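/- arXiv:1709.04027 — 3 statements merged into one kernel-verified Lean document; each statement's English description precedes it below -/
import Mathlib

section
/- Let G be a graph of maximum degree at most Δ, L an edge list assignment with |L(e)| ≥ Δ + t (t ≥ 1), H a subgraph of maximum degree at most d that is L-edge-precoloured. Suppose the precolouring extends to G - e for every edge e ∈ E(G) \ E(H) but not to G. Let A = V_{[a₀,a]} and B = V_{[b₀,Δ]} with a₀ ≥ t + 1, b₀ > a, and a + b₀ ≥ Δ + t + 1, and let X be the bipartite subgraph of G - E(H) induced by (A, B). If deg_X(u) ≥ deg_G(u) - d for every u ∈ A, then (t + 1 - d)|A| ≤ Σ_{i=b₀}^{Δ} (a + i - 1 - (Δ + t))|V_i|. -/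
open SimpleGraph

/-- The degree of a vertex: the number of neighbours. -/
noncomputable def edeg {V : Type} (G : SimpleGraph V) (v : V) : ℕ :=
  (G.neighborSet v).ncard

/-- Two edges (as unordered pairs) are adjacent if they are distinct and share a vertex. -/
def EdgeAdj {V : Type} (e f : Sym2 V) : Prop := e ≠ f ∧ ∃ v, v ∈ e ∧ v ∈ f

/-- A proper edge colouring of `G` in which every edge receives a colour from its list. -/
def IsListEdgeColoring {V : Type} (G : SimpleGraph V) (L : Sym2 V → Finset ℕ)
    (C : Sym2 V → ℕ) : Prop :=
  (∀ e ∈ G.edgeSet, C e ∈ L e) ∧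
  ∀ e ∈ G.edgeSet, ∀ f ∈ G.edgeSet, EdgeAdj e f → C e ≠ C f

/-- The precolouring `C₀` of the subgraph `H` extends to a proper `L`-edge-colouring of `G`. -/
def ExtendsTo {V : Type} (G H : SimpleGraph V) (L : Sym2 V → Finset ℕ)
    (C₀ : Sym2 V → ℕ) : Prop :=
  ∃ C, IsListEdgeColoring G L C ∧ ∀ e ∈ H.edgeSet, C e = C₀ e

/-- degree on the left side -/
def dgL {V : Type} [DecidableEq V] (E : Finset (V × V)) (u : V) : ℕ :=
  (E.filter (fun e => e.1 = u)).card

/-- degree on the right side -/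
def dgR {V : Type} [DecidableEq V] (E : Finset (V × V)) (u : V) : ℕ :=
  (E.filter (fun e => e.2 = u)).card

theorem kernel_exists {V : Type} [DecidableEq V] (r q : V × V → ℤ) (n : ℕ) :
    ∀ E : Finset (V × V), E.card = n →
    (∀ e ∈ E, ∀ f ∈ E, e.1 = f.1 → r e = r f → e = f) →
    (∀ e ∈ E, ∀ f ∈ E, e.2 = f.2 → q e = q f → e = f) →
    ∃ M ⊆ E, (∀ e ∈ M, ∀ f ∈ M, (e.1 = f.1 ∨ e.2 = f.2) → e = f) ∧
      ∀ e ∈ E, e ∉ M → ∃ f ∈ M, (f.1 = e.1 ∧ r f < r e) ∨ (f.2 = e.2 ∧ q f < q e) := by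
  induction n with
  | zero =>
    intro E hE _ _
    rw [Finset.card_eq_zero] at hE
    subst hE
    exact ⟨∅, by simp, by simp, by simp⟩
  | succ n ih =>
    intro E hE hr hq
    by_cases h : ∃ e ∈ E, ∃ f ∈ E, e ≠ f ∧ e.2 = f.2 ∧ (∀ g ∈ E, g.1 = e.1 → r e ≤ r g) ∧ q e < q f
    · obtain ⟨e, he, f, hf, hne, h2, hbest, hlt⟩ := h
      obtain ⟨M, hM, hmat, hdom⟩ := ih (E.erase f) (by rw [Finset.card_erase_of_mem hf, hE]; rfl)
        (fun a ha b hb => hr a (Finset.mem_of_mem_erase ha) b (Finset.mem_of_mem_erase hb))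
        (fun a ha b hb => hq a (Finset.mem_of_mem_erase ha) b (Finset.mem_of_mem_erase hb))
      refine ⟨M, hM.trans (Finset.erase_subset _ _), hmat, ?_⟩
      intro x hx hxM
      by_cases hxf : x = f
      · subst hxf
        by_cases heM : e ∈ M
        · exact ⟨e, heM, Or.inr ⟨h2, hlt⟩⟩
        · obtain ⟨g, hg, hg'⟩ := hdom e (Finset.mem_erase.2 ⟨hne, he⟩) heM
          have := hbest g (Finset.mem_of_mem_erase (hM hg))
          refine ⟨g, hg, Or.inr ?_⟩
          rcases hg' with hg' | hg'
          · have := this hg'.1; omega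
          · exact ⟨hg'.1.trans h2, hg'.2.trans hlt⟩
      · exact hdom x (Finset.mem_erase.2 ⟨hxf, hx⟩) hxM
    · push Not at h
      refine ⟨E.filter (fun e => ∀ g ∈ E, g.1 = e.1 → r e ≤ r g), Finset.filter_subset _ _, ?_, ?_⟩
      · intro e he f hf hef
        rw [Finset.mem_filter] at he hf
        rcases hef with h1 | h2
        · exact hr e he.1 f hf.1 h1 (le_antisymm (he.2 f hf.1 h1.symm) (hf.2 e he.1 h1))
        · by_contra hne
          have a1 := h e he.1 f hf.1 hne h2 he.2
          have a2 := h f hf.1 e he.1 (Ne.symm hne) h2.symm hf.2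
          exact hne (hq e he.1 f hf.1 h2 (le_antisymm a2 a1))
      · intro e he heM
        obtain ⟨f, hf, hmin⟩ := Finset.exists_min_image (E.filter (fun g => g.1 = e.1)) r
          ⟨e, by simp [he]⟩
        rw [Finset.mem_filter] at hf
        have hfM : f ∈ E.filter (fun e => ∀ g ∈ E, g.1 = e.1 → r e ≤ r g) := by
          rw [Finset.mem_filter]
          exact ⟨hf.1, fun g hg hgf => hmin g (by simp [hg, hgf, hf.2])⟩
        refine ⟨f, hfM, Or.inl ⟨hf.2, ?_⟩⟩
        have h1 := hmin e (by simp [he])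
        rcases h1.lt_or_eq with h1 | h1
        · exact h1
        · exact absurd (hr f hf.1 e he hf.2 h1 ▸ hfM) heM

/-- number of preferred edges at both ends -/
def pref {V : Type} [DecidableEq V] (r q : V × V → ℤ) (E : Finset (V × V)) (e : V × V) : ℕ :=
  (E.filter (fun f => f.1 = e.1 ∧ r f < r e)).card +
    (E.filter (fun f => f.2 = e.2 ∧ q f < q e)).card

theorem galvin {V : Type} [DecidableEq V] (r q : V × V → ℤ) (n : ℕ) :
    ∀ (E : Finset (V × V)) (L : V × V → Finset ℕ), E.card ≤ n →
    (∀ e ∈ E, ∀ f ∈ E, e.1 = f.1 → r e = r f → e = f) →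
    (∀ e ∈ E, ∀ f ∈ E, e.2 = f.2 → q e = q f → e = f) →
    (∀ e ∈ E, pref r q E e < (L e).card) →
    ∃ c : V × V → ℕ, (∀ e ∈ E, c e ∈ L e) ∧
      ∀ e ∈ E, ∀ f ∈ E, e ≠ f → (e.1 = f.1 ∨ e.2 = f.2) → c e ≠ c f := by
  induction n with
  | zero =>
    intro E L hE _ _ _
    rw [Nat.le_zero, Finset.card_eq_zero] at hE
    subst hE
    exact ⟨fun _ => 0, by simp, by simp⟩
  | succ n ih =>
    intro E L hE hr hq hL
    rcases E.eq_empty_or_nonempty with h0 | ⟨e0, he0⟩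
    · subst h0
      exact ⟨fun _ => 0, by simp, by simp⟩
    obtain ⟨k, hk⟩ : (L e0).Nonempty := by
      rw [← Finset.card_pos]; have := hL e0 he0; omega
    obtain ⟨M, hM, hmat, hdom⟩ := kernel_exists r q _ (E.filter (fun e => k ∈ L e)) rfl
      (fun a ha b hb => hr a (Finset.mem_filter.1 ha).1 b (Finset.mem_filter.1 hb).1)
      (fun a ha b hb => hq a (Finset.mem_filter.1 ha).1 b (Finset.mem_filter.1 hb).1)
    have hME : M ⊆ E := hM.trans (Finset.filter_subset _ _)
    have hMne : M.Nonempty := by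
      by_cases h : e0 ∈ M
      · exact ⟨_, h⟩
      · obtain ⟨f, hf, _⟩ := hdom e0 (by simp [he0, hk]) h
        exact ⟨f, hf⟩
    have hcard : (E \ M).card ≤ n := by
      have := Finset.card_sdiff_add_card_eq_card hME
      have := hMne.card_pos
      omega
    obtain ⟨c, hc1, hc2⟩ := ih (E \ M) (fun e => (L e).erase k) hcard
      (fun a ha b hb => hr a (Finset.mem_sdiff.1 ha).1 b (Finset.mem_sdiff.1 hb).1)
      (fun a ha b hb => hq a (Finset.mem_sdiff.1 ha).1 b (Finset.mem_sdiff.1 hb).1)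
      (by
        intro e he
        rw [Finset.mem_sdiff] at he
        have h1 : (E \ M).filter (fun f => f.1 = e.1 ∧ r f < r e) ⊆
          E.filter (fun f => f.1 = e.1 ∧ r f < r e) :=
            Finset.filter_subset_filter _ Finset.sdiff_subset
        have h2 : (E \ M).filter (fun f => f.2 = e.2 ∧ q f < q e) ⊆
          E.filter (fun f => f.2 = e.2 ∧ q f < q e) :=
            Finset.filter_subset_filter _ Finset.sdiff_subset
        have h1' := Finset.card_le_card h1
        have h2' := Finset.card_le_card h2
        have hLe := hL e he.1
        unfold pref at hLe ⊢
        by_cases hke : k ∈ L e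
        · rw [Finset.card_erase_of_mem hke]
          obtain ⟨f, hf, hf'⟩ := hdom e (by simp [he.1, hke]) he.2
          rcases hf' with hf' | hf'
          · have : ((E \ M).filter (fun f => f.1 = e.1 ∧ r f < r e)).card <
              (E.filter (fun f => f.1 = e.1 ∧ r f < r e)).card := by
              apply Finset.card_lt_card
              refine ⟨h1, fun hh => ?_⟩
              have := hh (Finset.mem_filter.2 ⟨hME hf, hf'⟩)
              simp [hf] at this
            omega
          · have : ((E \ M).filter (fun f => f.2 = e.2 ∧ q f < q e)).card <
              (E.filter (fun f => f.2 = e.2 ∧ q f < q e)).card := by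
              apply Finset.card_lt_card
              refine ⟨h2, fun hh => ?_⟩
              have := hh (Finset.mem_filter.2 ⟨hME hf, hf'⟩)
              simp [hf] at this
            omega
        · rw [Finset.erase_eq_of_notMem hke]
          omega)
    refine ⟨fun e => if e ∈ M then k else c e, ?_, ?_⟩
    · intro e he
      dsimp only
      split_ifs with h
      · exact (Finset.mem_filter.1 (hM h)).2
      · exact Finset.mem_of_mem_erase (hc1 e (by simp [he, h]))
    · intro e he f hf hne hadj
      dsimp only
      split_ifs with h h' h'
      · exact absurd (hmat e h f h' hadj) hne
      · exact (Finset.ne_of_mem_erase (hc1 f (by simp [hf, h']))).symm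
      · exact Finset.ne_of_mem_erase (hc1 e (by simp [he, h]))
      · exact hc2 e (by simp [he, h]) f (by simp [hf, h']) hne hadj

/-- existence of good preferences -/
def GoodE {V : Type} [DecidableEq V] (E : Finset (V × V)) : Prop :=
  ∃ r q : V × V → ℤ, (∀ e ∈ E, ∀ f ∈ E, e.1 = f.1 → r e = r f → e = f) ∧
    (∀ e ∈ E, ∀ f ∈ E, e.2 = f.2 → q e = q f → e = f) ∧
    (∀ e ∈ E, pref r q E e < max (dgL E e.1) (dgR E e.2))

theorem dgL_swap {V : Type} [DecidableEq V] (E : Finset (V × V)) (u : V) :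
    dgL (E.image Prod.swap) u = dgR E u := by
  unfold dgL dgR
  rw [Finset.filter_image, Finset.card_image_of_injective _ Prod.swap_injective]
  rfl

theorem dgR_swap {V : Type} [DecidableEq V] (E : Finset (V × V)) (u : V) :
    dgR (E.image Prod.swap) u = dgL E u := by
  unfold dgL dgR
  rw [Finset.filter_image, Finset.card_image_of_injective _ Prod.swap_injective]
  rfl

theorem swap_swap_image {V : Type} [DecidableEq V] (E : Finset (V × V)) :
    (E.image Prod.swap).image Prod.swap = E := by
  rw [Finset.image_image]; simp

theorem GoodE.swap {V : Type} [DecidableEq V] {E : Finset (V × V)} (h : GoodE E) :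
    GoodE (E.image Prod.swap) := by
  obtain ⟨r, q, hr, hq, hp⟩ := h
  refine ⟨q ∘ Prod.swap, r ∘ Prod.swap, ?_, ?_, ?_⟩
  · intro e he f hf h1 h2
    simp only [Finset.mem_image] at he hf
    obtain ⟨e, he, rfl⟩ := he
    obtain ⟨f, hf, rfl⟩ := hf
    rw [hq e he f hf h1 (by simpa using h2)]
  · intro e he f hf h1 h2
    simp only [Finset.mem_image] at he hf
    obtain ⟨e, he, rfl⟩ := he
    obtain ⟨f, hf, rfl⟩ := hf
    rw [hr e he f hf h1 (by simpa using h2)]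
  · intro e he
    simp only [Finset.mem_image] at he
    obtain ⟨e, he, rfl⟩ := he
    have := hp e he
    rw [dgL_swap, dgR_swap, max_comm]
    refine lt_of_eq_of_lt ?_ this
    unfold pref
    rw [Finset.filter_image, Finset.card_image_of_injective _ Prod.swap_injective,
      Finset.filter_image, Finset.card_image_of_injective _ Prod.swap_injective, add_comm]
    simp

theorem hall' {V : Type} [DecidableEq V] (X : Finset V) (t : V → Finset V)
    (h : ∀ S ⊆ X, S.card ≤ (S.biUnion t).card) :
    ∃ f : V → V, Set.InjOn f X ∧ ∀ x ∈ X, f x ∈ t x := by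
  obtain ⟨f, hf, hf'⟩ := (Finset.all_card_le_biUnion_card_iff_exists_injective
    (fun x : X => t x.1)).1 (by
      intro s
      have := h (s.map (Function.Embedding.subtype _)) (by
        intro x hx
        simp only [Finset.mem_map] at hx
        obtain ⟨y, _, rfl⟩ := hx
        exact y.2)
      rw [Finset.card_map] at this
      refine this.trans (Finset.card_le_card ?_)
      intro x hx
      simp only [Finset.mem_biUnion, Finset.mem_map] at hx ⊢
      obtain ⟨_, ⟨y, hy, rfl⟩, hx⟩ := hx
      exact ⟨y, hy, hx⟩)
  refine ⟨fun x => if h : x ∈ X then f ⟨x, h⟩ else x, ?_, ?_⟩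
  · intro x hx y hy hxy
    have hx' : x ∈ X := hx
    have hy' : y ∈ X := hy
    simp only [hx', hy', dif_pos] at hxy
    simpa using hf hxy
  · intro x hx
    simp only [hx, dif_pos]
    exact hf' ⟨x, hx⟩

/-- the alternating closure -/
inductive AltC {V : Type} (X Q : Set V) (f g : V → V) : V → Prop
  | base (q : V) : q ∈ Q → (∀ s ∈ X, f s ≠ q) → AltC X Q f g (g q)
  | step (s : V) : s ∈ X → AltC X Q f g s → f s ∈ Q → AltC X Q f g (g (f s))

theorem mendelsohn {V : Type} (X Q : Set V) (f g : V → V) (hf : Set.InjOn f X)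
    (hg : Set.InjOn g Q) (hgX : ∀ q ∈ Q, g q ∈ X) :
    ∃ h : V → V, Set.InjOn h X ∧ (∀ q ∈ Q, ∃ s ∈ X, h s = q) ∧
      ∀ s ∈ X, h s = f s ∨ (h s ∈ Q ∧ g (h s) = s) := by
  classical
  have key : ∀ s, AltC X Q f g s → ∃ q ∈ Q, g q = s ∧ ∀ s' ∈ X, f s' = q → AltC X Q f g s' := by
    intro s hs
    cases hs with
    | base q hq hn => exact ⟨q, hq, rfl, fun s' hs' h => absurd h (hn s' hs')⟩
    | step s hs hs2 hq => exact ⟨f s, hq, rfl, fun s' hs' h => hf hs' hs h ▸ hs2⟩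
  choose! k hk1 hk2 hk3 using key
  refine ⟨fun s => if AltC X Q f g s then k s else f s, ?_, ?_, ?_⟩
  · intro x hx y hy hxy
    dsimp only at hxy
    split_ifs at hxy with h1 h2 h2
    · rw [← hk2 x h1, ← hk2 y h2, hxy]
    · exact absurd (hk3 x h1 y hy hxy.symm) h2
    · exact absurd (hk3 y h2 x hx hxy) h1
    · exact hf hx hy hxy
  · intro q hq
    by_cases h : AltC X Q f g (g q)
    · refine ⟨g q, hgX q hq, ?_⟩
      simp only [h, if_true]
      exact hg (hk1 _ h) hq (hk2 _ h)
    · by_cases h' : ∀ s ∈ X, f s ≠ q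
      · exact absurd (AltC.base q hq h') h
      · push Not at h'
        obtain ⟨s, hs, rfl⟩ := h'
        refine ⟨s, hs, ?_⟩
        have : ¬ AltC X Q f g s := fun hh => h (AltC.step s hs hh hq)
        simp [this]
  · intro s hs
    dsimp only
    split_ifs with h
    · exact Or.inr ⟨hk1 s h, hk2 s h⟩
    · exact Or.inl rfl

/-- right neighbourhood of a left set -/
def nbR {V : Type} [DecidableEq V] (E : Finset (V × V)) (X : Finset V) : Finset V :=
  (E.filter (fun e => e.1 ∈ X)).image Prod.snd

/-- left neighbourhood of a right set -/
def nbL {V : Type} [DecidableEq V] (E : Finset (V × V)) (X : Finset V) : Finset V :=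
  (E.filter (fun e => e.2 ∈ X)).image Prod.fst

theorem mem_nbR {V : Type} [DecidableEq V] {E : Finset (V × V)} {X : Finset V} {v : V} :
    v ∈ nbR E X ↔ ∃ u ∈ X, (u, v) ∈ E := by
  unfold nbR
  simp only [Finset.mem_image, Finset.mem_filter]
  constructor
  · rintro ⟨⟨a, b⟩, ⟨h1, h2⟩, rfl⟩
    exact ⟨a, h2, h1⟩
  · rintro ⟨u, h1, h2⟩
    exact ⟨(u, v), ⟨h2, h1⟩, rfl⟩

theorem mem_nbL {V : Type} [DecidableEq V] {E : Finset (V × V)} {X : Finset V} {v : V} :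
    v ∈ nbL E X ↔ ∃ u ∈ X, (v, u) ∈ E := by
  unfold nbL
  simp only [Finset.mem_image, Finset.mem_filter]
  constructor
  · rintro ⟨⟨a, b⟩, ⟨h1, h2⟩, rfl⟩
    exact ⟨b, h2, h1⟩
  · rintro ⟨u, h1, h2⟩
    exact ⟨(v, u), ⟨h2, h1⟩, rfl⟩

theorem nbR_swap {V : Type} [DecidableEq V] (E : Finset (V × V)) (X : Finset V) :
    nbR (E.image Prod.swap) X = nbL E X := by
  ext v
  simp [mem_nbR, mem_nbL]

theorem nbL_swap {V : Type} [DecidableEq V] (E : Finset (V × V)) (X : Finset V) :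
    nbL (E.image Prod.swap) X = nbR E X := by
  ext v
  simp [mem_nbR, mem_nbL]

/-- reducing matching -/
def Reduct {V : Type} [DecidableEq V] (E : Finset (V × V)) (D : ℕ) : Prop :=
  ∃ M ⊆ E, ∃ S : Finset V, M.Nonempty ∧ (∀ e ∈ M, e.1 ∈ S) ∧
    (∀ s ∈ S, dgL E s = D ∧ ∃ e ∈ M, e.1 = s) ∧
    (∀ e ∈ M, ∀ f ∈ M, (e.1 = f.1 ∨ e.2 = f.2) → e = f) ∧
    ∀ e ∈ E, e.1 ∈ S → dgR E e.2 = D → ∃ f ∈ M, f.2 = e.2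

theorem hall_degree {V : Type} [DecidableEq V] (E : Finset (V × V)) (D : ℕ) (hD : 1 ≤ D)
    (hR : ∀ v, dgR E v ≤ D) (X : Finset V) (hX : ∀ x ∈ X, dgL E x = D) :
    X.card ≤ (nbR E X).card := by
  have h1 : (E.filter (fun e => e.1 ∈ X)).card = ∑ x ∈ X, dgL E x := by
    rw [Finset.card_eq_sum_card_fiberwise (f := Prod.fst) (t := X)]
    · apply Finset.sum_congr rfl
      intro x hx
      unfold dgL
      congr 1
      ext e
      simp only [Finset.mem_filter]
      constructor
      · rintro ⟨⟨a, b⟩, c⟩; exact ⟨a, c⟩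
      · rintro ⟨a, c⟩; exact ⟨⟨a, c ▸ hx⟩, c⟩
    · intro e he
      simp at he
      exact he.2
  have h2 : (E.filter (fun e => e.1 ∈ X)).card ≤ ∑ y ∈ nbR E X, dgR E y := by
    rw [Finset.card_eq_sum_card_fiberwise (f := Prod.snd) (t := nbR E X)]
    · apply Finset.sum_le_sum
      intro x hx
      unfold dgR
      apply Finset.card_le_card
      intro e
      simp only [Finset.mem_filter]
      rintro ⟨⟨a, b⟩, c⟩; exact ⟨a, c⟩
    · intro e he
      exact Finset.mem_image_of_mem _ he
  rw [h1, Finset.sum_congr rfl hX] at h2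
  have h3 : ∑ y ∈ nbR E X, dgR E y ≤ ∑ y ∈ nbR E X, D := Finset.sum_le_sum (fun y _ => hR y)
  have h4 := h2.trans h3
  simp only [Finset.sum_const, smul_eq_mul] at h4
  exact Nat.le_of_mul_le_mul_right h4 hD

theorem reduct_of_hall {V : Type} [DecidableEq V] (E : Finset (V × V)) (D : ℕ) (hD : 1 ≤ D)
    (hR : ∀ v, dgR E v ≤ D) (X : Finset V) (hXne : X.Nonempty) (hX : ∀ x ∈ X, dgL E x = D)
    (hH : ∀ Y ⊆ nbR E X, (∀ y ∈ Y, dgR E y = D) → Y.card ≤ (nbL E Y ∩ X).card) :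
    Reduct E D := by
  obtain ⟨f, hf, hf'⟩ := hall' X (fun x => nbR E {x}) (by
    intro S hS
    refine (hall_degree E D hD hR S (fun x hx => hX x (hS hx))).trans (Finset.card_le_card ?_)
    intro v hv
    simpa [mem_nbR] using hv)
  obtain ⟨g, hg, hg'⟩ := hall' ((nbR E X).filter (fun y => dgR E y = D))
    (fun y => nbL E {y} ∩ X) (by
    intro S hS
    refine (hH S (fun x hx => (Finset.mem_filter.1 (hS hx)).1)
      (fun x hx => (Finset.mem_filter.1 (hS hx)).2)).trans (Finset.card_le_card ?_)
    intro v hv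
    rw [Finset.mem_inter, mem_nbL] at hv
    obtain ⟨⟨u, hu, huE⟩, hvX⟩ := hv
    exact Finset.mem_biUnion.2 ⟨u, hu, Finset.mem_inter.2 ⟨mem_nbL.2 ⟨u, by simp, huE⟩, hvX⟩⟩)
  obtain ⟨h, h1, h2, h3⟩ := mendelsohn _ _ f g hf hg
    (fun q hq => (Finset.mem_inter.1 (hg' q hq)).2)
  have hE : ∀ x ∈ X, (x, h x) ∈ E := by
    intro x hx
    rcases h3 x hx with h4 | h4
    · have := hf' x hx
      rw [h4]; simpa [mem_nbR] using this
    · have := (Finset.mem_inter.1 (hg' _ h4.1)).1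
      rw [h4.2] at this
      simpa [mem_nbL] using this
  refine ⟨X.image (fun x => (x, h x)), ?_, X, hXne.image _, ?_, ?_, ?_, ?_⟩
  · intro e he
    obtain ⟨x, hx, rfl⟩ := Finset.mem_image.1 he
    exact hE x hx
  · intro e he
    obtain ⟨x, hx, rfl⟩ := Finset.mem_image.1 he
    exact hx
  · intro s hs
    exact ⟨hX s hs, (s, h s), Finset.mem_image_of_mem _ hs, rfl⟩
  · intro e he f hf hef
    obtain ⟨x, hx, rfl⟩ := Finset.mem_image.1 he
    obtain ⟨y, hy, rfl⟩ := Finset.mem_image.1 hf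
    have : x = y := by
      rcases hef with h | h
      · exact h
      · exact h1 hx hy h
    rw [this]
  · intro e he heX hed
    obtain ⟨s, hs, hs'⟩ := h2 e.2 (by
      simp only [Finset.coe_filter, Set.mem_ofPred_eq]
      exact ⟨mem_nbR.2 ⟨e.1, heX, he⟩, hed⟩)
    exact ⟨(s, h s), Finset.mem_image_of_mem _ hs, hs'⟩

theorem reduct_exists {V : Type} [Fintype V] [DecidableEq V] (E : Finset (V × V)) (D : ℕ)
    (hD : 1 ≤ D) (hL : ∀ v, dgL E v ≤ D) (hR : ∀ v, dgR E v ≤ D)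
    (hex : ∃ v, dgL E v = D ∨ dgR E v = D) :
    Reduct E D ∨ Reduct (E.image Prod.swap) D := by
  set U : Finset V := Finset.univ.filter (fun v => dgL E v = D) with hU
  set T : Finset V := Finset.univ.filter (fun v => dgR E v = D) with hT
  obtain ⟨X, hX, hmax⟩ := Finset.exists_max_image U.powerset
    (fun X => (X.card : ℤ) - ((nbR E X ∩ T).card : ℤ)) ⟨∅, by simp⟩
  rw [Finset.mem_powerset] at hX
  by_cases hpos : 0 < (X.card : ℤ) - ((nbR E X ∩ T).card : ℤ)
  · left
    refine reduct_of_hall E D hD hR X ?_ (fun x hx => (Finset.mem_filter.1 (hX hx)).2) ?_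
    · rw [← Finset.card_pos]; omega
    · intro Y hY hYD
      by_contra hlt
      push Not at hlt
      have := hmax (X \ nbL E Y) (Finset.mem_powerset.2 (Finset.sdiff_subset.trans hX))
      have c1 : (nbR E (X \ nbL E Y) ∩ T).card + Y.card ≤ (nbR E X ∩ T).card := by
        rw [← Finset.card_union_of_disjoint]
        · apply Finset.card_le_card
          intro v hv
          rw [Finset.mem_union] at hv
          rcases hv with hv | hv
          · rw [Finset.mem_inter, mem_nbR] at hv ⊢
            obtain ⟨⟨u, hu, huE⟩, hv⟩ := hv
            exact ⟨⟨u, (Finset.mem_sdiff.1 hu).1, huE⟩, hv⟩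
          · exact Finset.mem_inter.2 ⟨hY hv, by simp [hT, hYD v hv]⟩
        · rw [Finset.disjoint_left]
          intro v hv hvY
          rw [Finset.mem_inter, mem_nbR] at hv
          obtain ⟨⟨u, hu, huE⟩, hv⟩ := hv
          exact (Finset.mem_sdiff.1 hu).2 (mem_nbL.2 ⟨v, hvY, huE⟩)
      have c2 : (X \ nbL E Y).card + (nbL E Y ∩ X).card = X.card := by
        rw [add_comm]
        rw [Finset.inter_comm]; exact Finset.card_inter_add_card_sdiff _ _
      omega
  · have hall : ∀ Y ⊆ U, Y.card ≤ (nbR E Y ∩ T).card := by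
      intro Y hY
      have := hmax Y (Finset.mem_powerset.2 hY)
      omega
    by_cases hTne : T.Nonempty
    · right
      refine reduct_of_hall _ D hD (fun v => by rw [dgR_swap]; exact hL v) T hTne
        (fun x hx => by rw [dgL_swap]; exact (Finset.mem_filter.1 hx).2) ?_
      intro Y hY hYD
      rw [nbL_swap]
      apply hall
      intro y hy
      have := hYD y hy
      rw [dgR_swap] at this
      simp [hU, this]
    · left
      have hTz : ∀ v, dgR E v ≠ D := by
        intro v hv
        exact hTne ⟨v, by simp [hT, hv]⟩
      obtain ⟨v, hv⟩ := hex
      have hv : dgL E v = D := hv.resolve_right (hTz v)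
      refine reduct_of_hall E D hD hR U ⟨v, by simp [hU, hv]⟩
        (fun x hx => (Finset.mem_filter.1 hx).2) ?_
      intro Y hY hYD
      have : Y = ∅ := by
        rw [Finset.eq_empty_iff_forall_notMem]
        intro y hy
        exact hTz y (hYD y hy)
      simp [this]

theorem dgL_mono {V : Type} [DecidableEq V] {E F : Finset (V × V)} (h : F ⊆ E) (u : V) :
    dgL F u ≤ dgL E u := Finset.card_le_card (Finset.filter_subset_filter _ h)

theorem dgR_mono {V : Type} [DecidableEq V] {E F : Finset (V × V)} (h : F ⊆ E) (u : V) :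
    dgR F u ≤ dgR E u := Finset.card_le_card (Finset.filter_subset_filter _ h)

theorem dgL_sdiff_lt {V : Type} [DecidableEq V] {E M : Finset (V × V)} (h : M ⊆ E)
    {f : V × V} (hf : f ∈ M) : dgL (E \ M) f.1 < dgL E f.1 := by
  apply Finset.card_lt_card
  refine ⟨Finset.filter_subset_filter _ Finset.sdiff_subset, fun hh => ?_⟩
  have := hh (Finset.mem_filter.2 ⟨h hf, rfl⟩)
  simp [hf] at this

theorem dgR_sdiff_lt {V : Type} [DecidableEq V] {E M : Finset (V × V)} (h : M ⊆ E)
    {f : V × V} (hf : f ∈ M) : dgR (E \ M) f.2 < dgR E f.2 := by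
  apply Finset.card_lt_card
  refine ⟨Finset.filter_subset_filter _ Finset.sdiff_subset, fun hh => ?_⟩
  have := hh (Finset.mem_filter.2 ⟨h hf, rfl⟩)
  simp [hf] at this

theorem exists_bound {V : Type} (E : Finset (V × V)) (r : V × V → ℤ) :
    ∃ K : ℤ, ∀ e ∈ E, |r e| < K := by
  refine ⟨∑ e ∈ E, |r e| + 1, fun e he => ?_⟩
  have := Finset.single_le_sum (f := fun e => |r e|) (fun i _ => abs_nonneg (r i)) he
  omega

theorem good_of_reduct {V : Type} [DecidableEq V] (E : Finset (V × V)) (D : ℕ)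
    (hR : ∀ v, dgR E v ≤ D) (hred : Reduct E D)
    (ih : ∀ M ⊆ E, M.Nonempty → GoodE (E \ M)) : GoodE E := by
  obtain ⟨M, hME, S, hMne, hMS, hS, hmat, hcov⟩ := hred
  obtain ⟨r, q, hr, hq, hp⟩ := ih M hME hMne
  obtain ⟨K1, hK1⟩ := exists_bound E r
  obtain ⟨K2, hK2⟩ := exists_bound E q
  have hb1 : ∀ e ∈ E, -K1 < r e := fun e he => (abs_lt.1 (hK1 e he)).1
  have hb2 : ∀ e ∈ E, q e < K2 := fun e he => (abs_lt.1 (hK2 e he)).2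
  refine ⟨fun e => if e ∈ M then -K1 else r e, fun e => if e ∈ M then K2 else q e, ?_, ?_, ?_⟩
  · intro e he f hf h1 h2
    dsimp only at h2
    split_ifs at h2 with a b b
    · exact hmat e a f b (Or.inl h1)
    · have := hb1 f hf; omega
    · have := hb1 e he; omega
    · exact hr e (by simp [he, a]) f (by simp [hf, b]) h1 h2
  · intro e he f hf h1 h2
    dsimp only at h2
    split_ifs at h2 with a b b
    · exact hmat e a f b (Or.inr h1)
    · have := hb2 f hf; omega
    · have := hb2 e he; omega
    · exact hq e (by simp [he, a]) f (by simp [hf, b]) h1 h2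
  · intro e he
    unfold pref
    by_cases heM : e ∈ M
    · simp only [heM, if_true]
      have e1 : E.filter (fun f => f.1 = e.1 ∧ (if f ∈ M then -K1 else r f) < -K1) = ∅ := by
        rw [Finset.filter_eq_empty_iff]
        intro f hf hh
        have := hb1 f hf
        have h2 := hh.2
        split_ifs at h2 <;> omega
      rw [e1]
      have e2 : (E.filter (fun f => f.2 = e.2 ∧ (if f ∈ M then K2 else q f) < K2)).card
          < dgR E e.2 := by
        apply Finset.card_lt_card
        refine ⟨fun f hf => ?_, fun hh => ?_⟩
        · rw [Finset.mem_filter] at hf ⊢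
          exact ⟨hf.1, hf.2.1⟩
        · have := hh (Finset.mem_filter.2 ⟨he, rfl⟩)
          simp [heM] at this
      rw [Finset.card_empty, zero_add]
      exact lt_of_lt_of_le e2 (le_max_right _ _)
    · simp only [heM, if_false]
      have heE : e ∈ E \ M := by simp [he, heM]
      have hpe := hp e heE
      unfold pref at hpe
      have e2 : E.filter (fun f => f.2 = e.2 ∧ (if f ∈ M then K2 else q f) < q e) ⊆
          (E \ M).filter (fun f => f.2 = e.2 ∧ q f < q e) := by
        intro f hf
        rw [Finset.mem_filter] at hf ⊢
        obtain ⟨hf, h1, h2⟩ := hf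
        have := hb2 e he
        split_ifs at h2 with h
        · omega
        · exact ⟨by simp [hf, h], h1, h2⟩
      have e1 : E.filter (fun f => f.1 = e.1 ∧ (if f ∈ M then -K1 else r f) < r e) ⊆
          (E \ M).filter (fun f => f.1 = e.1 ∧ r f < r e) ∪ M.filter (fun f => f.1 = e.1) := by
        intro f hf
        rw [Finset.mem_union, Finset.mem_filter, Finset.mem_filter]
        rw [Finset.mem_filter] at hf
        obtain ⟨hf, h1, h2⟩ := hf
        split_ifs at h2 with h
        · exact Or.inr ⟨h, h1⟩
        · exact Or.inl ⟨by simp [hf, h], h1, h2⟩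
      have e1' := (Finset.card_le_card e1).trans (Finset.card_union_le _ _)
      have e2' := Finset.card_le_card e2
      by_cases heS : e.1 ∈ S
      · have m1 : (M.filter (fun f => f.1 = e.1)).card ≤ 1 := by
          rw [Finset.card_le_one]
          intro x hx y hy
          rw [Finset.mem_filter] at hx hy
          exact hmat x hx.1 y hy.1 (Or.inl (hx.2.trans hy.2.symm))
        obtain ⟨hD, f, hf, hfe⟩ := hS _ heS
        have d1 := dgL_sdiff_lt hME hf
        rw [hfe] at d1
        have d2 : dgR (E \ M) e.2 < D := by
          rcases (hR e.2).lt_or_eq with h | h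
          · exact lt_of_le_of_lt (dgR_mono Finset.sdiff_subset _) h
          · obtain ⟨g, hg, hge⟩ := hcov e he heS h
            have := dgR_sdiff_lt hME hg
            rw [hge] at this
            omega
        omega
      · have m0 : M.filter (fun f => f.1 = e.1) = ∅ := by
          rw [Finset.filter_eq_empty_iff]
          intro f hf h
          exact heS (h ▸ hMS f hf)
        rw [m0, Finset.card_empty] at e1'
        have d1 := dgL_mono (Finset.sdiff_subset : E \ M ⊆ E) e.1
        have d2 := dgR_mono (Finset.sdiff_subset : E \ M ⊆ E) e.2
        omega

theorem good_all {V : Type} [Fintype V] [DecidableEq V] (n : ℕ) :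
    ∀ E : Finset (V × V), E.card ≤ n → GoodE E := by
  induction n with
  | zero =>
    intro E hE
    rw [Nat.le_zero, Finset.card_eq_zero] at hE
    subst hE
    exact ⟨fun _ => 0, fun _ => 0, by simp, by simp, by simp⟩
  | succ n ih =>
    intro E hE
    rcases E.eq_empty_or_nonempty with h0 | ⟨e0, he0⟩
    · subst h0
      exact ⟨fun _ => 0, fun _ => 0, by simp, by simp, by simp⟩
    obtain ⟨m, _, hm⟩ := Finset.exists_max_image (Finset.univ : Finset V)
      (fun v => max (dgL E v) (dgR E v)) ⟨e0.1, Finset.mem_univ _⟩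
    set D := max (dgL E m) (dgR E m) with hDdef
    have hL : ∀ v, dgL E v ≤ D := fun v => (le_max_left _ _).trans (hm v (Finset.mem_univ _))
    have hR : ∀ v, dgR E v ≤ D := fun v => (le_max_right _ _).trans (hm v (Finset.mem_univ _))
    have hD : 1 ≤ D := by
      refine le_trans ?_ (hL e0.1)
      exact Finset.card_pos.2 ⟨e0, by simp [he0]⟩
    have hex : ∃ v, dgL E v = D ∨ dgR E v = D := by
      refine ⟨m, ?_⟩
      omega
    have key : ∀ F : Finset (V × V), F.card ≤ n + 1 → ∀ M ⊆ F, M.Nonempty → GoodE (F \ M) := by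
      intro F hF M hM hMne
      apply ih
      have := Finset.card_sdiff_add_card_eq_card hM
      have := hMne.card_pos
      omega
    rcases reduct_exists E D hD hL hR hex with h | h
    · exact good_of_reduct E D hR h (key E hE)
    · have := good_of_reduct _ D (fun v => by rw [dgR_swap]; exact hL v) h
        (key _ (Finset.card_image_le.trans hE))
      have := this.swap
      rwa [swap_swap_image] at this

/-- The bipartite list-edge-colouring theorem of Borodin, Kostochka and Woodall. -/
theorem bkw {V : Type} [Fintype V] [DecidableEq V] (E : Finset (V × V)) (L : V × V → Finset ℕ)
    (hL : ∀ e ∈ E, max (dgL E e.1) (dgR E e.2) ≤ (L e).card) :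
    ∃ c : V × V → ℕ, (∀ e ∈ E, c e ∈ L e) ∧
      ∀ e ∈ E, ∀ f ∈ E, e ≠ f → (e.1 = f.1 ∨ e.2 = f.2) → c e ≠ c f := by
  obtain ⟨r, q, hr, hq, hp⟩ := good_all _ E le_rfl
  exact galvin r q _ E L le_rfl hr hq (fun e he => lt_of_lt_of_le (hp e he) (hL e he))

theorem core_exists {V : Type} [DecidableEq V] (F : Finset (V × V)) (A B : Finset V)
    (α w : V → ℤ) (hF : ∀ e ∈ F, e.1 ∈ A ∧ e.2 ∈ B)
    (hα : ∀ u ∈ A, 0 ≤ α u) (hw : ∀ v ∈ B, 0 ≤ w v)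
    (hpos : 0 < (F.card : ℤ) - ∑ u ∈ A, α u - ∑ v ∈ B, w v) :
    ∃ E ⊆ F, E.Nonempty ∧ ∀ e ∈ E, α e.1 < dgL E e.1 ∧ w e.2 < dgR E e.2 := by
  set φ : Finset V × Finset V → ℤ := fun p =>
    ((F.filter (fun e => e.1 ∈ p.1 ∧ e.2 ∈ p.2)).card : ℤ) - ∑ u ∈ p.1, α u - ∑ v ∈ p.2, w v
    with hφ
  obtain ⟨⟨S, T⟩, hST, hmin⟩ := Finset.exists_min_image
    ((A.powerset ×ˢ B.powerset).filter (fun p => 0 < φ p)) (fun p => p.1.card + p.2.card)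
    ⟨(A, B), by
      simp only [Finset.mem_filter, Finset.mem_product, Finset.mem_powerset, Finset.Subset.refl,
        true_and, hφ]
      rw [Finset.filter_true_of_mem hF]
      exact hpos⟩
  simp only [Finset.mem_filter, Finset.mem_product, Finset.mem_powerset] at hST hmin
  obtain ⟨⟨hSA, hTB⟩, hST⟩ := hST
  refine ⟨F.filter (fun e => e.1 ∈ S ∧ e.2 ∈ T), Finset.filter_subset _ _, ?_, ?_⟩
  · rw [← Finset.card_pos]
    have h1 : 0 ≤ ∑ u ∈ S, α u := Finset.sum_nonneg (fun u hu => hα u (hSA hu))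
    have h2 : 0 ≤ ∑ u ∈ T, w u := Finset.sum_nonneg (fun u hu => hw u (hTB hu))
    simp only [hφ] at hST
    omega
  · intro e he
    obtain ⟨heF, he1, he2⟩ := Finset.mem_filter.1 he
    constructor
    · by_contra hlt
      push Not at hlt
      have c1 := Finset.card_erase_lt_of_mem he1
      have hs := Finset.add_sum_erase S α he1
      have hc : ((F.filter (fun e => e.1 ∈ S ∧ e.2 ∈ T)).card) ≤
          (F.filter (fun f => f.1 ∈ S.erase e.1 ∧ f.2 ∈ T)).card +
          dgL (F.filter (fun e => e.1 ∈ S ∧ e.2 ∈ T)) e.1 := by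
        refine le_trans (Finset.card_le_card ?_) (Finset.card_union_le _ _)
        intro f hf
        simp only [Finset.mem_union, Finset.mem_filter, Finset.mem_erase] at hf ⊢
        tauto
      have := hmin (S.erase e.1, T) ⟨⟨(Finset.erase_subset _ _).trans hSA, hTB⟩, by
        simp only [hφ] at hST ⊢
        omega⟩
      dsimp only at this
      omega
    · by_contra hlt
      push Not at hlt
      have c1 := Finset.card_erase_lt_of_mem he2
      have hs := Finset.add_sum_erase T w he2
      have hc : ((F.filter (fun e => e.1 ∈ S ∧ e.2 ∈ T)).card) ≤
          (F.filter (fun f => f.1 ∈ S ∧ f.2 ∈ T.erase e.2)).card +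
          dgR (F.filter (fun e => e.1 ∈ S ∧ e.2 ∈ T)) e.2 := by
        refine le_trans (Finset.card_le_card ?_) (Finset.card_union_le _ _)
        intro f hf
        simp only [Finset.mem_union, Finset.mem_filter, Finset.mem_erase] at hf ⊢
        tauto
      have := hmin (S, T.erase e.2) ⟨⟨hSA, (Finset.erase_subset _ _).trans hTB⟩, by
        simp only [hφ] at hST ⊢
        omega⟩
      dsimp only at this
      omega

/-- Recolouring a bipartite set of edges. -/
theorem recolour {V : Type} [Fintype V] [DecidableEq V] (G H : SimpleGraph V)
    (L : Sym2 V → Finset ℕ) (C₀ : Sym2 V → ℕ) (A B : Set V) (hAB : ∀ x ∈ A, x ∉ B)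
    (N : ℕ) (hL : ∀ e ∈ G.edgeSet, N ≤ (L e).card)
    (E : Finset (V × V)) (hE : ∀ e ∈ E, e.1 ∈ A ∧ e.2 ∈ B ∧ G.Adj e.1 e.2 ∧ ¬ H.Adj e.1 e.2)
    (hne : E.Nonempty)
    (hminus : ∀ u v, G.Adj u v → ¬ H.Adj u v →
      ExtendsTo (G.deleteEdges {s(u, v)}) H L C₀)
    (hcount : ∀ e ∈ E, edeg G e.1 + edeg G e.2 + max (dgL E e.1) (dgR E e.2) ≤
      N + dgL E e.1 + dgR E e.2) :
    ExtendsTo G H L C₀ := by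
  classical
  obtain ⟨e0, he0⟩ := hne
  obtain ⟨C', ⟨hC1, hC2⟩, hC3⟩ := hminus e0.1 e0.2 (hE e0 he0).2.2.1 (hE e0 he0).2.2.2
  set bad : V → Finset V := fun u =>
    Finset.univ.filter (fun x => G.Adj u x ∧ (u, x) ∉ E ∧ (x, u) ∉ E) with hbad
  have hdeg : ∀ u, edeg G u = (Finset.univ.filter (fun x => G.Adj u x)).card := by
    intro u
    unfold edeg
    rw [← Set.ncard_coe_finset]
    congr 1
    ext x
    simp
  have hb1 : ∀ e ∈ E, (bad e.1).card + dgL E e.1 ≤ edeg G e.1 := by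
    intro e he
    rw [hdeg]
    have : dgL E e.1 = ((E.filter (fun f => f.1 = e.1)).image Prod.snd).card := by
      rw [Finset.card_image_of_injOn]
      · rfl
      · intro x hx y hy hxy
        simp only [Finset.coe_filter, Set.mem_ofPred_eq] at hx hy
        exact Prod.ext (hx.2.trans hy.2.symm) hxy
    rw [this, ← Finset.card_union_of_disjoint]
    · apply Finset.card_le_card
      intro x hx
      simp only [hbad, Finset.mem_union, Finset.mem_filter, Finset.mem_univ, true_and,
        Finset.mem_image] at hx ⊢
      rcases hx with hx | ⟨f, ⟨hf, hfe⟩, rfl⟩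
      · exact hx.1
      · exact hfe ▸ (hE f hf).2.2.1
    · rw [Finset.disjoint_left]
      intro x hx hx'
      simp only [hbad, Finset.mem_filter, Finset.mem_univ, true_and, Finset.mem_image] at hx hx'
      obtain ⟨f, ⟨hf, hfe⟩, rfl⟩ := hx'
      exact hx.2.1 (hfe ▸ hf)
  have hb2 : ∀ e ∈ E, (bad e.2).card + dgR E e.2 ≤ edeg G e.2 := by
    intro e he
    rw [hdeg]
    have : dgR E e.2 = ((E.filter (fun f => f.2 = e.2)).image Prod.fst).card := by
      rw [Finset.card_image_of_injOn]
      · rfl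
      · intro x hx y hy hxy
        simp only [Finset.coe_filter, Set.mem_ofPred_eq] at hx hy
        exact Prod.ext hxy (hx.2.trans hy.2.symm)
    rw [this, ← Finset.card_union_of_disjoint]
    · apply Finset.card_le_card
      intro x hx
      simp only [hbad, Finset.mem_union, Finset.mem_filter, Finset.mem_univ, true_and,
        Finset.mem_image] at hx ⊢
      rcases hx with hx | ⟨f, ⟨hf, hfe⟩, rfl⟩
      · exact hx.1
      · exact hfe ▸ (hE f hf).2.2.1.symm
    · rw [Finset.disjoint_left]
      intro x hx hx'
      simp only [hbad, Finset.mem_filter, Finset.mem_univ, true_and, Finset.mem_image] at hx hx'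
      obtain ⟨f, ⟨hf, hfe⟩, rfl⟩ := hx'
      exact hx.2.2 (hfe ▸ hf)
  set fb : V → Finset ℕ := fun u => (bad u).image (fun x => C' s(u, x)) with hfb
  obtain ⟨c, hc1, hc2⟩ := bkw E (fun e => L s(e.1, e.2) \ (fb e.1 ∪ fb e.2)) (by
    intro e he
    have h1 := hb1 e he
    have h2 := hb2 e he
    have h3 := hcount e he
    have h4 := hL s(e.1, e.2) (hE e he).2.2.1
    have h5 : (fb e.1).card ≤ (bad e.1).card := Finset.card_image_le
    have h6 : (fb e.2).card ≤ (bad e.2).card := Finset.card_image_le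
    have h7 := Finset.card_union_le (fb e.1) (fb e.2)
    have h8 := Finset.le_card_sdiff (fb e.1 ∪ fb e.2) (L s(e.1, e.2))
    omega)
  -- uniqueness of representation
  have huniq : ∀ e ∈ E, ∀ f ∈ E, s(e.1, e.2) = s(f.1, f.2) → e = f := by
    intro e he f hf h
    rw [Sym2.eq_iff] at h
    rcases h with h | h
    · exact Prod.ext h.1 h.2
    · exact absurd (h.1 ▸ (hE f hf).2.1) (hAB _ (hE e he).1)
  set P : Sym2 V → Prop := fun x => ∃ e ∈ E, s(e.1, e.2) = x with hP
  set C : Sym2 V → ℕ := fun x => if h : P x then c h.choose else C' x with hC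
  have hCE : ∀ e ∈ E, C s(e.1, e.2) = c e := by
    intro e he
    have h : P s(e.1, e.2) := ⟨e, he, rfl⟩
    simp only [hC, h, dif_pos]
    rw [huniq _ h.choose_spec.1 e he h.choose_spec.2]
  have hCn : ∀ x, ¬ P x → C x = C' x := by
    intro x hx
    simp only [hC, hx, dif_neg, not_false_eq_true]
  have hedge : ∀ x ∈ G.edgeSet, ¬ P x → x ∈ (G.deleteEdges {s(e0.1, e0.2)}).edgeSet := by
    intro x hx hPx
    rw [SimpleGraph.edgeSet_deleteEdges]
    refine ⟨hx, fun h => hPx ⟨e0, he0, ?_⟩⟩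
    exact (Set.mem_singleton_iff.1 h).symm
  -- conflict between new and old edges
  have hcross : ∀ e ∈ E, ∀ x ∈ G.edgeSet, ¬ P x → (∃ v, v ∈ s(e.1, e.2) ∧ v ∈ x) → c e ≠ C' x := by
    rintro e he x hx hPx ⟨v, hv, hvx⟩ heq
    obtain ⟨y, rfl⟩ := Sym2.mem_iff_exists.1 hvx
    have hmem : y ∈ bad v := by
      simp only [hbad, Finset.mem_filter, Finset.mem_univ, true_and]
      exact ⟨hx, fun h => hPx ⟨_, h, rfl⟩, fun h => hPx ⟨_, h, Sym2.eq_swap⟩⟩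
    have hmem2 : c e ∈ fb v := heq ▸ Finset.mem_image_of_mem (fun x => C' s(v, x)) hmem
    have := hc1 e he
    rw [Finset.mem_sdiff, Finset.mem_union] at this
    rw [Sym2.mem_iff] at hv
    rcases hv with rfl | rfl
    · exact this.2 (Or.inl hmem2)
    · exact this.2 (Or.inr hmem2)
  refine ⟨C, ⟨?_, ?_⟩, ?_⟩
  · intro x hx
    by_cases hPx : P x
    · obtain ⟨e, he, rfl⟩ := hPx
      rw [hCE e he]
      exact (Finset.mem_sdiff.1 (hc1 e he)).1
    · rw [hCn x hPx]
      exact hC1 x (hedge x hx hPx)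
  · rintro x hx y hy ⟨hxy, v, hvx, hvy⟩
    by_cases hPx : P x
    · obtain ⟨e, he, rfl⟩ := hPx
      rw [hCE e he]
      by_cases hPy : P y
      · obtain ⟨f, hf, rfl⟩ := hPy
        rw [hCE f hf]
        refine hc2 e he f hf (fun h => hxy (by rw [h])) ?_
        rw [Sym2.mem_iff] at hvx hvy
        rcases hvx with h1 | h1 <;> rcases hvy with h2 | h2
        · exact Or.inl (h1.symm.trans h2)
        · exact absurd (h1.symm.trans h2 ▸ (hE f hf).2.1) (hAB _ (hE e he).1)
        · exact absurd (h2.symm.trans h1 ▸ (hE e he).2.1) (hAB _ (hE f hf).1)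
        · exact Or.inr (h1.symm.trans h2)
      · rw [hCn y hPy]
        exact hcross e he y hy hPy ⟨v, hvx, hvy⟩
    · rw [hCn x hPx]
      by_cases hPy : P y
      · obtain ⟨f, hf, rfl⟩ := hPy
        rw [hCE f hf]
        exact (hcross f hf x hx hPx ⟨v, hvy, hvx⟩).symm
      · rw [hCn y hPy]
        exact hC2 x (hedge x hx hPx) y (hedge y hy hPy) ⟨hxy, v, hvx, hvy⟩
  · intro x hx
    have hPx : ¬ P x := by
      rintro ⟨e, he, rfl⟩
      exact (hE e he).2.2.2 hx
    rw [hCn x hPx]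
    exact hC3 x hx

/-- Lemma "cyclefix": with A = V_[a₀,a], B = V_[b₀,Δ] and X the bipartite
subgraph of G - E(H) induced by (A, B), if the precolouring extends to G - e for every
e ∈ E(G)\E(H) but not to G, and deg_X(u) ≥ deg_G(u) - d for all u ∈ A, then
(t+1-d)|A| ≤ Σ_{i=b₀}^{Δ} (a+i-1-(Δ+t))|V_i|. -/
theorem statement9 {V : Type} [Fintype V] (Δ d t a₀ a b₀ : ℕ) (ht : 1 ≤ t)
    (G H : SimpleGraph V) (hHG : H ≤ G)
    (hdeg : ∀ v, edeg G v ≤ Δ) (hHdeg : ∀ v, edeg H v ≤ d)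
    (L : Sym2 V → Finset ℕ) (hL : ∀ e ∈ G.edgeSet, Δ + t ≤ (L e).card)
    (C₀ : Sym2 V → ℕ) (hC₀ : IsListEdgeColoring H L C₀)
    (hminus : ∀ u v, G.Adj u v → ¬ H.Adj u v →
      ExtendsTo (G.deleteEdges {s(u, v)}) H L C₀)
    (hnot : ¬ ExtendsTo G H L C₀)
    (A B : Set V)
    (hA : A = {v | a₀ ≤ edeg G v ∧ edeg G v ≤ a})
    (hB : B = {v | b₀ ≤ edeg G v ∧ edeg G v ≤ Δ})
    (ha₀ : t + 1 ≤ a₀) (hb₀ : a < b₀) (hab : Δ + t + 1 ≤ a + b₀)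
    (hX : ∀ u ∈ A, edeg G u - d ≤ ({w | w ∈ B ∧ (G \ H).Adj u w} : Set V).ncard) :
    ((t : ℤ) + 1 - d) * A.ncard ≤
      ∑ i ∈ Finset.Icc b₀ Δ,
        ((a : ℤ) + i - 1 - (Δ + t)) * ({v | edeg G v = i} : Set V).ncard := by
  classical
  by_contra hcon
  push Not at hcon
  apply hnot
  set AF : Finset V := Finset.univ.filter (fun v => a₀ ≤ edeg G v ∧ edeg G v ≤ a) with hAF
  set BF : Finset V := Finset.univ.filter (fun v => b₀ ≤ edeg G v ∧ edeg G v ≤ Δ) with hBF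
  have hA' : A = ↑AF := by rw [hA]; ext v; simp [hAF]
  have hB' : B = ↑BF := by rw [hB]; ext v; simp [hBF]
  have memA : ∀ v, v ∈ AF ↔ a₀ ≤ edeg G v ∧ edeg G v ≤ a := fun v => by simp [hAF]
  have memB : ∀ v, v ∈ BF ↔ b₀ ≤ edeg G v ∧ edeg G v ≤ Δ := fun v => by simp [hBF]
  set F : Finset (V × V) := Finset.univ.filter
    (fun e => e.1 ∈ AF ∧ e.2 ∈ BF ∧ (G \ H).Adj e.1 e.2) with hF
  have memF : ∀ e, e ∈ F ↔ e.1 ∈ AF ∧ e.2 ∈ BF ∧ (G \ H).Adj e.1 e.2 := fun e => by simp [hF]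
  have hsum : ∑ i ∈ Finset.Icc b₀ Δ,
        ((a : ℤ) + i - 1 - (Δ + t)) * ({v | edeg G v = i} : Set V).ncard =
      ∑ v ∈ BF, ((a : ℤ) + edeg G v - 1 - (Δ + t)) := by
    rw [← Finset.sum_fiberwise_of_maps_to (s := BF) (t := Finset.Icc b₀ Δ) (g := fun v => edeg G v)
      (fun v hv => Finset.mem_Icc.2 ((memB v).1 hv))]
    apply Finset.sum_congr rfl
    intro i hi
    rw [Finset.mem_Icc] at hi
    rw [Finset.sum_congr rfl (g := fun _ => ((a : ℤ) + i - 1 - (Δ + t)))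
      (fun v hv => by rw [(Finset.mem_filter.1 hv).2])]
    rw [Finset.sum_const, nsmul_eq_mul, mul_comm]
    congr 2
    rw [← Set.ncard_coe_finset]
    congr 1
    ext v
    simp only [Set.mem_ofPred_eq, Finset.coe_filter, memB]
    constructor
    · intro h; exact ⟨by omega, h⟩
    · intro h; exact h.2
  have hFcard : F.card = ∑ u ∈ AF, dgL F u :=
    Finset.card_eq_sum_card_fiberwise (f := Prod.fst) (fun e he => ((memF e).1 he).1)
  have hFdeg : ∀ u ∈ AF, edeg G u - d ≤ dgL F u := by
    intro u hu
    refine (hX u (by rw [hA']; exact hu)).trans (le_of_eq ?_)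
    unfold dgL
    rw [← Set.ncard_coe_finset]
    rw [← Set.ncard_image_of_injective (f := fun w : V => (u, w))]
    · congr 1
      ext e
      simp only [Set.mem_image, Set.mem_ofPred_eq, Finset.coe_filter, memF, hB', Finset.mem_coe]
      constructor
      · rintro ⟨w, ⟨h1, h2⟩, rfl⟩
        exact ⟨⟨hu, h1, h2⟩, rfl⟩
      · rintro ⟨⟨h1, h2, h3⟩, rfl⟩
        exact ⟨e.2, ⟨h2, h3⟩, rfl⟩
    · intro x y h
      exact (Prod.mk.inj h).2
  have hpos : 0 < (F.card : ℤ) - ∑ u ∈ AF, ((edeg G u : ℤ) - t - 1) -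
      ∑ v ∈ BF, ((a : ℤ) + edeg G v - 1 - (Δ + t)) := by
    rw [hsum, hA', Set.ncard_coe_finset] at hcon
    rw [hFcard]
    push_cast
    rw [← Finset.sum_sub_distrib]
    have : ∑ u ∈ AF, ((t : ℤ) + 1 - d) ≤
        ∑ u ∈ AF, ((dgL F u : ℤ) - ((edeg G u : ℤ) - t - 1)) := by
      apply Finset.sum_le_sum
      intro u hu
      have := hFdeg u hu
      omega
    rw [Finset.sum_const, nsmul_eq_mul, mul_comm] at this
    linarith
  obtain ⟨E, hEF, hEne, hEdeg⟩ := core_exists F AF BF (fun u => (edeg G u : ℤ) - t - 1)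
    (fun v => (a : ℤ) + edeg G v - 1 - (Δ + t))
    (fun e he => ⟨((memF e).1 he).1, ((memF e).1 he).2.1⟩)
    (fun u hu => by have := (memA u).1 hu; omega)
    (fun v hv => by have := (memB v).1 hv; omega) hpos
  refine recolour G H L C₀ A B ?_ (Δ + t) hL E ?_ hEne hminus ?_
  · intro x hxA hxB
    rw [hA'] at hxA
    rw [hB'] at hxB
    have h1 := (memA x).1 hxA
    have h2 := (memB x).1 hxB
    omega
  · intro e he
    have h := (memF e).1 (hEF he)
    have h3 := (SimpleGraph.sdiff_adj _ _ _ _).1 h.2.2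
    exact ⟨by rw [hA']; exact h.1, by rw [hB']; exact h.2.1, h3.1, h3.2⟩
  · intro e he
    have h := (memF e).1 (hEF he)
    have h1 := (memA _).1 h.1
    have h2 := (memB _).1 h.2.1
    have h3 := hEdeg e he
    omega
end

section
/- Let Δ, d, t be positive integers with d ≤ t, and let G be a simple planar graph with maximum degree at most Δ. Let L be an edge list assignment on G with |L(e)| ≥ Δ + t for all e ∈ E(G), and let H be a subgraph of G with maximum degree at most d that has been properly L-edge-coloured. If d ≤ t - 4, then the precolouring of H extends to a proper L-edge-colouring of G. -/
open SimpleGraph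

/-- A graph is planar if it has a drawing in the plane: an injective placement of the
vertices together with simple arcs for the edges, such that the interior of each arc avoids
all vertex points, and the interiors of arcs of distinct edges are disjoint. -/
def IsPlanar {V : Type} (G : SimpleGraph V) : Prop :=
  ∃ (p : V → ℝ × ℝ) (γ : ∀ u v, G.Adj u v → Path (p u) (p v)),
    Function.Injective p ∧
    (∀ u v (h : G.Adj u v), Function.Injective (γ u v h)) ∧
    (∀ u v (h : G.Adj u v), ∀ s : unitInterval, s ≠ 0 → s ≠ 1 →
      (γ u v h) s ∉ Set.range p) ∧
    (∀ u v x y (h₁ : G.Adj u v) (h₂ : G.Adj x y), s(u, v) ≠ s(x, y) →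
      ∀ s : unitInterval, s ≠ 0 → s ≠ 1 → ∀ r : unitInterval, r ≠ 0 → r ≠ 1 →
        (γ u v h₁) s ≠ (γ x y h₂) r)

lemma exists_log_plane (F : ℝ × ℝ → ℂ) (hF : Continuous F) (h0 : ∀ x, F x ≠ 0) :
    ∃ g : ℝ × ℝ → ℂ, Continuous g ∧ ∀ x, Complex.exp (g x) = F x := by
  obtain ⟨g, ⟨-, hg⟩, -⟩ := Complex.isCoveringMap_exp.existsUnique_continuousMap_lifts
    (A := ℝ × ℝ) ⟨fun x => (⟨F x, h0 x⟩ : {z : ℂ // z ≠ 0}), by fun_prop⟩ (0, 0)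
    (Complex.log (F (0, 0))) (by ext; simp [Complex.exp_log (h0 _)])
  refine ⟨g, g.continuous, fun x => ?_⟩
  have := congr_fun hg x
  simpa using congr_arg Subtype.val this

lemma lift_diff_unique (f g : ℝ → ℂ) (hf : Continuous f) (hg : Continuous g) (c : ℂ)
    (h : ∀ s, Complex.exp (g s) = c * Complex.exp (f s)) : g 1 - g 0 = f 1 - f 0 := by
  have key : (fun s => f s) = (fun s => g s - g 0 + f 0) := by
    refine Complex.isCoveringMap_exp.eq_of_comp_eq (by fun_prop) (by fun_prop) ?_ 0 (by simp)
    funext s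
    have hc : c ≠ 0 := by
      intro hc
      have := h 0
      rw [hc, zero_mul] at this
      exact Complex.exp_ne_zero _ this
    ext
    simp only [Function.comp]
    rw [Complex.exp_add, Complex.exp_sub, h s, h 0]
    have := Complex.exp_ne_zero (f 0)
    field_simp
  have := congr_fun key 1
  rw [this]; ring

/-- Total change of the logarithm of `f` over `[0,1]`. -/
noncomputable def theta (f : ℝ → ℂ) : ℂ :=
  open Classical in
  if h : ∃ g : ℝ → ℂ, Continuous g ∧ ∀ s, Complex.exp (g s) = f s then
    h.choose 1 - h.choose 0 else 0

lemma theta_eq (f g : ℝ → ℂ) (hg : Continuous g) (c : ℂ) (hc : c ≠ 0)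
    (h : ∀ s, Complex.exp (g s) = c * f s) : theta f = g 1 - g 0 := by
  have hex : ∃ g : ℝ → ℂ, Continuous g ∧ ∀ s, Complex.exp (g s) = f s := by
    refine ⟨fun s => g s - Complex.log c, by fun_prop, fun s => ?_⟩
    rw [Complex.exp_sub, h, Complex.exp_log hc]
    field_simp
  rw [theta, dif_pos hex]
  obtain ⟨h1, h2⟩ := hex.choose_spec
  symm
  apply lift_diff_unique _ _ h1 hg c
  intro s
  rw [h, h2]

/-- the basic relation for two disjoint paths -/
lemma theta_rel (γ δ : ℝ → ℂ) (hγ : Continuous γ) (hδ : Continuous δ) (h : ∀ s t, γ s ≠ δ t) :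
    theta (fun s => γ s - δ 1) - theta (fun s => γ s - δ 0) =
    theta (fun t => δ t - γ 1) - theta (fun t => δ t - γ 0) := by
  obtain ⟨g, hg, hgF⟩ := exists_log_plane (fun x => γ x.1 - δ x.2) (by fun_prop)
    (fun x => sub_ne_zero.2 (h _ _))
  rw [theta_eq (fun s => γ s - δ 1) (fun s => g (s, 1)) (by fun_prop) 1 one_ne_zero
      (by intro s; simp [hgF]),
    theta_eq (fun s => γ s - δ 0) (fun s => g (s, 0)) (by fun_prop) 1 one_ne_zero
      (by intro s; simp [hgF]),
    theta_eq (fun s => δ s - γ 1) (fun s => g (1, s)) (by fun_prop) (-1) (by simp)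
      (by intro s; simp [hgF]),
    theta_eq (fun s => δ s - γ 0) (fun s => g (0, s)) (by fun_prop) (-1) (by simp)
      (by intro s; simp [hgF])]
  ring

lemma exp_theta (γ : ℝ → ℂ) (hγ : Continuous γ) (z : ℂ) (h : ∀ s, γ s ≠ z) :
    Complex.exp (theta (fun s => γ s - z)) = (γ 1 - z) / (γ 0 - z) := by
  obtain ⟨g, hg, hgF⟩ := exists_log_plane (fun x => γ x.1 - z) (by fun_prop)
    (fun x => sub_ne_zero.2 (h _))
  rw [theta_eq (fun s => γ s - z) (fun s => g (s, 0)) (by fun_prop) 1 one_ne_zero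
      (by intro s; simp [hgF]), Complex.exp_sub, hgF, hgF]

/-- lifts of the direction angle -/
noncomputable def phi (p : Fin 5 → ℂ) (x y : Fin 5) : ℂ :=
  if x < y then Complex.log (p y - p x) else Complex.log (p x - p y) + Real.pi * Complex.I

lemma exp_phi (p : Fin 5 → ℂ) (x y : Fin 5) (h : p x ≠ p y) :
    Complex.exp (phi p x y) = p y - p x := by
  unfold phi
  split_ifs
  · exact Complex.exp_log (sub_ne_zero.2 h.symm)
  · rw [Complex.exp_add, Complex.exp_log (sub_ne_zero.2 h), Complex.exp_pi_mul_I]; ring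

lemma phi_symm (p : Fin 5 → ℂ) (x y : Fin 5) (h : x < y) :
    phi p y x = phi p x y + Real.pi * Complex.I := by
  simp [phi, h, not_lt.2 h.le]

/-- There is no map of `K₅` to the plane in which non-adjacent edges are disjoint. -/
theorem no_K5 (p : Fin 5 → ℂ) (γ : Fin 5 → Fin 5 → ℝ → ℂ)
    (hc : ∀ a b, a < b → Continuous (γ a b))
    (h0 : ∀ a b, a < b → γ a b 0 = p a) (h1 : ∀ a b, a < b → γ a b 1 = p b)
    (hd : ∀ a b c d, a < b → c < d → a ≠ c → a ≠ d → b ≠ c → b ≠ d →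
      ∀ s t, γ a b s ≠ γ c d t) : False := by
  have hv : ∀ a b c, a < b → a ≠ c → b ≠ c → ∀ s, γ a b s ≠ p c := by
    intro a b c hab hac hbc s
    obtain ⟨d, hd1, hd2, hd3⟩ : ∃ d : Fin 5, d ≠ a ∧ d ≠ b ∧ d ≠ c := by
      revert a b c; decide
    rcases lt_or_gt_of_ne hd3 with h | h
    · rw [← h1 d c h]; exact hd a b d c hab h hd1.symm hac hd2.symm hbc s 1
    · rw [← h0 c d h]; exact hd a b c d hab h hac hd1.symm hbc hd2.symm s 0
  have hinj : ∀ a b, a ≠ b → p a ≠ p b := by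
    intro a b hab
    obtain ⟨d, hd1, hd2⟩ : ∃ d : Fin 5, d ≠ a ∧ d ≠ b := by
      revert a b; decide
    rcases lt_or_gt_of_ne hd1 with h | h
    · rw [← h1 d a h]; exact hv d a b h hd2 hab 1
    · rw [← h0 a d h]; exact hv a d b h hab hd2 0
  have hn : ∀ a b c, ∃ n : ℤ, a < b → a ≠ c → b ≠ c →
      theta (fun s => γ a b s - p c) = phi p c b - phi p c a + n * (2 * Real.pi * Complex.I) := by
    intro a b c
    by_cases hh : a < b ∧ a ≠ c ∧ b ≠ c
    · obtain ⟨hab, hac, hbc⟩ := hh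
      have := exp_theta (γ a b) (hc a b hab) (p c) (hv a b c hab hac hbc)
      rw [h0 a b hab, h1 a b hab, ← exp_phi p c b (hinj _ _ hbc.symm),
        ← exp_phi p c a (hinj _ _ hac.symm), ← Complex.exp_sub,
        Complex.exp_eq_exp_iff_exists_int] at this
      obtain ⟨n, hn⟩ := this
      exact ⟨n, fun _ _ _ => hn⟩
    · exact ⟨0, fun h1 h2 h3 => (hh ⟨h1, h2, h3⟩).elim⟩
  choose n hn using hn
  have rel : ∀ a b c d, a < b → c < d → a ≠ c → a ≠ d → b ≠ c → b ≠ d →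
      (phi p d b - phi p d a + n a b d * (2 * Real.pi * Complex.I)) -
      (phi p c b - phi p c a + n a b c * (2 * Real.pi * Complex.I)) =
      (phi p b d - phi p b c + n c d b * (2 * Real.pi * Complex.I)) -
      (phi p a d - phi p a c + n c d a * (2 * Real.pi * Complex.I)) := by
    intro a b c d hab hcd hac had hbc hbd
    rw [← hn a b d hab had hbd, ← hn a b c hab hac hbc, ← hn c d b hcd hbc.symm hbd.symm,
      ← hn c d a hcd hac.symm had.symm]
    have := theta_rel (γ a b) (γ c d) (hc a b hab) (hc c d hcd) (hd a b c d hab hcd hac had hbc hbd)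
    rwa [h0 a b hab, h1 a b hab, h0 c d hcd, h1 c d hcd] at this
  have hpi : (2 * Real.pi * Complex.I : ℂ) ≠ 0 := Complex.two_pi_I_ne_zero
  have conv : ∀ k : ℤ, (k : ℂ) * (2 * Real.pi * Complex.I) = 0 → k = 0 := by
    intro k hk
    exact_mod_cast (mul_eq_zero.1 hk).resolve_right hpi
  -- the three orderings
  have r1 : ∀ a b c d : Fin 5, a < b → b < c → c < d →
      n a b d - n a b c - n c d b + n c d a = 0 := by
    intro a b c d hab hbc hcd
    have hac := hab.trans hbc
    have := rel a b c d hab hcd hac.ne (hac.trans hcd).ne hbc.ne (hbc.trans hcd).ne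
    rw [phi_symm p b d (hbc.trans hcd), phi_symm p a d (hac.trans hcd), phi_symm p b c hbc,
      phi_symm p a c hac] at this
    apply conv
    push_cast
    linear_combination this
  have r2 : ∀ a b c d : Fin 5, a < c → c < b → b < d →
      n a b d - n a b c - n c d b + n c d a + 1 = 0 := by
    intro a b c d hac hcb hbd
    have := rel a b c d (hac.trans hcb) (hcb.trans hbd) hac.ne (hac.trans (hcb.trans hbd)).ne hcb.ne'
      hbd.ne
    rw [phi_symm p b d hbd, phi_symm p a d (hac.trans (hcb.trans hbd)), phi_symm p c b hcb,
      phi_symm p a c hac] at this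
    apply conv
    push_cast
    linear_combination this
  have r3 : ∀ a b c d : Fin 5, a < c → c < d → d < b →
      n a b d - n a b c - n c d b + n c d a = 0 := by
    intro a b c d hac hcd hdb
    have := rel a b c d (hac.trans (hcd.trans hdb)) hcd hac.ne (hac.trans hcd).ne
      (hcd.trans hdb).ne' hdb.ne'
    rw [phi_symm p d b hdb, phi_symm p a d (hac.trans hcd), phi_symm p c b (hcd.trans hdb),
      phi_symm p a c hac] at this
    apply conv
    push_cast
    linear_combination this
  have A : ∀ w x y z : Fin 5, w < x → x < y → y < z →
      ∃ m : ℤ, n w x z + n w x y + n y z x + n y z w + (n w y z + n w y x + n x z y + n x z w)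
       + (n w z y + n w z x + n x y z + n x y w) = 2 * m + 1 := by
    intro w x y z hwx hxy hyz
    have e1 := r1 w x y z hwx hxy hyz
    have e2 := r2 w y x z hwx hxy hyz
    have e3 := r3 w z x y hwx hxy hyz
    refine ⟨n w x y + n y z x + n w y x + n x z y + n w z x + n x y z - 1, ?_⟩
    linear_combination e1 + e2 + e3
  obtain ⟨m1, A1⟩ := A 0 1 2 3 (by decide) (by decide) (by decide)
  obtain ⟨m2, A2⟩ := A 0 1 2 4 (by decide) (by decide) (by decide)
  obtain ⟨m3, A3⟩ := A 0 1 3 4 (by decide) (by decide) (by decide)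
  obtain ⟨m4, A4⟩ := A 0 2 3 4 (by decide) (by decide) (by decide)
  obtain ⟨m5, A5⟩ := A 1 2 3 4 (by decide) (by decide) (by decide)
  omega

/-- A weak drawing: vertices are points, edges are joined inside sets, and the sets of
vertex-disjoint edges are disjoint. -/
def WeakDrawing {V : Type} (Q : SimpleGraph V) : Prop :=
  ∃ (p : V → ℂ) (S : V → V → Set ℂ),
    (∀ i j, Q.Adj i j → JoinedIn (S i j) (p i) (p j)) ∧
    ∀ i j k l, Q.Adj i j → Q.Adj k l → i ≠ k → i ≠ l → j ≠ k → j ≠ l →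
      Disjoint (S i j) (S k l)

lemma WeakDrawing.mono {V : Type} {Q R : SimpleGraph V} (h : WeakDrawing Q) (hR : R ≤ Q) :
    WeakDrawing R := by
  obtain ⟨p, S, h1, h2⟩ := h
  exact ⟨p, S, fun i j hij => h1 i j (hR hij),
    fun i j k l hij hkl => h2 i j k l (hR hij) (hR hkl)⟩

lemma WeakDrawing.no_K5 {V : Type} {Q : SimpleGraph V} (h : WeakDrawing Q) (f : Fin 5 → V)
    (hf : ∀ a b, a < b → Q.Adj (f a) (f b)) : False := by
  obtain ⟨p, S, h1, h2⟩ := h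
  have hne : ∀ a b, a ≠ b → f a ≠ f b := by
    intro a b hab
    rcases lt_or_gt_of_ne hab with h | h
    · exact (hf a b h).ne
    · exact (hf b a h).ne'
  refine _root_.no_K5 (fun a => p (f a))
    (fun a b => if h : a < b then (h1 _ _ (hf a b h)).somePath.extend else fun _ => 0) ?_ ?_ ?_ ?_
  · intro a b hab
    rw [dif_pos hab]; exact Path.continuous_extend _
  · intro a b hab
    rw [dif_pos hab]; simp
  · intro a b hab
    rw [dif_pos hab]; simp
  · intro a b c d hab hcd hac had hbc hbd s t
    rw [dif_pos hab, dif_pos hcd]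
    refine Set.disjoint_iff_forall_ne.1 (h2 _ _ _ _ (hf a b hab) (hf c d hcd) (hne _ _ hac)
      (hne _ _ had) (hne _ _ hbc) (hne _ _ hbd)) ?_ ?_
    · exact JoinedIn.somePath_mem _ _
    · exact JoinedIn.somePath_mem _ _

/-- Contraction of the vertex `j` into the vertex `i`. -/
def contr {V : Type} (Q : SimpleGraph V) (i j : V) : SimpleGraph V where
  Adj k l := k ≠ j ∧ l ≠ j ∧ k ≠ l ∧ (Q.Adj k l ∨ (k = i ∧ Q.Adj j l) ∨ (l = i ∧ Q.Adj k j))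
  symm := ⟨by
    rintro k l ⟨h1, h2, h3, h4⟩
    refine ⟨h2, h1, h3.symm, ?_⟩
    rcases h4 with h | ⟨h, h'⟩ | ⟨h, h'⟩
    · exact Or.inl h.symm
    · exact Or.inr (Or.inr ⟨h, h'.symm⟩)
    · exact Or.inr (Or.inl ⟨h, h'.symm⟩)⟩
  loopless := ⟨fun k h => h.2.2.1 rfl⟩

lemma contr_aux {V : Type} {a b c d i j x y : V} (hx : x = a ∨ x = b ∨ (x = j ∧ (a = i ∨ b = i)))
    (hy : y = c ∨ y = d ∨ (y = j ∧ (c = i ∨ d = i))) (hac : a ≠ c) (had : a ≠ d) (hbc : b ≠ c)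
    (hbd : b ≠ d) (haj : a ≠ j) (hbj : b ≠ j) (hcj : c ≠ j) (hdj : d ≠ j) : x ≠ y := by
  rintro rfl
  rcases hx with hx | hx | ⟨hx, hx1 | hx1⟩ <;> rcases hy with hy | hy | ⟨hy, hy1 | hy1⟩ <;> grind

lemma WeakDrawing.contr {V : Type} {Q : SimpleGraph V} (h : WeakDrawing Q) {i j : V}
    (hij : Q.Adj i j) : WeakDrawing (contr Q i j) := by
  classical
  obtain ⟨p, S, h1, h2⟩ := h
  -- the new sets
  let T : V → V → Set ℂ := fun k l =>
    if Q.Adj k l then S k l else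
      if k = i then S i j ∪ S j l else S k j ∪ S j i
  -- every point of the new set lies in an old one, for an edge in `{k, l, j}`
  have hT : ∀ k l, (_root_.contr Q i j).Adj k l → ∀ x ∈ T k l, ∃ a b, Q.Adj a b ∧ x ∈ S a b ∧
      (a = k ∨ a = l ∨ (a = j ∧ (k = i ∨ l = i))) ∧
      (b = k ∨ b = l ∨ (b = j ∧ (k = i ∨ l = i))) := by
    rintro k l ⟨hk, hl, hkl, hadj⟩ x hx
    by_cases hQ : Q.Adj k l
    · simp only [T, if_pos hQ] at hx
      exact ⟨k, l, hQ, hx, by simp, by simp⟩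
    · by_cases hki : k = i
      · subst hki
        have hjl : Q.Adj j l := by
          rcases hadj with h | ⟨_, h⟩ | ⟨h, _⟩
          · exact absurd h hQ
          · exact h
          · exact absurd h.symm hkl
        simp only [T, if_neg hQ, if_true] at hx
        rcases hx with hx | hx
        · exact ⟨k, j, hij, hx, by simp, by simp⟩
        · exact ⟨j, l, hjl, hx, by simp, by simp⟩
      · have hjl : l = i ∧ Q.Adj k j := by
          rcases hadj with h | ⟨h, _⟩ | h
          · exact absurd h hQ
          · exact absurd h hki
          · exact h
        obtain ⟨rfl, hkj⟩ := hjl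
        simp only [T, if_neg hQ, if_neg hki] at hx
        rcases hx with hx | hx
        · exact ⟨k, j, hkj, hx, by simp, by simp⟩
        · exact ⟨j, l, hij.symm, hx, by simp, by simp⟩
  refine ⟨p, T, ?_, ?_⟩
  · rintro k l ⟨hk, hl, hkl, hadj⟩
    by_cases hQ : Q.Adj k l
    · simp only [T, if_pos hQ]
      exact h1 _ _ hQ
    · by_cases hki : k = i
      · subst hki
        have hjl : Q.Adj j l := by
          rcases hadj with h | ⟨_, h⟩ | ⟨h, _⟩
          · exact absurd h hQ
          · exact h
          · exact absurd h.symm hkl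
        simp only [T, if_neg hQ, if_true]
        exact ((h1 _ _ hij).mono Set.subset_union_left).trans
          ((h1 _ _ hjl).mono Set.subset_union_right)
      · have hjl : l = i ∧ Q.Adj k j := by
          rcases hadj with h | ⟨h, _⟩ | h
          · exact absurd h hQ
          · exact absurd h hki
          · exact h
        obtain ⟨rfl, hkj⟩ := hjl
        simp only [T, if_neg hQ, if_neg hki]
        exact ((h1 _ _ hkj).mono Set.subset_union_left).trans
          ((h1 _ _ hij.symm).mono Set.subset_union_right)
  · intro a b c d hab hcd hac had hbc hbd
    rw [Set.disjoint_left]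
    intro x hx hx'
    obtain ⟨a', b', hab', hxS, ha', hb'⟩ := hT a b hab x hx
    obtain ⟨c', d', hcd', hxS', hc', hd'⟩ := hT c d hcd x hx'
    have haj := hab.1
    have hbj := hab.2.1
    have hcj := hcd.1
    have hdj := hcd.2.1
    refine Set.disjoint_left.1 (h2 a' b' c' d' hab' hcd' ?_ ?_ ?_ ?_) hxS hxS'
    · exact contr_aux ha' hc' hac had hbc hbd haj hbj hcj hdj
    · exact contr_aux ha' hd' hac had hbc hbd haj hbj hcj hdj
    · exact contr_aux hb' hc' hac had hbc hbd haj hbj hcj hdj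
    · exact contr_aux hb' hd' hac had hbc hbd haj hbj hcj hdj

/-- Number of edges lost in a contraction. -/
lemma contr_card {V : Type} [Fintype V] [DecidableEq V] (Q : SimpleGraph V) [DecidableRel Q.Adj]
    (i j : V) (hij : Q.Adj i j) [DecidableRel (contr Q i j).Adj] :
    Q.edgeFinset.card ≤ (contr Q i j).edgeFinset.card + 1 +
      (Q.neighborFinset i ∩ Q.neighborFinset j).card := by
  let A := Q.edgeFinset \ Q.incidenceFinset j
  let N := (Q.neighborFinset j \ Q.neighborFinset i).erase i
  let B := N.image (fun l => s(i, l))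
  have hA : A.card + Q.degree j = Q.edgeFinset.card := by
    rw [← Q.card_incidenceFinset_eq_degree j]
    exact Finset.card_sdiff_add_card_eq_card (Q.incidenceFinset_subset j)
  have hN : N.card + 1 + (Q.neighborFinset i ∩ Q.neighborFinset j).card = Q.degree j := by
    have h1 : N.card + 1 = (Q.neighborFinset j \ Q.neighborFinset i).card :=
      Finset.card_erase_add_one (by simp [hij.symm])
    rw [h1, Finset.inter_comm, Finset.card_sdiff_add_card_inter, Q.card_neighborFinset_eq_degree]
  have hB : B.card = N.card := by
    apply Finset.card_image_of_injective
    intro a b hab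
    exact Sym2.congr_right.1 hab
  have hdis : Disjoint A B := by
    rw [Finset.disjoint_left]
    intro e he he'
    obtain ⟨l, hl, rfl⟩ := Finset.mem_image.1 he'
    have h1 := (Finset.mem_sdiff.1 he).1
    simp only [N, Finset.mem_erase, Finset.mem_sdiff, SimpleGraph.mem_neighborFinset] at hl
    exact hl.2.2 (by simpa using h1)
  have hsub : A ∪ B ⊆ (contr Q i j).edgeFinset := by
    intro e he
    rcases Finset.mem_union.1 he with he | he
    · induction e with
      | h a b =>
        simp only [A, Finset.mem_sdiff, SimpleGraph.mem_edgeFinset, SimpleGraph.mem_edgeSet,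
          SimpleGraph.mem_incidenceFinset, SimpleGraph.incidenceSet, Set.mem_ofPred_eq,
          Sym2.mem_iff] at he
        rw [SimpleGraph.mem_edgeFinset, SimpleGraph.mem_edgeSet]
        refine ⟨?_, ?_, he.1.ne, Or.inl he.1⟩
        · rintro rfl; exact he.2 ⟨he.1, Or.inl rfl⟩
        · rintro rfl; exact he.2 ⟨he.1, Or.inr rfl⟩
    · obtain ⟨l, hl, rfl⟩ := Finset.mem_image.1 he
      simp only [N, Finset.mem_erase, Finset.mem_sdiff, SimpleGraph.mem_neighborFinset] at hl
      rw [SimpleGraph.mem_edgeFinset, SimpleGraph.mem_edgeSet]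
      exact ⟨hij.ne, hl.2.1.ne', fun h => hl.1 h.symm, Or.inr (Or.inl ⟨rfl, hl.2.1⟩)⟩
  have := Finset.card_le_card hsub
  rw [Finset.card_union_of_disjoint hdis] at this
  omega

/-- A vertex with at most five neighbours, each edge at it being in at least three triangles. -/
lemma local_contra {V : Type} [DecidableEq V] (Q : SimpleGraph V) [DecidableRel Q.Adj]
    (hQ : WeakDrawing Q) (v : V)
    (N : Finset V) (hN : ∀ u ∈ N, Q.Adj v u) (hN0 : N.Nonempty) (hN5 : N.card ≤ 5)
    (hdeg : ∀ u ∈ N, 3 ≤ (N.filter (fun x => Q.Adj u x)).card) : False := by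
  have H5 : ∀ u x y, u ∈ N → x ∈ N → y ∈ N → x ≠ u → y ≠ u → x ≠ y → Q.Adj u x ∨ Q.Adj u y := by
    intro u x y hu hx hy hxu hyu hxy
    by_contra hcon
    push Not at hcon
    have h1 : Disjoint ({u, x, y} : Finset V) (N.filter (fun x => Q.Adj u x)) := by
      rw [Finset.disjoint_left]
      intro z hz hz'
      simp only [Finset.mem_insert, Finset.mem_singleton] at hz
      have hz2 := (Finset.mem_filter.1 hz').2
      rcases hz with rfl | rfl | rfl
      · exact hz2.ne rfl
      · exact hcon.1 hz2
      · exact hcon.2 hz2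
    have h2 : ({u, x, y} : Finset V) ∪ (N.filter (fun x => Q.Adj u x)) ⊆ N := by
      apply Finset.union_subset _ (Finset.filter_subset _ _)
      intro z hz
      simp only [Finset.mem_insert, Finset.mem_singleton] at hz
      rcases hz with rfl | rfl | rfl <;> assumption
    have h3 := Finset.card_le_card h2
    rw [Finset.card_union_of_disjoint h1, Finset.card_eq_three.2
      ⟨u, x, y, hxu.symm, hyu.symm, hxy, rfl⟩] at h3
    have := hdeg u hu
    omega
  by_cases hcomp : ∀ a ∈ N, ∀ b ∈ N, a ≠ b → Q.Adj a b
  · have hge : 4 ≤ N.card := by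
      obtain ⟨u, hu⟩ := hN0
      have h1 := hdeg u hu
      have h2 : N.filter (fun x => Q.Adj u x) ⊆ N.erase u := by
        intro z hz
        rw [Finset.mem_filter] at hz
        exact Finset.mem_erase.2 ⟨hz.2.ne', hz.1⟩
      have h3 := Finset.card_le_card h2
      have := Finset.card_erase_add_one hu
      omega
    obtain ⟨M, hM, hM4⟩ := Finset.exists_subset_card_eq hge
    obtain ⟨f⟩ : Nonempty (Fin 4 ≃ M) := ⟨(Finset.equivFinOfCardEq hM4).symm⟩
    have hfN : ∀ a, (f a : V) ∈ N := fun a => hM (f a).2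
    refine hQ.no_K5 (Fin.cons v (fun a => (f a : V))) ?_
    intro a b hab
    induction b using Fin.cases with
    | zero => simp at hab
    | succ b =>
      induction a using Fin.cases with
      | zero =>
        rw [Fin.cons_zero, Fin.cons_succ]
        exact hN _ (hfN b)
      | succ a =>
        rw [Fin.cons_succ, Fin.cons_succ]
        refine hcomp _ (hfN a) _ (hfN b) ?_
        intro h
        have := f.injective (Subtype.ext h)
        subst this
        exact lt_irrefl _ hab
  · push Not at hcomp
    obtain ⟨a, ha, b, hb, hab, hnab⟩ := hcomp
    have hc1 := Finset.card_erase_add_one ha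
    have hc2 := Finset.card_erase_add_one (Finset.mem_erase.2 ⟨hab.symm, hb⟩)
    have hsub : N.filter (fun x => Q.Adj a x) ⊆ (N.erase a).erase b := by
      intro z hz
      rw [Finset.mem_filter] at hz
      refine Finset.mem_erase.2 ⟨?_, Finset.mem_erase.2 ⟨hz.2.ne', hz.1⟩⟩
      rintro rfl
      exact hnab hz.2
    have hcard : ((N.erase a).erase b).card = 3 := by
      have := Finset.card_le_card hsub
      have := hdeg a ha
      omega
    obtain ⟨c, d, w, hcd, hcw, hdw, hM⟩ := Finset.card_eq_three.1 hcard
    have hc' : c ∈ (N.erase a).erase b := by rw [hM]; simp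
    have hd' : d ∈ (N.erase a).erase b := by rw [hM]; simp
    have hw' : w ∈ (N.erase a).erase b := by rw [hM]; simp
    simp only [Finset.mem_erase] at hc' hd' hw'
    obtain ⟨hcb, hca, hc⟩ := hc'
    obtain ⟨hdb, hda, hd⟩ := hd'
    obtain ⟨hwb, hwa, hw⟩ := hw'
    have hnba : ¬ Q.Adj b a := fun h => hnab h.symm
    have eac := (H5 a b c ha hb hc hab.symm hca hcb.symm).resolve_left hnab
    have ead := (H5 a b d ha hb hd hab.symm hda hdb.symm).resolve_left hnab
    have eaw := (H5 a b w ha hb hw hab.symm hwa hwb.symm).resolve_left hnab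
    have ebc := (H5 b a c hb ha hc hab hcb hca.symm).resolve_left hnba
    have ebd := (H5 b a d hb ha hd hab hdb hda.symm).resolve_left hnba
    have ebw := (H5 b a w hb ha hw hab hwb hwa.symm).resolve_left hnba
    have ec := H5 c d w hc hd hw hcd.symm hcw.symm hdw
    have ed := H5 d c w hd hc hw hcd hdw.symm hcw
    have ew := H5 w c d hw hc hd hcw hdw hcd
    -- the conclusion, for a vertex `w` adjacent to the two others
    have fin : ∀ c d w, c ∈ N → d ∈ N → w ∈ N → c ≠ d → Q.Adj a c → Q.Adj a d → Q.Adj a w →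
        Q.Adj b c → Q.Adj b d → Q.Adj b w → Q.Adj w c → Q.Adj w d → False := by
      clear * - hQ hN ha hb hab
      intro c d w hc hd hw hcd hac had haw hbc hbd hbw hwc hwd
      have va := hN a ha
      have vb := hN b hb
      have vc := hN c hc
      have vd := hN d hd
      have vw := hN w hw
      have e1 : (contr Q a c).Adj v a := ⟨vc.ne, hac.ne, va.ne, Or.inl va⟩
      have e2 : (contr Q a c).Adj v b := ⟨vc.ne, hbc.ne, vb.ne, Or.inl vb⟩
      have e3 : (contr Q a c).Adj v d := ⟨vc.ne, hcd.symm, vd.ne, Or.inl vd⟩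
      have e4 : (contr Q a c).Adj v w := ⟨vc.ne, hwc.ne, vw.ne, Or.inl vw⟩
      have e5 : (contr Q a c).Adj a b :=
        ⟨hac.ne, hbc.ne, hab, Or.inr (Or.inl ⟨rfl, hbc.symm⟩)⟩
      have e6 : (contr Q a c).Adj a d := ⟨hac.ne, hcd.symm, had.ne, Or.inl had⟩
      have e7 : (contr Q a c).Adj a w := ⟨hac.ne, hwc.ne, haw.ne, Or.inl haw⟩
      have e8 : (contr Q a c).Adj b d := ⟨hbc.ne, hcd.symm, hbd.ne, Or.inl hbd⟩
      have e9 : (contr Q a c).Adj b w := ⟨hbc.ne, hwc.ne, hbw.ne, Or.inl hbw⟩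
      have e10 : (contr Q a c).Adj d w := ⟨hcd.symm, hwc.ne, hwd.ne', Or.inl hwd.symm⟩
      refine (hQ.contr hac).no_K5 ![v, a, b, d, w] ?_
      intro x y hxy
      fin_cases x <;> fin_cases y <;> first
        | (exact absurd hxy (by decide))
        | assumption
    rcases ec with h1 | h1
    · rcases ew with h2 | h2
      · exact fin d w c hd hw hc hdw ead eaw eac ebd ebw ebc h1 h2.symm
      · exact fin c w d hc hw hd hcw eac eaw ead ebc ebw ebd h1.symm h2.symm
    · rcases ed with h2 | h2
      · exact fin d w c hd hw hc hdw ead eaw eac ebd ebw ebc h2.symm h1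
      · exact fin c d w hc hd hw hcd eac ead eaw ebc ebd ebw h1.symm h2.symm

/-- The induction step of the edge bound, with exactly `3n - 1` edges. -/
lemma core {V : Type} [Fintype V] [DecidableEq V] {m : ℕ} (ih : ∀ m' < m, ∀ (Q : SimpleGraph V)
    [DecidableRel Q.Adj] (s : Finset V), s.card = m' → s.Nonempty →
    (∀ a b, Q.Adj a b → a ∈ s) → 3 * s.card ≤ Q.edgeFinset.card + 1 → WeakDrawing Q → False)
    (Q : SimpleGraph V)
    [DecidableRel Q.Adj] (s : Finset V) (hm : s.card = m) (hs : s.Nonempty)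
    (hsup : ∀ a b, Q.Adj a b → a ∈ s) (hE : 3 * s.card = Q.edgeFinset.card + 1)
    (hQ : WeakDrawing Q) : False := by
  classical
  have hs1 : 1 ≤ s.card := hs.card_pos
  have hsum : ∑ v ∈ s, Q.degree v = 2 * Q.edgeFinset.card := by
    rw [← Q.sum_degrees_eq_twice_card_edges]
    apply Finset.sum_subset (Finset.subset_univ _)
    intro v _ hv
    rw [← Q.card_neighborFinset_eq_degree, Finset.card_eq_zero, Finset.eq_empty_iff_forall_notMem]
    intro w hw
    exact hv (hsup v w (by simpa using hw))
  obtain ⟨v, hv, hv5⟩ : ∃ v ∈ s, Q.degree v ≤ 5 := by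
    by_contra hcon
    push Not at hcon
    have := Finset.card_nsmul_le_sum s (fun v => Q.degree v) 6 (fun v hv => hcon v hv)
    rw [hsum, smul_eq_mul] at this
    omega
  by_cases hv0 : Q.degree v = 0
  · have hiso : ∀ w, ¬ Q.Adj v w := by
      intro w hw
      have : w ∈ Q.neighborFinset v := by simpa using hw
      rw [← Q.card_neighborFinset_eq_degree, Finset.card_eq_zero] at hv0
      simp [hv0] at this
    have hc := Finset.card_erase_add_one hv
    obtain ⟨e, he⟩ : Q.edgeFinset.Nonempty := Finset.card_pos.1 (by omega)
    refine ih _ ?_ Q (s.erase v) rfl ?_ ?_ (by omega) hQ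
    · omega
    · induction e with
      | h a b =>
        have hab : Q.Adj a b := by simpa using he
        refine ⟨a, Finset.mem_erase.2 ⟨?_, hsup a b hab⟩⟩
        rintro rfl
        exact hiso _ hab
    · intro a b hab
      refine Finset.mem_erase.2 ⟨?_, hsup a b hab⟩
      rintro rfl
      exact hiso _ hab
  by_cases htri : ∃ i j, Q.Adj i j ∧ (Q.neighborFinset i ∩ Q.neighborFinset j).card ≤ 2
  · obtain ⟨i, j, hij, hc⟩ := htri
    have h1 := contr_card Q i j hij
    have his := hsup i j hij
    have hjs := hsup j i hij.symm
    have h2 := Finset.card_erase_add_one hjs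
    refine ih _ ?_ (contr Q i j) (s.erase j) rfl ⟨i, Finset.mem_erase.2 ⟨hij.ne, his⟩⟩ ?_ ?_
      (hQ.contr hij)
    · omega
    · rintro a b ⟨ha, hb, hab, h | ⟨h, h'⟩ | ⟨h, h'⟩⟩
      · exact Finset.mem_erase.2 ⟨ha, hsup _ _ h⟩
      · exact Finset.mem_erase.2 ⟨ha, h ▸ his⟩
      · exact Finset.mem_erase.2 ⟨ha, hsup _ _ h'⟩
    · omega
  · push Not at htri
    refine local_contra Q hQ v (Q.neighborFinset v) (by simp) ?_ ?_ ?_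
    · rw [← Finset.card_pos, Q.card_neighborFinset_eq_degree]; omega
    · rw [Q.card_neighborFinset_eq_degree]; omega
    · intro u hu
      have h := htri v u (by simpa using hu)
      have h' : (Q.neighborFinset v).filter (fun x => Q.Adj u x) =
          Q.neighborFinset v ∩ Q.neighborFinset u := by
        ext x
        simp
      rw [h']
      exact h

/-- A weakly drawn graph has fewer than `3n - 1` edges. -/
theorem edge_bound {V : Type} [Fintype V] [DecidableEq V] : ∀ (m : ℕ) (Q : SimpleGraph V)
    [DecidableRel Q.Adj] (s : Finset V), s.card = m → s.Nonempty →
    (∀ a b, Q.Adj a b → a ∈ s) → 3 * s.card ≤ Q.edgeFinset.card + 1 → WeakDrawing Q → False := by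
  classical
  intro m
  induction m using Nat.strong_induction_on with
  | _ m ih =>
  intro Q _ s hm hs hsup hE hQ
  have hs1 : 1 ≤ s.card := hs.card_pos
  -- drop superfluous edges
  by_cases hmore : 3 * s.card ≤ Q.edgeFinset.card
  · obtain ⟨T, hT, hTc⟩ := Finset.exists_subset_card_eq
      (show 3 * s.card - 1 ≤ Q.edgeFinset.card by omega)
    have hR : ∀ _ : Fintype (SimpleGraph.fromEdgeSet (T : Set (Sym2 V))).edgeSet,
        (SimpleGraph.fromEdgeSet (T : Set (Sym2 V))).edgeFinset = T := by
      intro _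
      ext e
      simp only [SimpleGraph.mem_edgeFinset, SimpleGraph.edgeSet_fromEdgeSet, Set.mem_sdiff,
        Finset.mem_coe]
      refine ⟨fun h => h.1, fun h => ⟨h, ?_⟩⟩
      exact Q.not_isDiag_of_mem_edgeFinset (hT h)
    have hle : SimpleGraph.fromEdgeSet (T : Set (Sym2 V)) ≤ Q := by
      intro a b hab
      have := hT ((SimpleGraph.fromEdgeSet_adj _).1 hab).1
      simpa using this
    exact core ih _ s hm hs (fun a b h => hsup a b (hle h)) (by rw [hR]; omega) (hQ.mono hle)
  exact core ih Q s hm hs hsup (by omega) hQ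

/-- A weakly drawn graph with an edge has an edge one end of which has degree at most five. -/
theorem exists_light {V : Type} [Fintype V] [DecidableEq V] (Q : SimpleGraph V)
    [DecidableRel Q.Adj] (hQ : WeakDrawing Q) (a b : V) (hab : Q.Adj a b) :
    ∃ u v, Q.Adj u v ∧ Q.degree u ≤ 5 := by
  by_contra hcon
  push Not at hcon
  let s : Finset V := Finset.univ.filter (fun v => 0 < Q.degree v)
  have hdeg : ∀ v ∈ s, 6 ≤ Q.degree v := by
    intro v hv
    have : 0 < Q.degree v := (Finset.mem_filter.1 hv).2
    obtain ⟨w, hw⟩ := (Q.degree_pos_iff_exists_adj v).1 this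
    exact hcon v w hw
  have hs : ∀ a b, Q.Adj a b → a ∈ s := fun a b h =>
    Finset.mem_filter.2 ⟨Finset.mem_univ _, (Q.degree_pos_iff_exists_adj a).2 ⟨b, h⟩⟩
  refine edge_bound _ Q s rfl ⟨a, hs a b hab⟩ hs ?_ hQ
  have h1 := Finset.card_nsmul_le_sum s (fun v => Q.degree v) 6 hdeg
  have h2 : ∑ v ∈ s, Q.degree v ≤ ∑ v, Q.degree v :=
    Finset.sum_le_sum_of_subset (Finset.subset_univ _)
  rw [Q.sum_degrees_eq_twice_card_edges] at h2
  rw [smul_eq_mul] at h1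
  omega

lemma IsPlanar.weakDrawing {V : Type} {G : SimpleGraph V} (h : IsPlanar G) : WeakDrawing G := by
  obtain ⟨p, γ, hp, -, hv, he⟩ := h
  have hcont : Continuous Complex.equivRealProdCLM.symm := Complex.equivRealProdCLM.symm.continuous
  refine ⟨fun v => Complex.equivRealProdCLM.symm (p v),
    fun u v => {z | ∃ (h : G.Adj u v) (s : unitInterval),
      z = Complex.equivRealProdCLM.symm (γ u v h s)}, ?_, ?_⟩
  · intro i j hij
    exact ⟨(γ i j hij).map hcont, fun s => ⟨hij, s, rfl⟩⟩
  · intro i j k l _ _ hik hil hjk hjl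
    rw [Set.disjoint_left]
    rintro z ⟨h1, s, rfl⟩ ⟨h2, r, hz⟩
    have hz := Complex.equivRealProdCLM.symm.injective hz
    have hne : s(i, j) ≠ s(k, l) := by
      intro h
      rcases Sym2.eq_iff.1 h with h | h
      · exact hik h.1
      · exact hil h.1
    -- each parameter is an end or interior
    have hs : γ i j h1 s = p i ∨ γ i j h1 s = p j ∨ (s ≠ 0 ∧ s ≠ 1) := by
      by_cases h0 : s = 0
      · left; rw [h0]; exact (γ i j h1).source
      · by_cases h1' : s = 1
        · right; left; rw [h1']; exact (γ i j h1).target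
        · exact Or.inr (Or.inr ⟨h0, h1'⟩)
    have hr : γ k l h2 r = p k ∨ γ k l h2 r = p l ∨ (r ≠ 0 ∧ r ≠ 1) := by
      by_cases h0 : r = 0
      · left; rw [h0]; exact (γ k l h2).source
      · by_cases h1' : r = 1
        · right; left; rw [h1']; exact (γ k l h2).target
        · exact Or.inr (Or.inr ⟨h0, h1'⟩)
    rcases hs with hs | hs | hs <;> rcases hr with hr | hr | hr
    · exact hik (hp (by rw [← hs, hz, hr]))
    · exact hil (hp (by rw [← hs, hz, hr]))
    · exact hv k l h2 r hr.1 hr.2 ⟨i, by rw [← hs, hz]⟩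
    · exact hjk (hp (by rw [← hs, hz, hr]))
    · exact hjl (hp (by rw [← hs, hz, hr]))
    · exact hv k l h2 r hr.1 hr.2 ⟨j, by rw [← hs, hz]⟩
    · exact hv i j h1 s hs.1 hs.2 ⟨k, by rw [hz, hr]⟩
    · exact hv i j h1 s hs.1 hs.2 ⟨l, by rw [hz, hr]⟩
    · exact he i j k l h1 h2 hne s hs.1 hs.2 r hr.1 hr.2 hz

lemma edeg_eq {V : Type} [Fintype V] (G : SimpleGraph V) [DecidableRel G.Adj] (v : V) :
    edeg G v = G.degree v := by
  rw [edeg, Set.ncard_eq_toFinset_card', ← G.card_neighborFinset_eq_degree]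
  rfl

/-- Extending a colouring to one more edge. -/
lemma extend_edge {V : Type} [Fintype V] [DecidableEq V] (K H : SimpleGraph V)
    [DecidableRel K.Adj] (L : Sym2 V → Finset ℕ) (C₀ : Sym2 V → ℕ) (u v : V) (huv : K.Adj u v)
    (hH : ¬ H.Adj u v) (hdeg : K.degree u + K.degree v < (L s(u, v)).card + 2)
    (hext : ExtendsTo (K.deleteEdges {s(u, v)}) H L C₀) : ExtendsTo K H L C₀ := by
  obtain ⟨C, ⟨hC1, hC2⟩, hC3⟩ := hext
  let F : Finset ℕ := ((K.incidenceFinset u).erase s(u, v) ∪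
    (K.incidenceFinset v).erase s(u, v)).image C
  have hF : F.card < (L s(u, v)).card := by
    have h1 : F.card ≤ _ := Finset.card_image_le
    have h2 := Finset.card_union_le ((K.incidenceFinset u).erase s(u, v))
      ((K.incidenceFinset v).erase s(u, v))
    have h3 := Finset.card_erase_add_one (show s(u, v) ∈ K.incidenceFinset u by
      simp [SimpleGraph.mem_incidenceFinset, huv])
    have h4 := Finset.card_erase_add_one (show s(u, v) ∈ K.incidenceFinset v by
      simp [SimpleGraph.mem_incidenceFinset, SimpleGraph.mk'_mem_incidenceSet_iff, huv])
    rw [K.card_incidenceFinset_eq_degree] at h3 h4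
    omega
  obtain ⟨c, hcL, hcF⟩ := Finset.exists_mem_notMem_of_card_lt_card hF
  have hmem : ∀ f ∈ K.edgeSet, f ≠ s(u, v) → f ∈ (K.deleteEdges {s(u, v)}).edgeSet := by
    intro f hf hne
    rw [SimpleGraph.edgeSet_deleteEdges]
    exact ⟨hf, hne⟩
  have hfree : ∀ f ∈ K.edgeSet, f ≠ s(u, v) → (∃ x, x ∈ s(u, v) ∧ x ∈ f) → C f ≠ c := by
    rintro f hf hne ⟨x, hx, hxf⟩ hcf
    apply hcF
    rw [← hcf]
    apply Finset.mem_image_of_mem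
    rw [Finset.mem_union, Finset.mem_erase, Finset.mem_erase, SimpleGraph.mem_incidenceFinset,
      SimpleGraph.mem_incidenceFinset]
    rcases Sym2.mem_iff.1 hx with rfl | rfl
    · exact Or.inl ⟨hne, hf, hxf⟩
    · exact Or.inr ⟨hne, hf, hxf⟩
  refine ⟨Function.update C s(u, v) c, ⟨?_, ?_⟩, ?_⟩
  · intro f hf
    by_cases hfe : f = s(u, v)
    · subst hfe; simpa using hcL
    · rw [Function.update_of_ne hfe]
      exact hC1 f (hmem f hf hfe)
  · rintro f hf g hg ⟨hfg, x, hxf, hxg⟩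
    by_cases hfe : f = s(u, v)
    · have hge : g ≠ s(u, v) := fun h => hfg (hfe.trans h.symm)
      rw [hfe, Function.update_self, Function.update_of_ne hge]
      exact (hfree g hg hge ⟨x, hfe ▸ hxf, hxg⟩).symm
    · by_cases hge : g = s(u, v)
      · rw [hge, Function.update_self, Function.update_of_ne hfe]
        exact hfree f hf hfe ⟨x, hge ▸ hxg, hxf⟩
      · rw [Function.update_of_ne hfe, Function.update_of_ne hge]
        exact hC2 f (hmem f hf hfe) g (hmem g hg hge) ⟨hfg, x, hxf, hxg⟩
  · intro f hf
    rw [Function.update_of_ne, hC3 f hf]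
    rintro rfl
    exact hH hf

theorem edge_card_lt {V : Type*} {A B : SimpleGraph V} {_ : Fintype A.edgeSet}
    {_ : Fintype B.edgeSet} (h : A ≤ B) (e : Sym2 V) (he : e ∈ B.edgeSet) (he' : e ∉ A.edgeSet) :
    A.edgeFinset.card < B.edgeFinset.card := by
  apply Finset.card_lt_card
  rw [Finset.ssubset_iff_of_subset (SimpleGraph.edgeFinset_mono h)]
  exact ⟨e, by simpa using he, by simpa using he'⟩

/-- Theorem 4, case 1: for positive integers Δ, d, t with d ≤ t - 4, any
proper L-edge-precolouring (lists of size ≥ Δ + t) of a subgraph of maximum degree ≤ d of a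
planar graph of maximum degree ≤ Δ extends to the whole graph. -/
theorem statement18 {V : Type} [Fintype V] (Δ d t : ℕ)
    (hΔ : 1 ≤ Δ) (hd : 1 ≤ d) (ht : 1 ≤ t) (hdt : d ≤ t)
    (G : SimpleGraph V) (hplanar : IsPlanar G) (hdeg : ∀ v, edeg G v ≤ Δ)
    (L : Sym2 V → Finset ℕ) (hL : ∀ e ∈ G.edgeSet, Δ + t ≤ (L e).card)
    (H : SimpleGraph V) (hHG : H ≤ G) (hHdeg : ∀ v, edeg H v ≤ d)
    (C₀ : Sym2 V → ℕ) (hC₀ : IsListEdgeColoring H L C₀)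
    (hcase : d + 4 ≤ t) :
    ExtendsTo G H L C₀ := by
  classical
  have main : ∀ (n : ℕ) (K : SimpleGraph V), H ≤ K → K ≤ G → (K \ H).edgeFinset.card = n →
      ExtendsTo K H L C₀ := by
    intro n
    induction n using Nat.strong_induction_on with
    | _ n ih =>
    intro K hHK hKG hn
    by_cases hex : ∃ a b, (K \ H).Adj a b
    · obtain ⟨a, b, hab⟩ := hex
      obtain ⟨u, v, huv, hu5⟩ := exists_light (K \ H)
        (hplanar.weakDrawing.mono (sdiff_le.trans hKG)) a b hab
      have huv' : K.Adj u v ∧ ¬ H.Adj u v := by simpa [SimpleGraph.sdiff_adj] using huv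
      refine extend_edge K H L C₀ u v huv'.1 huv'.2 ?_ ?_
      · have h1 : K.degree u ≤ H.degree u + (K \ H).degree u := by
          simp only [← SimpleGraph.card_neighborFinset_eq_degree]
          refine le_trans (Finset.card_le_card ?_) (Finset.card_union_le _ _)
          intro x hx
          rw [SimpleGraph.mem_neighborFinset] at hx
          rw [Finset.mem_union, SimpleGraph.mem_neighborFinset, SimpleGraph.mem_neighborFinset,
            SimpleGraph.sdiff_adj]
          tauto
        have h2 : H.degree u ≤ d := edeg_eq H u ▸ hHdeg u
        have h3 : K.degree v ≤ G.degree v := SimpleGraph.degree_le_of_le hKG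
        have h4 : G.degree v ≤ Δ := edeg_eq G v ▸ hdeg v
        have h5 := hL s(u, v) (hKG huv'.1)
        omega
      · refine ih _ ?_ (K.deleteEdges {s(u, v)}) ?_ ((K.deleteEdges_le _).trans hKG) rfl
        · rw [← hn]
          refine edge_card_lt (sdiff_le_sdiff_right (K.deleteEdges_le _)) s(u, v) ?_ ?_
          · exact huv
          · simp
        · intro x y hxy
          rw [SimpleGraph.deleteEdges_adj]
          refine ⟨hHK hxy, ?_⟩
          intro h
          have h' : s(x, y) = s(u, v) := h
          apply huv'.2
          rw [← SimpleGraph.mem_edgeSet, ← h', SimpleGraph.mem_edgeSet]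
          exact hxy
    · push Not at hex
      have hKH : K = H := by
        apply le_antisymm _ hHK
        intro x y hxy
        by_contra hc
        exact hex x y (by rw [SimpleGraph.sdiff_adj]; exact ⟨hxy, hc⟩)
      subst hKH
      exact ⟨C₀, hC₀, fun _ _ => rfl⟩
  exact main _ G hHG le_rfl rfl
end

section
/- Let Δ, d, t be positive integers with t - 3 ≤ d ≤ t, and suppose Δ ≥ 16 + d if d = t, Δ ≥ 9 + d if d = t - 1, Δ ≥ 8 + d if d = t - 2, and Δ ≥ 7 + d if d = t - 3. Let G be a simple planar graph with maximum degree at most Δ, L an edge list assignment with |L(e)| ≥ Δ + t for all edges e, and H a subgraph of G with maximum degree at most d that has been properly L-edge-coloured. Then the precolouring of H extends to a proper L-edge-colouring of G. -/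
open SimpleGraph

namespace PlanarExt
open Classical
open scoped BigOperators

/-- Mod-2 boundary of a chain on a finite set of edges. -/
noncomputable def bd {V : Type} (Q : Finset (Sym2 V)) :
    (Q → ZMod 2) →ₗ[ZMod 2] (V → ZMod 2) where
  toFun c v := ∑ e : Q, if v ∈ e.1 then c e else 0
  map_add' c c' := by
    funext v
    simp only [Pi.add_apply, ← Finset.sum_add_distrib]
    refine Finset.sum_congr rfl fun e _ => ?_
    split_ifs <;> simp
  map_smul' a c := by
    funext v
    simp only [Pi.smul_apply, smul_eq_mul, RingHom.id_apply, Finset.mul_sum]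
    refine Finset.sum_congr rfl fun e _ => ?_
    split_ifs <;> simp

lemma bd_apply {V : Type} (Q : Finset (Sym2 V)) (c : Q → ZMod 2) (v : V) :
    bd Q c v = ∑ e : Q, if v ∈ e.1 then c e else 0 := rfl

lemma sum_mem_edge {V : Type} (S : Finset V) (a b : V) (hab : a ≠ b) (x : ZMod 2) :
    ∑ v ∈ S, (if v ∈ s(a, b) then x else 0) =
      (if a ∈ S then x else 0) + (if b ∈ S then x else 0) := by
  have : ∀ v ∈ S, (if v ∈ s(a, b) then x else 0) =
      (if v = a then x else 0) + (if v = b then x else 0) := by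
    intro v _
    by_cases h1 : v = a
    · subst h1; simp [hab]
    · by_cases h2 : v = b
      · subst h2; simp [Ne.symm hab]
      · simp [h1, h2]
  rw [Finset.sum_congr rfl this, Finset.sum_add_distrib, Finset.sum_ite_eq', Finset.sum_ite_eq']

lemma sum_bd {V : Type} (Q : Finset (Sym2 V)) (c : Q → ZMod 2) (S : Finset V) :
    ∑ v ∈ S, bd Q c v = ∑ e : Q, ∑ v ∈ S, if v ∈ e.1 then c e else 0 := by
  simp only [bd_apply]
  exact Finset.sum_comm

lemma z2_add_self (x : ZMod 2) : x + x = 0 := CharTwo.add_self_eq_zero x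

lemma finrank_ker_bd {V : Type} (Q : Finset (Sym2 V)) (S : Finset V) (hS : S.Nonempty)
    (hd : ∀ e ∈ Q, ¬ e.IsDiag) (hQ : ∀ e ∈ Q, ∀ v ∈ e, v ∈ S) :
    Q.card + 1 ≤ Module.finrank (ZMod 2) (LinearMap.ker (bd Q)) + S.card := by
  let r : (V → ZMod 2) →ₗ[ZMod 2] (S → ZMod 2) := LinearMap.funLeft _ _ (fun s : S => s.1)
  let b := r ∘ₗ bd Q
  have hker : LinearMap.ker b = LinearMap.ker (bd Q) := by
    ext c
    simp only [LinearMap.mem_ker]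
    constructor
    · intro h
      funext v
      by_cases hv : v ∈ S
      · exact congrFun h ⟨v, hv⟩
      · rw [bd_apply]
        refine Finset.sum_eq_zero fun e _ => ?_
        rw [if_neg]
        intro h'
        exact hv (hQ _ e.2 _ h')
    · intro h
      simp [b, h]
  have hrk := LinearMap.finrank_range_add_finrank_ker b
  have hne : LinearMap.range b ≠ ⊤ := by
    intro htop
    obtain ⟨s, hs⟩ := hS
    have : Pi.single (⟨s, hs⟩ : S) (1 : ZMod 2) ∈ LinearMap.range b := by rw [htop]; trivial
    obtain ⟨c, hc⟩ := this
    have h1 : ∑ v : S, b c v = 1 := by rw [hc]; simp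
    have h2 : ∑ v : S, b c v = ∑ v ∈ S, bd Q c v := by
      rw [← Finset.sum_coe_sort S]
      rfl
    rw [h2, sum_bd] at h1
    have h3 : ∀ e : Q, (∑ v ∈ S, if v ∈ e.1 then c e else 0) = 0 := by
      rintro ⟨e, he⟩
      induction e using Sym2.ind with
      | _ x y =>
        have hxy : x ≠ y := by simpa using hd _ he
        rw [sum_mem_edge S x y hxy, if_pos (hQ _ he _ (by simp)), if_pos (hQ _ he _ (by simp))]
        exact z2_add_self _
    simp [h3] at h1
  have hlt := Submodule.finrank_lt hne
  rw [hker] at hrk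
  simp only [Module.finrank_fintype_fun_eq_card, Fintype.card_coe] at hrk hlt
  omega

/-- Counting with a sparse spanning family of the cycle space. -/
lemma macLane_count {V ι : Type} [Fintype ι] (Q : Finset (Sym2 V)) (S : Finset V) (hS : S.Nonempty)
    (hd : ∀ e ∈ Q, ¬ e.IsDiag) (hQ : ∀ e ∈ Q, ∀ v ∈ e, v ∈ S)
    (b : ι → Q → ZMod 2) (hb : ∀ i, bd Q (b i) = 0)
    (hspan : LinearMap.ker (bd Q) ≤ Submodule.span (ZMod 2) (Set.range b))
    (h2 : ∀ e, (Finset.univ.filter fun i => b i e ≠ 0).card ≤ 2)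
    (g : ℕ) (hg : ∀ c : Q → ZMod 2, bd Q c = 0 → c ≠ 0 →
      g ≤ (Finset.univ.filter fun e => c e ≠ 0).card) :
    g * (Q.card + 1) ≤ 2 * Q.card + g * S.card := by
  have hrk := finrank_ker_bd Q S hS hd hQ
  obtain ⟨T, hTsub, hspanT, hTli⟩ := exists_linearIndependent (ZMod 2) (Set.range b)
  have hTfin : T.Finite := (Set.finite_range b).subset hTsub
  have : Fintype T := hTfin.fintype
  have hcard : Module.finrank (ZMod 2) (LinearMap.ker (bd Q)) ≤ Fintype.card T := by
    rw [← hspanT] at hspan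
    refine (Submodule.finrank_mono hspan).trans ?_
    have := finrank_span_le_card (R := ZMod 2) T
    rwa [Set.toFinset_card] at this
  choose f hf using fun t : T => hTsub t.2
  have hfinj : Function.Injective f := by
    intro t t' h
    apply Subtype.ext
    rw [← hf t, ← hf t', h]
  have hsum : g * Fintype.card T ≤ ∑ t : T, (Finset.univ.filter fun e => b (f t) e ≠ 0).card := by
    rw [mul_comm, ← smul_eq_mul, ← Finset.card_univ]
    refine Finset.card_nsmul_le_sum _ _ _ fun t _ => ?_
    refine hg _ (hb _) ?_
    have := hTli.ne_zero t
    rw [hf]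
    exact this
  have hsum2 : ∑ t : T, (Finset.univ.filter fun e => b (f t) e ≠ 0).card
      ≤ ∑ i : ι, (Finset.univ.filter fun e => b i e ≠ 0).card := by
    rw [← Finset.sum_image (s := Finset.univ) (g := f)
      (f := fun i => (Finset.univ.filter fun e => b i e ≠ 0).card) (fun x _ y _ h => hfinj h)]
    exact Finset.sum_le_sum_of_subset (Finset.subset_univ _)
  have hsum3 : ∑ i : ι, (Finset.univ.filter fun e => b i e ≠ 0).card ≤ 2 * Q.card := by
    simp only [Finset.card_filter]
    rw [Finset.sum_comm]
    simp only [← Finset.card_filter]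
    refine (Finset.sum_le_card_nsmul _ _ 2 fun e _ => h2 e).trans ?_
    simp [mul_comm]
  have : g * (Q.card + 1) ≤ g * (Fintype.card T + S.card) := Nat.mul_le_mul_left _ (by omega)
  rw [Nat.mul_add g (Fintype.card T)] at this
  omega

/-- an even chain which is nonzero at an edge is nonzero at another edge at a given end -/
lemma even_other {V : Type} (Q : Finset (Sym2 V)) (c : Q → ZMod 2) (hc : bd Q c = 0)
    (e : Q) (he : c e ≠ 0) (v : V) (hv : v ∈ e.1) : ∃ f : Q, c f ≠ 0 ∧ f ≠ e ∧ v ∈ f.1 := by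
  by_contra! hcon
  have h := congrFun hc v
  rw [bd_apply, Finset.sum_eq_single e] at h
  · simp [hv] at h; exact he h
  · intro f _ hfe
    split_ifs with hvf
    · by_contra h0
      exact hcon f h0 hfe hvf
    · rfl
  · simp

lemma girth3 {V : Type} (Q : Finset (Sym2 V)) (hd : ∀ e ∈ Q, ¬ e.IsDiag)
    (c : Q → ZMod 2) (hc : bd Q c = 0) (h0 : c ≠ 0) :
    3 ≤ (Finset.univ.filter fun e => c e ≠ 0).card := by
  obtain ⟨⟨e, heQ⟩, he⟩ := Function.ne_iff.mp h0
  induction e using Sym2.ind with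
  | _ u v =>
    have huv : u ≠ v := by simpa using hd _ heQ
    obtain ⟨f, hf0, hfe, hf⟩ := even_other Q c hc _ he u (by simp)
    obtain ⟨g, hg0, hge, hg⟩ := even_other Q c hc _ he v (by simp)
    have hfg : f ≠ g := by
      rintro rfl
      apply hfe
      apply Subtype.ext
      exact (Sym2.mem_and_mem_iff huv).mp ⟨hf, hg⟩
    have : ({⟨s(u, v), heQ⟩, f, g} : Finset Q) ⊆ Finset.univ.filter fun e => c e ≠ 0 := by
      intro x hx
      simp only [Finset.mem_insert, Finset.mem_singleton] at hx
      rcases hx with rfl | rfl | rfl <;> simpa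
    refine le_trans ?_ (Finset.card_le_card this)
    rw [Finset.card_eq_three.mpr ⟨_, f, g, hfe.symm, hge.symm, hfg, rfl⟩]

lemma girth4 {V : Type} (Q : Finset (Sym2 V)) (A : Set V)
    (hA : ∀ a b, s(a, b) ∈ Q → (a ∈ A ↔ b ∉ A))
    (c : Q → ZMod 2) (hc : bd Q c = 0) (h0 : c ≠ 0) :
    4 ≤ (Finset.univ.filter fun e => c e ≠ 0).card := by
  have hne : ∀ a b, s(a, b) ∈ Q → a ≠ b := by
    rintro a b h rfl
    have := hA _ _ h
    tauto
  obtain ⟨⟨e, heQ⟩, he⟩ := Function.ne_iff.mp h0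
  induction e using Sym2.ind with
  | _ u v =>
    have huv : u ≠ v := hne _ _ heQ
    obtain ⟨⟨f, hfQ⟩, hf0, hfe, hf⟩ := even_other Q c hc _ he u (by simp)
    obtain ⟨⟨g, hgQ⟩, hg0, hge, hg⟩ := even_other Q c hc _ he v (by simp)
    obtain ⟨w, rfl⟩ := hf
    obtain ⟨x, rfl⟩ := hg
    have h1 := hA _ _ heQ
    have h2 := hA _ _ hfQ
    have h3 := hA _ _ hgQ
    have hwx : w ≠ x := by rintro rfl; tauto
    have hwv : w ≠ v := by rintro rfl; exact hfe rfl
    have hxu : x ≠ u := by rintro rfl; exact hge (Subtype.ext (Sym2.eq_swap))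
    have hwu : w ≠ u := by rintro rfl; tauto
    have hxv : x ≠ v := by rintro rfl; tauto
    obtain ⟨⟨k, hkQ⟩, hk0, hkf, hk⟩ := even_other Q c hc _ hf0 w (by simp)
    obtain ⟨y, rfl⟩ := hk
    have : ({⟨s(u, v), heQ⟩, ⟨s(u, w), hfQ⟩, ⟨s(v, x), hgQ⟩, ⟨s(w, y), hkQ⟩} : Finset Q) ⊆
        Finset.univ.filter fun e => c e ≠ 0 := by
      intro z hz
      simp only [Finset.mem_insert, Finset.mem_singleton] at hz
      rcases hz with rfl | rfl | rfl | rfl <;> simpa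
    refine le_trans ?_ (Finset.card_le_card this)
    have hyu : y ≠ u := by rintro rfl; exact hkf (Subtype.ext (Sym2.eq_swap))
    rw [Finset.card_insert_of_notMem, Finset.card_insert_of_notMem, Finset.card_insert_of_notMem,
      Finset.card_singleton]
    all_goals simp
    all_goals grind

end PlanarExt

namespace PlanarExt
open Classical
open scoped BigOperators

/-- Grid edges: base point and direction (`true` is vertical). -/
abbrev Ed := (ℤ × ℤ) × Bool

def src (g : Ed) : ℤ × ℤ := g.1
def tgt (g : Ed) : ℤ × ℤ := if g.2 then (g.1.1, g.1.2 + 1) else (g.1.1 + 1, g.1.2)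
/-- the second unit square next to a grid edge; the first one is the one based at `g.1` -/
def side (g : Ed) : ℤ × ℤ := if g.2 then (g.1.1 - 1, g.1.2) else (g.1.1, g.1.2 - 1)

def GAdj (a b : ℤ × ℤ) : Prop := ∃ g, (src g = a ∧ tgt g = b) ∨ (src g = b ∧ tgt g = a)

/-- boundary of a grid chain -/
noncomputable def gbd : (Ed →₀ ZMod 2) →ₗ[ZMod 2] (ℤ × ℤ →₀ ZMod 2) :=
  Finsupp.linearCombination (ZMod 2)
    (fun g => Finsupp.single (src g) 1 + Finsupp.single (tgt g) 1)

lemma gbd_single (g : Ed) (x : ZMod 2) : gbd (Finsupp.single g x) =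
    x • (Finsupp.single (src g) 1 + Finsupp.single (tgt g) 1) := by
  simp [gbd, Finsupp.linearCombination_single]

lemma gbd_apply (c : Ed →₀ ZMod 2) (i j : ℤ) : gbd c (i, j) =
    c ((i, j), false) + c ((i - 1, j), false) + c ((i, j), true) + c ((i, j - 1), true) := by
  induction c using Finsupp.induction_linear with
  | zero => simp
  | add f g hf hg => rw [map_add]; simp only [Finsupp.add_apply, hf, hg]; ring
  | single g x =>
    obtain ⟨⟨a, b⟩, d⟩ := g
    rw [gbd_single]
    cases d
    · by_cases h1 : a = i ∧ b = j
      · obtain ⟨rfl, rfl⟩ := h1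
        simp [src, tgt]
      · by_cases h2 : a = i - 1 ∧ b = j
        · obtain ⟨rfl, rfl⟩ := h2
          simp [src, tgt]
        · have h3 : ¬ (a + 1 = i ∧ b = j) := by omega
          simp [src, tgt, h1, h2, h3]
    · by_cases h1 : a = i ∧ b = j
      · obtain ⟨rfl, rfl⟩ := h1
        simp [src, tgt]
      · by_cases h2 : a = i ∧ b = j - 1
        · obtain ⟨rfl, rfl⟩ := h2
          simp [src, tgt]
        · have h3 : ¬ (a = i ∧ b + 1 = j) := by omega
          simp [src, tgt, h1, h2, h3]

/-- coboundary of a function on squares -/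
def cob (x : ℤ × ℤ → ZMod 2) (g : Ed) : ZMod 2 := x g.1 + x (side g)

lemma int_antideriv (f : ℤ → ZMod 2) :
    ∃ F : ℤ → ZMod 2, F 0 = 0 ∧ ∀ j, F j = F (j - 1) + f j := by
  refine ⟨fun j => ∑ k ∈ Finset.Ioc 0 j, f k + ∑ k ∈ Finset.Ioc j 0, f k, by simp, fun j => ?_⟩
  rcases lt_or_ge 0 j with h | h
  · have h1 : Finset.Ioc 0 j = insert j (Finset.Ioc 0 (j - 1)) := by
      ext k; simp only [Finset.mem_Ioc, Finset.mem_insert]; omega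
    have h2 : Finset.Ioc j 0 = ∅ := by ext k; simp; omega
    have h3 : Finset.Ioc (j - 1) 0 = ∅ := by ext k; simp; omega
    simp only [h1, h2, h3]
    rw [Finset.sum_insert (by simp)]
    simp [add_comm]
  · have h1 : Finset.Ioc (j - 1) 0 = insert j (Finset.Ioc j 0) := by
      ext k; simp only [Finset.mem_Ioc, Finset.mem_insert]; omega
    have h2 : Finset.Ioc 0 j = ∅ := by ext k; simp; omega
    have h3 : Finset.Ioc 0 (j - 1) = ∅ := by ext k; simp; omega
    simp only [h1, h2, h3]
    rw [Finset.sum_insert (by simp)]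
    have := z2_add_self (f j)
    simp only [Finset.sum_empty, zero_add]
    linear_combination -this

lemma exists_cob (c : Ed →₀ ZMod 2) (hc : gbd c = 0) : ∃ x, ∀ g, c g = cob x g := by
  obtain ⟨A, hA0, hA⟩ := int_antideriv (fun i => c ((i, 0), true))
  choose B hB0 hB using fun i => int_antideriv (fun j => c ((i, j), false))
  have hcl : ∀ i j, c ((i, j), false) + c ((i - 1, j), false) + c ((i, j), true)
      + c ((i, j - 1), true) = 0 := by
    intro i j
    rw [← gbd_apply, hc]; rfl
  have hv : ∀ i j, c ((i, j), true) = A i + B i j + (A (i - 1) + B (i - 1) j) := by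
    intro i j
    induction j using Int.induction_on with
    | zero =>
      rw [hB0, hB0, hA i]
      linear_combination -(z2_add_self (A (i - 1)))
    | succ j ih =>
      have h := hcl i (j + 1)
      have h1 := hB i (j + 1)
      have h2 := hB (i - 1) (j + 1)
      rw [show ((j : ℤ) + 1 - 1) = j by ring] at h h1 h2
      rw [h1, h2]
      linear_combination h - ih - z2_add_self (c ((i, (j:ℤ)+1), false)) -
        z2_add_self (c ((i - 1, (j:ℤ)+1), false)) -
        z2_add_self (A i + B i j + (A (i - 1) + B (i - 1) j))
    | pred j ih =>
      have h := hcl i (-j)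
      have h1 := hB i (-j)
      have h2 := hB (i - 1) (-j)
      rw [h1, h2] at ih
      linear_combination h - ih - z2_add_self (c ((i, (-j:ℤ)), false)) -
        z2_add_self (c ((i - 1, (-j:ℤ)), false)) -
        z2_add_self (A i + B i (-j - 1) + (A (i - 1) + B (i - 1) (-j - 1)))
  refine ⟨fun p => A p.1 + B p.1 p.2, ?_⟩
  rintro ⟨⟨i, j⟩, d⟩
  cases d
  · simp only [cob, side]
    have := hB i j
    simp
    rw [this]
    linear_combination -(z2_add_self (A i)) - z2_add_self (B i (j - 1))
  · simp only [cob, side]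
    simpa using hv i j

lemma gbd_of_cob (c : Ed →₀ ZMod 2) (x : ℤ × ℤ → ZMod 2) (h : ∀ g, c g = cob x g) :
    gbd c = 0 := by
  ext ⟨i, j⟩
  rw [gbd_apply]
  simp only [h, cob, side]
  simp
  linear_combination z2_add_self (x (i, j)) + z2_add_self (x (i - 1, j)) +
    z2_add_self (x (i, j - 1)) + z2_add_self (x (i - 1, j - 1))

end PlanarExt

namespace PlanarExt
open Classical
open scoped BigOperators

/-- A minor model, in the integer grid, of the graph with edge set `Q`. -/
structure GridModel {V : Type} (Q : Finset (Sym2 V)) where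
  B : V → Set (ℤ × ℤ)
  q : V → ℤ × ℤ
  conn : ∀ v, ∀ b ∈ B v,
    Relation.ReflTransGen (fun a b => a ∈ B v ∧ b ∈ B v ∧ GAdj a b) (q v) b
  fin : ∀ v, (B v).Finite
  disj : ∀ u v x, x ∈ B u → x ∈ B v → u = v
  ge : Q → Ed
  hge : ∀ e : Q, ∃ u v, u ≠ v ∧ e.1 = s(u, v) ∧ src (ge e) ∈ B u ∧ tgt (ge e) ∈ B v

namespace GridModel
variable {V : Type} {Q : Finset (Sym2 V)} (M : GridModel Q)

def Inside (g : Ed) : Prop := ∃ v, src g ∈ M.B v ∧ tgt g ∈ M.B v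
def R (g : Ed) : Prop := M.Inside g ∨ ∃ e, g = M.ge e

lemma not_inside (e : Q) : ¬ M.Inside (M.ge e) := by
  rintro ⟨w, h1, h2⟩
  obtain ⟨u, v, huv, -, h3, h4⟩ := M.hge e
  exact huv ((M.disj _ _ _ h3 h1).trans (M.disj _ _ _ h2 h4))

lemma ge_inj : Function.Injective M.ge := by
  intro e e' h
  obtain ⟨u, v, huv, he, h3, h4⟩ := M.hge e
  obtain ⟨u', v', huv', he', h3', h4'⟩ := M.hge e'
  rw [h] at h3 h4
  apply Subtype.ext
  rw [he, he', M.disj _ _ _ h3 h3', M.disj _ _ _ h4 h4']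

lemma finite_R [Finite V] : {g | M.R g}.Finite := by
  have h1 : {g | M.Inside g} ⊆ (⋃ v, M.B v) ×ˢ (Set.univ : Set Bool) := by
    rintro g ⟨v, h, -⟩
    exact ⟨Set.mem_iUnion.mpr ⟨v, h⟩, trivial⟩
  have h2 : {g | M.Inside g}.Finite :=
    ((Set.finite_iUnion M.fin).prod Set.finite_univ).subset h1
  have h3 : (Set.range M.ge).Finite := Set.finite_range _
  refine (h2.union h3).subset ?_
  rintro g (h | ⟨e, rfl⟩)
  · exact Or.inl h
  · exact Or.inr ⟨e, rfl⟩

lemma tau (v : V) (b : ℤ × ℤ) (hb : b ∈ M.B v) : ∃ τ : Ed →₀ ZMod 2,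
    gbd τ = Finsupp.single (M.q v) 1 + Finsupp.single b 1 ∧ ∀ g, τ g ≠ 0 → M.Inside g := by
  have h := M.conn v b hb
  clear hb
  induction h with
  | refl =>
    refine ⟨0, ?_, by simp⟩
    rw [← Finsupp.single_add, z2_add_self]; simp
  | @tail b c _ hbc ih =>
    obtain ⟨τ, h1, h2⟩ := ih
    obtain ⟨hb, hc, g, hg⟩ := hbc
    refine ⟨τ + Finsupp.single g 1, ?_, ?_⟩
    · rw [map_add, h1, gbd_single, one_smul]
      have : Finsupp.single b (1 : ZMod 2) + Finsupp.single b 1 = 0 := by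
        rw [← Finsupp.single_add, z2_add_self]; simp
      rcases hg with ⟨h, h'⟩ | ⟨h, h'⟩ <;> rw [h, h']
      · calc _ = Finsupp.single (M.q v) 1 + Finsupp.single c (1 : ZMod 2) +
            (Finsupp.single b (1 : ZMod 2) + Finsupp.single b 1) := by abel
          _ = _ := by rw [this, add_zero]
      · calc _ = Finsupp.single (M.q v) 1 + Finsupp.single c (1 : ZMod 2) +
            (Finsupp.single b (1 : ZMod 2) + Finsupp.single b 1) := by abel
          _ = _ := by rw [this, add_zero]
    · intro g' hg'
      by_cases h0 : τ g' = 0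
      · have : g = g' := by
          by_contra hne
          simp [h0, hne] at hg'
        subst this
        rcases hg with ⟨h, h'⟩ | ⟨h, h'⟩ <;> exact ⟨v, by rw [h]; assumption, by rw [h']; assumption⟩
      · exact h2 _ h0

lemma lam [Fintype V] (e : Q) : ∃ l : Ed →₀ ZMod 2,
    gbd l = ∑ w : V, (if w ∈ e.1 then (1 : ZMod 2) else 0) • Finsupp.single (M.q w) (1 : ZMod 2) ∧
    (∀ g, l g ≠ 0 → M.R g) ∧ ∀ e', l (M.ge e') = if e = e' then 1 else 0 := by
  obtain ⟨u, v, huv, he, h3, h4⟩ := M.hge e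
  obtain ⟨τ, ht, hti⟩ := M.tau u _ h3
  obtain ⟨σ, hs, hsi⟩ := M.tau v _ h4
  refine ⟨τ + σ + Finsupp.single (M.ge e) 1, ?_, ?_, ?_⟩
  · have hsum : ∑ w : V, (if w ∈ e.1 then (1 : ZMod 2) else 0) •
        Finsupp.single (M.q w) (1 : ZMod 2) =
        Finsupp.single (M.q u) 1 + Finsupp.single (M.q v) 1 := by
      rw [he, Finset.sum_eq_add u v huv]
      · simp
      · intro c _ hc
        simp [hc.1, hc.2]
      · simp
      · simp
    rw [hsum, map_add, map_add, ht, hs, gbd_single, one_smul]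
    have h : ∀ b : ℤ × ℤ, Finsupp.single b (1 : ZMod 2) + Finsupp.single b 1 = 0 := by
      intro b
      rw [← Finsupp.single_add, z2_add_self]; simp
    calc _ = Finsupp.single (M.q u) 1 + Finsupp.single (M.q v) 1 +
            (Finsupp.single (src (M.ge e)) (1 : ZMod 2) + Finsupp.single (src (M.ge e)) 1) +
            (Finsupp.single (tgt (M.ge e)) (1 : ZMod 2) + Finsupp.single (tgt (M.ge e)) 1) := by abel
          _ = _ := by rw [h, h, add_zero, add_zero]
  · intro g hg
    by_cases h1 : τ g = 0
    · by_cases h2 : σ g = 0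
      · right
        refine ⟨e, ?_⟩
        by_contra hne
        simp [h1, h2, Ne.symm hne] at hg
      · exact Or.inl (hsi _ h2)
    · exact Or.inl (hti _ h1)
  · intro e'
    have h1 : τ (M.ge e') = 0 := by
      by_contra h; exact M.not_inside e' (hti _ h)
    have h2 : σ (M.ge e') = 0 := by
      by_contra h; exact M.not_inside e' (hsi _ h)
    simp [h1, h2, Finsupp.single_apply, M.ge_inj.eq_iff]

lemma lift [Fintype V] (c : Q → ZMod 2) (hc : bd Q c = 0) : ∃ C : Ed →₀ ZMod 2,
    gbd C = 0 ∧ (∀ g, C g ≠ 0 → M.R g) ∧ ∀ e, C (M.ge e) = c e := by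
  choose l hl1 hl2 hl3 using M.lam
  refine ⟨∑ e, c e • l e, ?_, ?_, ?_⟩
  · rw [map_sum]
    simp only [map_smul, hl1, Finset.smul_sum, smul_smul]
    rw [Finset.sum_comm]
    refine Finset.sum_eq_zero fun w _ => ?_
    rw [← Finset.sum_smul]
    have := congrFun hc w
    rw [bd_apply] at this
    simp only [mul_ite, mul_one, mul_zero]
    rw [this]; simp
  · intro g hg
    by_contra hR
    apply hg
    rw [Finsupp.finsetSum_apply]
    refine Finset.sum_eq_zero fun e _ => ?_
    have : l e g = 0 := by
      by_contra h; exact hR (hl2 _ _ h)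
    simp [this]
  · intro e
    rw [Finsupp.finsetSum_apply]
    simp [hl3]

lemma push [Finite V] (x : ℤ × ℤ → ZMod 2) (hx : ∀ g, cob x g ≠ 0 → M.R g) :
    bd Q (fun e => cob x (M.ge e)) = 0 := by
  let C : Ed →₀ ZMod 2 := Finsupp.onFinset M.finite_R.toFinset (cob x) (by
    intro g hg; simpa using hx g hg)
  have hC : ∀ g, C g = cob x g := fun g => rfl
  have h0 := gbd_of_cob C x hC
  funext v
  let ℓ : (ℤ × ℤ →₀ ZMod 2) →ₗ[ZMod 2] ZMod 2 :=
    Finsupp.linearCombination (ZMod 2) (fun p => if p ∈ M.B v then (1 : ZMod 2) else 0)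
  have h1 : ℓ (gbd C) = 0 := by rw [h0]; simp
  let w : Ed → ZMod 2 := fun g =>
    (if src g ∈ M.B v then (1 : ZMod 2) else 0) + (if tgt g ∈ M.B v then (1 : ZMod 2) else 0)
  have h2 : ∀ D : Ed →₀ ZMod 2, ℓ (gbd D) = D.sum (fun g a => a * w g) := by
    intro D
    induction D using Finsupp.induction_linear with
    | zero => simp
    | add f g hf hg =>
      rw [map_add, map_add, hf, hg, Finsupp.sum_add_index']
      · simp
      · intros; ring
    | single g a =>
      rw [gbd_single, Finsupp.sum_single_index (by simp)]
      simp [ℓ, w, Finsupp.linearCombination_single, mul_add]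
  have hw : ∀ g, M.Inside g → w g = 0 := by
    rintro g ⟨u, ha, hb⟩
    by_cases huv : u = v
    · subst huv
      simp only [w, ha, hb, if_true]; exact z2_add_self _
    · have h3 : src g ∉ M.B v := fun h => huv (M.disj _ _ _ ha h)
      have h4 : tgt g ∉ M.B v := fun h => huv (M.disj _ _ _ hb h)
      simp [w, h3, h4]
  have hwe : ∀ e : Q, w (M.ge e) = if v ∈ e.1 then 1 else 0 := by
    intro e
    obtain ⟨a, b, hab, he, h3, h4⟩ := M.hge e
    have ha : src (M.ge e) ∈ M.B v ↔ v = a :=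
      ⟨fun h => M.disj _ _ _ h h3, by rintro rfl; exact h3⟩
    have hb : tgt (M.ge e) ∈ M.B v ↔ v = b :=
      ⟨fun h => M.disj _ _ _ h h4, by rintro rfl; exact h4⟩
    simp only [w, ha, hb, he, Sym2.mem_iff]
    by_cases h5 : v = a
    · subst h5; simp [hab]
    · simp [h5]
  rw [h2, Finsupp.sum_of_support_subset C (s := M.finite_R.toFinset)
    (by intro g hg; simpa using hx g (by simpa [hC] using hg)) _ (by simp)] at h1
  rw [bd_apply]
  have h5 : ∑ g ∈ Finset.univ.image M.ge, C g * w g = ∑ g ∈ M.finite_R.toFinset, C g * w g := by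
    apply Finset.sum_subset
    · intro g hg
      obtain ⟨e, -, rfl⟩ := Finset.mem_image.mp hg
      simp only [Set.Finite.mem_toFinset]
      exact Or.inr ⟨e, rfl⟩
    · intro g hg hg'
      simp only [Set.Finite.mem_toFinset] at hg
      rcases hg with h | ⟨e, rfl⟩
      · rw [hw g h, mul_zero]
      · exact absurd (Finset.mem_image_of_mem _ (Finset.mem_univ e)) hg'
  rw [h1, Finset.sum_image (fun a _ b _ h => M.ge_inj h)] at h5
  refine Eq.trans ?_ h5
  refine Finset.sum_congr rfl fun e _ => ?_
  rw [hwe, hC]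
  simp

def rel (s s' : ℤ × ℤ) : Prop := ∃ g : Ed, ¬ M.R g ∧ g.1 = s ∧ side g = s'

/-- The count for graphs with a grid model. -/
lemma count [Fintype V] (M : GridModel Q) (S : Finset V) (hS : S.Nonempty)
    (hQ : ∀ e ∈ Q, ∀ v ∈ e, v ∈ S) (g : ℕ)
    (hg : ∀ c : Q → ZMod 2, bd Q c = 0 → c ≠ 0 →
      g ≤ (Finset.univ.filter fun e => c e ≠ 0).card) :
    g * (Q.card + 1) ≤ 2 * Q.card + g * S.card := by
  have hd : ∀ e ∈ Q, ¬ e.IsDiag := by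
    intro e he
    obtain ⟨u, v, huv, h, -⟩ := M.hge ⟨e, he⟩
    simp only at h
    rw [h]; simpa using huv
  let mk : ℤ × ℤ → Quot M.rel := Quot.mk _
  let a : Q → Quot M.rel := fun e => mk (M.ge e).1
  let a' : Q → Quot M.rel := fun e => mk (side (M.ge e))
  let I : Finset (Quot M.rel) := Finset.univ.image a ∪ Finset.univ.image a'
  have haI : ∀ e, a e ∈ I := fun e => by simp [I]
  have haI' : ∀ e, a' e ∈ I := fun e => by simp [I]
  let b : I → Q → ZMod 2 := fun κ e => (if a e = κ then 1 else 0) + (if a' e = κ then 1 else 0)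
  refine macLane_count Q S hS hd hQ b ?_ ?_ ?_ g hg
  · intro κ
    refine M.push (fun s => if mk s = κ then 1 else 0) ?_
    intro g hg
    by_contra hR
    apply hg
    have : mk g.1 = mk (side g) := Quot.sound ⟨g, hR, rfl, rfl⟩
    simp only [cob, this]
    exact z2_add_self _
  · intro c hc
    obtain ⟨C, hC, hCR, hCe⟩ := M.lift c hc
    obtain ⟨x, hx⟩ := exists_cob C hC
    have hxr : ∀ s s', M.rel s s' → x s = x s' := by
      rintro s s' ⟨g, hg, rfl, rfl⟩
      have h0 : C g = 0 := by
        by_contra h; exact hg (hCR _ h)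
      rw [hx, cob] at h0
      exact CharTwo.add_eq_zero.mp h0
    let y : Quot M.rel → ZMod 2 := Quot.lift x hxr
    have : c = ∑ κ : I, y κ • b κ := by
      funext e
      rw [← hCe, hx, Finset.sum_apply]
      simp only [Pi.smul_apply, smul_eq_mul, b, mul_add, mul_ite, mul_one, mul_zero]
      rw [Finset.sum_add_distrib]
      rw [Finset.sum_eq_single (⟨a e, haI e⟩ : I), Finset.sum_eq_single (⟨a' e, haI' e⟩ : I)]
      · simp [cob, y, a, a', mk]
      · rintro κ - hκ
        rw [if_neg]; rintro h; exact hκ (Subtype.ext h.symm)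
      · simp
      · rintro κ - hκ
        rw [if_neg]; rintro h; exact hκ (Subtype.ext h.symm)
      · simp
    rw [this]
    exact Submodule.sum_mem _ fun κ _ => Submodule.smul_mem _ _ (Submodule.subset_span ⟨κ, rfl⟩)
  · intro e
    have : (Finset.univ.filter fun i => b i e ≠ 0) ⊆ {⟨a e, haI e⟩, ⟨a' e, haI' e⟩} := by
      intro κ hκ
      simp only [Finset.mem_filter, Finset.mem_univ, true_and] at hκ
      simp only [Finset.mem_insert, Finset.mem_singleton]
      by_contra! hcon
      apply hκ
      have h1 : a e ≠ κ := fun h => hcon.1 (Subtype.ext h.symm)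
      have h2 : a' e ≠ κ := fun h => hcon.2 (Subtype.ext h.symm)
      simp [b, h1, h2]
    exact (Finset.card_le_card this).trans Finset.card_le_two

lemma bound3 [Fintype V] (M : GridModel Q) (S : Finset V) (hS : S.Nonempty)
    (hQ : ∀ e ∈ Q, ∀ v ∈ e, v ∈ S) : Q.card + 3 ≤ 3 * S.card := by
  have hd : ∀ e ∈ Q, ¬ e.IsDiag := by
    intro e he
    obtain ⟨u, v, huv, h, -⟩ := M.hge ⟨e, he⟩
    simp only at h
    rw [h]; simpa using huv
  have := M.count S hS hQ 3 (fun c h1 h2 => girth3 Q hd c h1 h2)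
  omega

lemma bound2 [Fintype V] (M : GridModel Q) (S : Finset V) (hS : S.Nonempty)
    (hQ : ∀ e ∈ Q, ∀ v ∈ e, v ∈ S) (A : Set V)
    (hA : ∀ a b, s(a, b) ∈ Q → (a ∈ A ↔ b ∉ A)) : Q.card + 2 ≤ 2 * S.card := by
  have := M.count S hS hQ 4 (fun c h1 h2 => girth4 Q A hA c h1 h2)
  omega

end GridModel

end PlanarExt

namespace PlanarExt
open Classical
open scoped BigOperators

lemma GAdj.symm {a b : ℤ × ℤ} (h : GAdj a b) : GAdj b a := by
  obtain ⟨g, hg⟩ := h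
  exact ⟨g, hg.symm⟩

/-- adjacency inside a set -/
def Step (X : Set (ℤ × ℤ)) (a b : ℤ × ℤ) : Prop := a ∈ X ∧ b ∈ X ∧ GAdj a b

abbrev Reach (X : Set (ℤ × ℤ)) := Relation.ReflTransGen (Step X)

lemma Reach.symm {X : Set (ℤ × ℤ)} {a b : ℤ × ℤ} (h : Reach X a b) : Reach X b a := by
  induction h with
  | refl => exact Relation.ReflTransGen.refl
  | tail _ h ih => exact Relation.ReflTransGen.head ⟨h.2.1, h.1, h.2.2.symm⟩ ih

lemma reach_horiz (X : Set (ℤ × ℤ)) (j i i' : ℤ) (hi : i ≤ i')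
    (h : ∀ k, i ≤ k → k ≤ i' → (k, j) ∈ X) : Reach X (i, j) (i', j) := by
  induction i', hi using Int.leInduction with
  | base => exact Relation.ReflTransGen.refl
  | succ n hn ih =>
    refine (ih fun k h1 h2 => h k h1 (by omega)).tail ⟨h n hn (by omega), h _ (by omega) le_rfl, ?_⟩
    exact ⟨((n, j), false), Or.inl ⟨rfl, rfl⟩⟩

lemma reach_vert (X : Set (ℤ × ℤ)) (i j j' : ℤ) (hj : j ≤ j')
    (h : ∀ k, j ≤ k → k ≤ j' → (i, k) ∈ X) : Reach X (i, j) (i, j') := by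
  induction j', hj using Int.leInduction with
  | base => exact Relation.ReflTransGen.refl
  | succ n hn ih =>
    refine (ih fun k h1 h2 => h k h1 (by omega)).tail ⟨h n hn (by omega), h _ (by omega) le_rfl, ?_⟩
    exact ⟨((i, n), true), Or.inl ⟨rfl, rfl⟩⟩

/-- embedding of the grid -/
noncomputable def emb (h : ℝ) (q : ℤ × ℤ) : ℝ × ℝ := (h * q.1, h * q.2)
noncomputable def rnd (h : ℝ) (z : ℝ × ℝ) : ℤ × ℤ := (⌊z.1 / h⌋, ⌊z.2 / h⌋)

lemma dist_le_iff (x y : ℝ × ℝ) (R : ℝ) :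
    dist x y ≤ R ↔ |x.1 - y.1| ≤ R ∧ |x.2 - y.2| ≤ R := by
  rw [Prod.dist_eq, max_le_iff, Real.dist_eq, Real.dist_eq]

lemma floor_close {h : ℝ} (hh : 0 < h) (a : ℝ) : |h * (⌊a / h⌋ : ℤ) - a| ≤ h := by
  have h1 := Int.floor_le (a / h)
  have h2 := (Int.lt_floor_add_one (a / h)).le
  rw [le_div_iff₀ hh] at h1
  rw [div_le_iff₀ hh] at h2
  rw [abs_le]; constructor <;> nlinarith

lemma rnd_close {h : ℝ} (hh : 0 < h) (z : ℝ × ℝ) : dist (emb h (rnd h z)) z ≤ h := by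
  rw [dist_le_iff]
  exact ⟨floor_close hh _, floor_close hh _⟩

/-- boxes are connected -/
lemma reach_box {X : Set (ℤ × ℤ)} (a b : ℤ × ℤ)
    (h : ∀ k l, min a.1 b.1 ≤ k → k ≤ max a.1 b.1 → min a.2 b.2 ≤ l → l ≤ max a.2 b.2 →
      (k, l) ∈ X) : Reach X a b := by
  have h1 : Reach X (a.1, a.2) (b.1, a.2) := by
    rcases le_total a.1 b.1 with hab | hab
    · exact reach_horiz X _ _ _ hab fun k h1 h2 => h k a.2 (by simp [h1]) (by simp [h2])
        (by simp) (by simp)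
    · exact (reach_horiz X _ _ _ hab fun k h1 h2 => h k a.2 (by simp [h1]) (by simp [h2])
        (by simp) (by simp)).symm
  have h2 : Reach X (b.1, a.2) (b.1, b.2) := by
    rcases le_total a.2 b.2 with hab | hab
    · exact reach_vert X _ _ _ hab fun k h1 h2 => h b.1 k (by simp) (by simp)
        (by simp [h1]) (by simp [h2])
    · exact (reach_vert X _ _ _ hab fun k h1 h2 => h b.1 k (by simp) (by simp)
        (by simp [h1]) (by simp [h2])).symm
  exact h1.trans h2

lemma abs_between {x y k : ℤ} {h a R : ℝ} (hh : 0 < h) (hx : |h * x - a| ≤ R)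
    (hy : |h * y - a| ≤ R) (h1 : min x y ≤ k) (h2 : k ≤ max x y) : |h * k - a| ≤ R := by
  rw [abs_le] at *
  have h1' : (x : ℝ) ≤ k ∨ (y : ℝ) ≤ k := by
    rcases min_le_iff.mp h1 with h | h
    · left; exact_mod_cast h
    · right; exact_mod_cast h
  have h2' : (k : ℝ) ≤ x ∨ (k : ℝ) ≤ y := by
    rcases le_max_iff.mp h2 with h | h
    · left; exact_mod_cast h
    · right; exact_mod_cast h
  constructor
  · rcases h1' with h | h <;> nlinarith
  · rcases h2' with h | h <;> nlinarith

lemma reach_ball {h R : ℝ} (hh : 0 < h) (z : ℝ × ℝ) (a b : ℤ × ℤ)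
    (ha : dist (emb h a) z ≤ R) (hb : dist (emb h b) z ≤ R) :
    Reach {q | dist (emb h q) z ≤ R} a b := by
  rw [dist_le_iff] at ha hb
  refine reach_box a b fun k l h1 h2 h3 h4 => ?_
  show Dist.dist _ _ ≤ R
  rw [dist_le_iff]
  exact ⟨abs_between hh ha.1 hb.1 h1 h2, abs_between hh ha.2 hb.2 h3 h4⟩

lemma Reach.mono {X Y : Set (ℤ × ℤ)} (hXY : X ⊆ Y) {a b : ℤ × ℤ} (h : Reach X a b) :
    Reach Y a b := by
  induction h with
  | refl => exact Relation.ReflTransGen.refl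
  | tail _ h ih => exact ih.tail ⟨hXY h.1, hXY h.2.1, h.2.2⟩

lemma reach_path {h : ℝ} (hh : 0 < h) (α : unitInterval → ℝ × ℝ) (hα : Continuous α)
    (s s' : unitInterval) :
    Reach {q | ∃ t, dist (emb h q) (α t) ≤ 2 * h} (rnd h (α s)) (rnd h (α s')) := by
  have key : ∀ t t', dist (α t') (α t) < h →
      Reach {q | ∃ t, dist (emb h q) (α t) ≤ 2 * h} (rnd h (α t)) (rnd h (α t')) := by
    intro t t' htt
    refine (reach_ball (R := 2 * h) hh (α t) _ _ ?_ ?_).mono ?_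
    · have := rnd_close hh (α t); linarith
    · have := rnd_close hh (α t')
      have := dist_triangle (emb h (rnd h (α t'))) (α t') (α t)
      linarith
    · intro q hq
      exact ⟨t, hq⟩
  refine PreconnectedSpace.induction₂' (fun s s' =>
    Reach {q | ∃ t, dist (emb h q) (α t) ≤ 2 * h} (rnd h (α s)) (rnd h (α s'))) ?_ ?_ s s'
  · intro x
    have := Metric.tendsto_nhds.mp (hα.tendsto x) h hh
    filter_upwards [this] with y hy
    exact ⟨key _ _ hy, key _ _ (by rwa [_root_.dist_comm])⟩
  · exact ⟨fun _ _ _ h1 h2 => Relation.ReflTransGen.trans h1 h2⟩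

lemma exists_pos_le {ι : Type*} [Finite ι] (f : ι → ℝ) (hf : ∀ i, 0 < f i) :
    ∃ r > 0, ∀ i, r ≤ f i := by
  cases nonempty_fintype ι
  rcases isEmpty_or_nonempty ι with h | h
  · exact ⟨1, one_pos, fun i => (h.false i).elim⟩
  · obtain ⟨i, hi⟩ := Finite.exists_min f
    exact ⟨f i, hf i, hi⟩

theorem exists_gridModel {V : Type} [Fintype V] (Q : Finset (Sym2 V)) (p : V → ℝ × ℝ)
    (hp : Function.Injective p) (a b : Q → V) (hab : ∀ e, a e ≠ b e) (he : ∀ e : Q, e.1 = s(a e, b e))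
    (α : Q → unitInterval → ℝ × ℝ) (hα : ∀ e, Continuous (α e))
    (h0 : ∀ e, α e 0 = p (a e)) (h1 : ∀ e, α e 1 = p (b e))
    (havoid : ∀ (e : Q) (w : V) s, w ≠ a e → w ≠ b e → α e s ≠ p w)
    (hdisj : ∀ e e' s s', e ≠ e' → α e s = α e' s' → ∃ w, α e s = p w) :
    Nonempty (GridModel Q) := by
  -- the scale around vertices
  obtain ⟨r, hr, hr1, hr2⟩ : ∃ r > 0, (∀ u v, u ≠ v → 4 * r ≤ dist (p u) (p v)) ∧
      ∀ (e : Q) w s, w ≠ a e → w ≠ b e → 2 * r ≤ dist (α e s) (p w) := by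
    obtain ⟨r1, hr1, hr1'⟩ := exists_pos_le (fun x : {x : V × V // x.1 ≠ x.2} =>
      dist (p x.1.1) (p x.1.2)) (fun x => dist_pos.mpr (hp.ne x.2))
    obtain ⟨r2, hr2, hr2'⟩ := exists_pos_le
      (fun x : {x : Q × V // x.2 ≠ a x.1 ∧ x.2 ≠ b x.1} =>
      Metric.infDist (p x.1.2) (Set.range (α x.1.1))) (by
        intro x
        have hc : IsClosed (Set.range (α x.1.1)) := (isCompact_range (hα _)).isClosed
        refine (hc.notMem_iff_infDist_pos ⟨_, Set.mem_range_self 0⟩).mp ?_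
        rintro ⟨s, hs⟩
        exact havoid _ _ s x.2.1 x.2.2 hs)
    refine ⟨min r1 r2 / 4, by positivity, ?_, ?_⟩
    · intro u v huv
      have := hr1' ⟨(u, v), huv⟩
      have := min_le_left r1 r2
      simp only at *
      linarith
    · intro e w s hw1 hw2
      have h3 := hr2' ⟨(e, w), hw1, hw2⟩
      have h4 := min_le_right r1 r2
      have h5 : Metric.infDist (p w) (Set.range (α e)) ≤ dist (p w) (α e s) :=
        Metric.infDist_le_dist_of_mem (Set.mem_range_self s)
      rw [_root_.dist_comm] at h5
      simp only at *
      linarith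
  -- the scale between arcs
  obtain ⟨δ, hδ, hδ'⟩ : ∃ δ > 0, ∀ e e' s s', e ≠ e' → (∀ w, r ≤ dist (α e s) (p w)) →
      (∀ w, r ≤ dist (α e' s') (p w)) → δ ≤ dist (α e s) (α e' s') := by
    have : ∀ x : {x : Q × Q // x.1 ≠ x.2}, ∃ δ > 0, ∀ s s',
        (∀ w, r ≤ dist (α x.1.1 s) (p w)) →
        (∀ w, r ≤ dist (α x.1.2 s') (p w)) → δ ≤ dist (α x.1.1 s) (α x.1.2 s') := by
      rintro ⟨⟨e, e'⟩, hne⟩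
      let T : Set (unitInterval × unitInterval) :=
        {y | (∀ w, r ≤ dist (α e y.1) (p w)) ∧ ∀ w, r ≤ dist (α e' y.2) (p w)}
      have hcont1 : Continuous fun y : unitInterval × unitInterval => α e y.1 :=
        (hα e).comp continuous_fst
      have hcont2 : Continuous fun y : unitInterval × unitInterval => α e' y.2 :=
        (hα e').comp continuous_snd
      have hT : IsClosed T := by
        apply IsClosed.inter
        · show IsClosed {y : unitInterval × unitInterval | ∀ w, r ≤ dist (α e y.1) (p w)}
          rw [Set.ofPred_forall]
          exact isClosed_iInter fun w => isClosed_le continuous_const (hcont1.dist continuous_const)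
        · show IsClosed {y : unitInterval × unitInterval | ∀ w, r ≤ dist (α e' y.2) (p w)}
          rw [Set.ofPred_forall]
          exact isClosed_iInter fun w => isClosed_le continuous_const (hcont2.dist continuous_const)
      rcases T.eq_empty_or_nonempty with hemp | hne'
      · refine ⟨1, one_pos, fun s s' h h' => ?_⟩
        have : (s, s') ∈ T := ⟨h, h'⟩
        rw [hemp] at this
        exact this.elim
      · obtain ⟨y, hy, hmin⟩ := hT.isCompact.exists_isMinOn hne'
          (hcont1.dist hcont2).continuousOn
        refine ⟨dist (α e y.1) (α e' y.2), ?_, fun s s' h h' => ?_⟩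
        · rw [gt_iff_lt, dist_pos]
          intro heq
          obtain ⟨w, hw⟩ := hdisj _ _ _ _ hne heq
          have := hy.1 w
          rw [hw, _root_.dist_self] at this
          linarith
        · exact hmin (show (s, s') ∈ T from ⟨h, h'⟩)
    choose d hd hd' using this
    obtain ⟨δ, hδ, hδ'⟩ := exists_pos_le d hd
    exact ⟨δ, hδ, fun e e' s s' hne h h' => (hδ' ⟨(e, e'), hne⟩).trans (hd' ⟨(e, e'), hne⟩ _ _ h h')⟩
  -- the mesh
  obtain ⟨h, hh, hhr, hhδ⟩ : ∃ h > 0, 8 * h ≤ r ∧ 8 * h ≤ δ :=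
    ⟨min r δ / 8, by positivity, by have := min_le_left r δ; linarith,
      by have := min_le_right r δ; linarith⟩
  let N : Q → Set (ℤ × ℤ) := fun e => {q | ∃ t, dist (emb h q) (α e t) ≤ 2 * h}
  let D : V → Set (ℤ × ℤ) := fun v => {q | dist (emb h q) (p v) ≤ 3 / 2 * r}
  let U : V → Set (ℤ × ℤ) := fun v => D v ∪ {q | (∀ w, q ∉ D w) ∧ ∃ e, a e = v ∧ q ∈ N e}
  let q : V → ℤ × ℤ := fun v => rnd h (p v)
  let B : V → Set (ℤ × ℤ) := fun v => {x | Reach (U v) (q v) x}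
  have hqD : ∀ v, q v ∈ D v := by
    intro v
    have := rnd_close hh (p v)
    show dist (emb h (rnd h (p v))) (p v) ≤ 3 / 2 * r
    linarith
  have hDB : ∀ v, D v ⊆ B v := by
    intro v x hx
    refine Reach.mono (X := D v) Set.subset_union_left ?_
    exact reach_ball hh (p v) _ _ (hqD v) hx
  have hBU : ∀ v, B v ⊆ U v := by
    intro v x hx
    rcases Relation.ReflTransGen.cases_tail hx with h | ⟨y, -, hy⟩
    · rw [h]; exact Or.inl (hqD v)
    · exact hy.2.1
  have hDdisj : ∀ u v x, x ∈ D u → x ∈ D v → u = v := by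
    intro u v x hu hv
    by_contra hne
    have h3 := hr1 u v hne
    have h4 := dist_triangle_left (p u) (p v) (emb h x)
    change Dist.dist _ _ ≤ _ at hu hv
    linarith
  have hUdisj : ∀ u v x, x ∈ U u → x ∈ U v → u = v := by
    rintro u v x (hu | ⟨hu, e, rfl, s, hs⟩) (hv | ⟨hv, e', rfl, s', hs'⟩)
    · exact hDdisj _ _ _ hu hv
    · exact absurd hu (hv _)
    · exact absurd hv (hu _)
    · by_contra hne
      have hee : e ≠ e' := by rintro rfl; exact hne rfl
      have hfar : ∀ w, 3 / 2 * r < dist (emb h x) (p w) := fun w => not_le.mp (hu w)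
      have h3 := hδ' e e' s s' hee
        (fun w => by
          have := hfar w
          have := dist_triangle (emb h x) (α e s) (p w)
          linarith)
        (fun w => by
          have := hfar w
          have := dist_triangle (emb h x) (α e' s') (p w)
          linarith)
      have := dist_triangle_left (α e s) (α e' s') (emb h x)
      linarith
  have hND : ∀ e w x, x ∈ N e → x ∈ D w → w = a e ∨ w = b e := by
    rintro e w x ⟨s, hs⟩ hw
    by_contra! hcon
    have h3 := hr2 e w s hcon.1 hcon.2
    have h4 := dist_triangle_left (α e s) (p w) (emb h x)
    change Dist.dist _ _ ≤ _ at hw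
    linarith
  have hUfin : ∀ v, (U v).Finite := by
    intro v
    have hcomp : IsCompact (Set.range p ∪ ⋃ e, Set.range (α e)) :=
      (Set.finite_range p).isCompact.union (isCompact_iUnion fun e => isCompact_range (hα e))
    obtain ⟨K, hK⟩ := hcomp.isBounded.exists_norm_le
    have hb : ∀ x ∈ U v, ‖emb h x‖ ≤ K + 2 * r := by
      rintro x (hx | ⟨-, e, -, s, hs⟩)
      · have h3 := hK (p v) (Or.inl ⟨v, rfl⟩)
        have h4 := norm_le_norm_add_norm_sub' (emb h x) (p v)
        change Dist.dist _ _ ≤ _ at hx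
        rw [dist_eq_norm] at hx
        linarith
      · have h3 := hK (α e s) (Or.inr (Set.mem_iUnion.mpr ⟨e, s, rfl⟩))
        have h4 := norm_le_norm_add_norm_sub' (emb h x) (α e s)
        rw [dist_eq_norm] at hs
        linarith
    obtain ⟨m, hm⟩ := exists_int_gt ((K + 2 * r) / h)
    refine (Set.finite_Icc ((-m, -m) : ℤ × ℤ) (m, m)).subset ?_
    intro x hx
    have h3 := hb x hx
    rw [div_lt_iff₀ hh] at hm
    rw [Prod.norm_def, max_le_iff] at h3
    simp only [emb, Real.norm_eq_abs, abs_le] at h3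
    have e1 : (-m : ℝ) ≤ x.1 := by nlinarith [h3.1.1]
    have e2 : (x.1 : ℝ) ≤ m := by nlinarith [h3.1.2]
    have e3 : (-m : ℝ) ≤ x.2 := by nlinarith [h3.2.1]
    have e4 : (x.2 : ℝ) ≤ m := by nlinarith [h3.2.2]
    exact ⟨⟨by exact_mod_cast e1, by exact_mod_cast e3⟩, ⟨by exact_mod_cast e2, by exact_mod_cast e4⟩⟩
  have hedge : ∀ e, ∃ x ∈ B (a e), ∃ y ∈ B (b e), GAdj x y := by
    intro e
    have hch := reach_path hh (α e) (hα e) 0 1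
    have key : ∀ x, Reach (N e) (q (a e)) x →
        x ∈ B (a e) ∨ ∃ x ∈ B (a e), ∃ y ∈ B (b e), GAdj x y := by
      intro x hx
      induction hx with
      | refl => exact Or.inl Relation.ReflTransGen.refl
      | @tail x y _ hxy ih =>
        rcases ih with ih | ih
        · by_cases hy : y ∈ U (a e)
          · exact Or.inl (Relation.ReflTransGen.tail ih ⟨hBU _ ih, hy, hxy.2.2⟩)
          · right
            have hyD : y ∈ D (b e) := by
              by_cases h3 : ∃ w, y ∈ D w
              · obtain ⟨w, hw⟩ := h3
                rcases hND e w y hxy.2.1 hw with rfl | rfl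
                · exact absurd (Or.inl hw) hy
                · exact hw
              · push Not at h3
                exact absurd (Or.inr ⟨h3, e, rfl, hxy.2.1⟩) hy
            exact ⟨x, ih, y, hDB _ hyD, hxy.2.2⟩
        · exact Or.inr ih
    rw [h0, h1] at hch
    rcases key _ hch with h3 | h3
    · exact absurd (hUdisj _ _ _ (hBU _ h3) (Or.inl (hqD (b e)))) (hab e)
    · exact h3
  choose x hx y hy g hg using hedge
  refine ⟨⟨B, q, ?_, fun v => (hUfin v).subset (hBU v),
    fun u v x hu hv => hUdisj u v x (hBU _ hu) (hBU _ hv), g, ?_⟩⟩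
  · intro v z hz
    change Reach (U v) (q v) z at hz
    induction hz with
    | refl => exact Relation.ReflTransGen.refl
    | tail h3 h4 ih => exact ih.tail ⟨h3, h3.tail h4, h4.2.2⟩
  · intro e
    rcases hg e with ⟨h3, h4⟩ | ⟨h3, h4⟩
    · exact ⟨a e, b e, hab e, he e, by rw [h3]; exact hx e, by rw [h4]; exact hy e⟩
    · exact ⟨b e, a e, (hab e).symm, by rw [he e]; exact Sym2.eq_swap, by rw [h3]; exact hy e,
        by rw [h4]; exact hx e⟩

end PlanarExt

namespace PlanarExt
open Classical
open scoped BigOperators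

theorem planar_gridModel {V : Type} [Fintype V] {G : SimpleGraph V} (hG : IsPlanar G)
    (Q : Finset (Sym2 V)) (hQ : ∀ e ∈ Q, e ∈ G.edgeSet) : Nonempty (GridModel Q) := by
  obtain ⟨p, γ, hp, hinj, hav, hdis⟩ := hG
  have hex : ∀ e : Q, ∃ a b, ∃ _ : G.Adj a b, e.1 = s(a, b) := by
    rintro ⟨e, he⟩
    have := hQ e he
    induction e with
    | _ a b => exact ⟨a, b, this, rfl⟩
  choose a b hab he using hex
  refine exists_gridModel Q p hp a b (fun e => (hab e).ne) he (fun e => γ _ _ (hab e))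
    (fun e => (γ _ _ (hab e)).continuous) (fun e => (γ _ _ (hab e)).source)
    (fun e => (γ _ _ (hab e)).target) ?_ ?_
  · intro e w s h1 h2 h3
    by_cases hs0 : s = 0
    · subst hs0
      rw [(γ _ _ (hab e)).source] at h3
      exact h1 (hp h3).symm
    by_cases hs1 : s = 1
    · subst hs1
      rw [(γ _ _ (hab e)).target] at h3
      exact h2 (hp h3).symm
    exact hav _ _ (hab e) s hs0 hs1 ⟨w, h3.symm⟩
  · intro e e' s s' hne heq
    by_cases hs0 : s = 0
    · exact ⟨a e, by rw [hs0]; exact (γ _ _ (hab e)).source⟩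
    by_cases hs1 : s = 1
    · exact ⟨b e, by rw [hs1]; exact (γ _ _ (hab e)).target⟩
    by_cases hs0' : s' = 0
    · exact ⟨a e', by rw [heq, hs0']; exact (γ _ _ (hab e')).source⟩
    by_cases hs1' : s' = 1
    · exact ⟨b e', by rw [heq, hs1']; exact (γ _ _ (hab e')).target⟩
    refine absurd heq (hdis _ _ _ _ (hab e) (hab e') ?_ s hs0 hs1 s' hs0' hs1')
    rw [← he, ← he]
    exact fun h => hne (Subtype.ext h)

end PlanarExt

namespace PlanarExt
open Classical
open scoped BigOperators

/-- degree of a vertex in a set of edges -/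
noncomputable def Dg {V : Type} (F : Finset (Sym2 V)) (v : V) : ℕ := (F.filter (v ∈ ·)).card

/-- list edge colourability of a set of edges -/
def Col {V : Type} (F : Finset (Sym2 V)) (L : Sym2 V → Finset ℕ) : Prop :=
  ∃ C : Sym2 V → ℕ, (∀ e ∈ F, C e ∈ L e) ∧ ∀ e ∈ F, ∀ f ∈ F, EdgeAdj e f → C e ≠ C f

/-- remaining list -/
noncomputable def rest {V : Type} (R : Finset (Sym2 V)) (L : Sym2 V → Finset ℕ) (C : Sym2 V → ℕ)
    (e : Sym2 V) : Finset ℕ := L e \ (R.filter (EdgeAdj e)).image C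

lemma edgeAdj_symm {V : Type} {e f : Sym2 V} (h : EdgeAdj e f) : EdgeAdj f e :=
  ⟨h.1.symm, h.2.imp fun _ h => h.symm⟩

lemma combine {V : Type} (R K : Finset (Sym2 V)) (L : Sym2 V → Finset ℕ) (C : Sym2 V → ℕ)
    (hC : (∀ e ∈ R, C e ∈ L e) ∧ ∀ e ∈ R, ∀ f ∈ R, EdgeAdj e f → C e ≠ C f)
    (hK : Col K (rest R L C)) : ∃ C' : Sym2 V → ℕ, ((∀ e ∈ R ∪ K, C' e ∈ L e) ∧
      ∀ e ∈ R ∪ K, ∀ f ∈ R ∪ K, EdgeAdj e f → C' e ≠ C' f) ∧ ∀ e ∈ R, C' e = C e := by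
  obtain ⟨C1, h1, h2⟩ := hK
  have key : ∀ e ∈ K, ∀ f ∈ R, EdgeAdj e f → C1 e ≠ C f := by
    intro e he f hf hef heq
    have := h1 e he
    simp only [rest, Finset.mem_sdiff, Finset.mem_image, Finset.mem_filter, not_exists] at this
    exact this.2 f ⟨⟨hf, hef⟩, heq.symm⟩
  refine ⟨fun e => if e ∈ R then C e else C1 e, ⟨?_, ?_⟩, fun e he => by simp [he]⟩
  · intro e he
    by_cases h : e ∈ R
    · simpa [h] using hC.1 e h
    · have he' : e ∈ K := by simpa [h] using he
      simp only [h, if_false]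
      exact (Finset.mem_sdiff.mp (h1 e he')).1
  · intro e he f hf hef
    by_cases h : e ∈ R <;> by_cases h' : f ∈ R <;> simp only [h, h', if_true, if_false]
    · exact hC.2 e h f h' hef
    · have hf' : f ∈ K := by simpa [h'] using hf
      exact (key f hf' e h (edgeAdj_symm hef)).symm
    · have he' : e ∈ K := by simpa [h] using he
      exact key e he' f h' hef
    · have hf' : f ∈ K := by simpa [h'] using hf
      have he' : e ∈ K := by simpa [h] using he
      exact h2 e he' f hf' hef

lemma card_rest {V : Type} (R : Finset (Sym2 V)) (L : Sym2 V → Finset ℕ) (C : Sym2 V → ℕ) (u v : V) :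
    (L s(u, v)).card ≤ (rest R L C s(u, v)).card + (Dg R u + Dg R v) := by
  have h1 : (L s(u, v)).card ≤ (rest R L C s(u, v)).card + ((R.filter (EdgeAdj s(u, v))).image C).card := by
    have := Finset.le_card_sdiff ((R.filter (EdgeAdj s(u, v))).image C) (L s(u, v))
    unfold rest
    omega
  have h2 : (R.filter (EdgeAdj s(u, v))).card ≤ Dg R u + Dg R v := by
    refine le_trans (Finset.card_le_card (t := R.filter (u ∈ ·) ∪ R.filter (v ∈ ·)) ?_)
      (Finset.card_union_le _ _)
    intro f hf
    obtain ⟨hfR, -, w, hw, hwf⟩ := Finset.mem_filter.mp hf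
    rcases Sym2.mem_iff.mp hw with rfl | rfl
    · exact Finset.mem_union_left _ (by simp [hfR, hwf])
    · exact Finset.mem_union_right _ (by simp [hfR, hwf])
  have := Finset.card_image_le (s := R.filter (EdgeAdj s(u, v))) (f := C)
  omega

/-- list colouring of even cycles -/
lemma cycle_list (m : ℕ) (hm : Even (m + 3)) (Λ : ZMod (m + 3) → Finset ℕ)
    (hΛ : ∀ i, 2 ≤ (Λ i).card) : ∃ f : ZMod (m + 3) → ℕ, (∀ i, f i ∈ Λ i) ∧ ∀ i, f i ≠ f (i + 1) := by
  have : ∀ i, ∃ T ⊆ Λ i, T.card = 2 := fun i => Finset.exists_subset_card_eq (hΛ i)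
  choose T hT hT2 using this
  suffices ∃ f : ZMod (m + 3) → ℕ, (∀ i, f i ∈ T i) ∧ ∀ i, f i ≠ f (i + 1) by
    obtain ⟨f, h1, h2⟩ := this
    exact ⟨f, fun i => hT i (h1 i), h2⟩
  have hval : ∀ y : ZMod (m + 3), (y.val + 1 < m + 3 ∧ (y + 1).val = y.val + 1) ∨
      (y.val = m + 2 ∧ (y + 1).val = 0) := by
    intro y
    have hy := ZMod.val_lt y
    have h1 : (y + 1).val = (y.val + 1) % (m + 3) := by
      rw [ZMod.val_add]
      congr 2
    by_cases h : y.val + 1 < m + 3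
    · left; exact ⟨h, by rw [h1, Nat.mod_eq_of_lt h]⟩
    · right
      have : y.val = m + 2 := by omega
      refine ⟨this, ?_⟩
      rw [h1, this, Nat.mod_self]
  by_cases hall : ∀ i, T i = T (i + 1)
  · have hc : ∀ k : ℕ, T (k : ZMod (m + 3)) = T 0 := by
      intro k
      induction k with
      | zero => simp
      | succ k ih => rw [Nat.cast_succ, ← hall, ih]
    obtain ⟨a, b, hab, hTab⟩ := Finset.card_eq_two.mp (hT2 0)
    have hc' : ∀ i, T i = {a, b} := by
      intro i
      rw [← hTab, ← hc i.val, ZMod.natCast_zmod_val]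
    refine ⟨fun x => if Even x.val then a else b, ?_, ?_⟩
    · intro i
      simp only [hc']
      split_ifs <;> simp
    · intro i
      rcases hval i with ⟨-, h⟩ | ⟨h0, h⟩
      · simp only [h, Nat.even_add_one]
        by_cases h' : Even i.val <;> simp [h', hab, hab.symm]
      · have : ¬ Even (m + 2) := by
          intro h; exact (Nat.even_add_one.mp hm) h
        simp [h, h0, this, hab.symm]
  · push Not at hall
    obtain ⟨i, hi⟩ := hall
    obtain ⟨c, hc1, hc2⟩ : ∃ c ∈ T (i + 1), c ∉ T i := by
      by_contra! hcon
      exact hi (Finset.eq_of_subset_of_card_le hcon (by rw [hT2, hT2])).symm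
    have hnext : ∀ (j : ℕ) (x : ℕ), ∃ y ∈ T (i + 1 + j), y ≠ x := by
      intro j x
      exact Finset.exists_mem_ne (by rw [hT2]; norm_num) x
    choose nx hnx1 hnx2 using hnext
    let g : ℕ → ℕ := fun j => Nat.rec c (fun j x => nx (j + 1) x) j
    have hg0 : g 0 = c := rfl
    have hgs : ∀ j, g (j + 1) = nx (j + 1) (g j) := fun j => rfl
    have hgm : ∀ j : ℕ, g j ∈ T (i + 1 + j) := by
      intro j
      cases j with
      | zero => simpa [hg0] using hc1
      | succ j => rw [hgs]; exact hnx1 _ _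
    refine ⟨fun x => g (x - (i + 1)).val, ?_, ?_⟩
    · intro x
      have := hgm (x - (i + 1)).val
      rwa [ZMod.natCast_zmod_val, add_sub_cancel] at this
    · intro x
      have e1 : x + 1 - (i + 1) = (x - (i + 1)) + 1 := by ring
      simp only [e1]
      rcases hval (x - (i + 1)) with ⟨-, h⟩ | ⟨h0, h⟩
      · rw [h, hgs]
        exact (hnx2 _ _).symm
      · rw [h, hg0]
        intro heq
        apply hc2
        rw [← heq]
        have := hgm (x - (i + 1)).val
        rw [ZMod.natCast_zmod_val, add_sub_cancel] at this
        have hx : x = i := by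
          have h5 : ((x - (i + 1)).val : ZMod (m + 3)) = ((m + 2 : ℕ) : ZMod (m + 3)) := by rw [h0]
          rw [ZMod.natCast_zmod_val] at h5
          have h6 : ((m + 3 : ℕ) : ZMod (m + 3)) = 0 := ZMod.natCast_self _
          push_cast at h5 h6
          linear_combination h5 + h6
        rwa [hx] at this ⊢

lemma two_ne (m : ℕ) : (2 : ZMod (m + 3)) ≠ 0 := by
  intro h
  have h1 : ((2 : ℕ) : ZMod (m + 3)) = 0 := by exact_mod_cast h
  rw [ZMod.natCast_eq_zero_iff] at h1
  have := Nat.le_of_dvd (by norm_num) h1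
  omega

lemma cyc_inj {V : Type} (m : ℕ) (φ : ZMod (m + 3) → V) (hφ : Function.Injective φ)
    (i j : ZMod (m + 3)) (h : s(φ i, φ (i + 1)) = s(φ j, φ (j + 1))) : i = j := by
  rcases Sym2.eq_iff.mp h with ⟨h1, -⟩ | ⟨h1, h2⟩
  · exact hφ h1
  · have e1 := hφ h1
    have e2 := hφ h2
    exact absurd (show (2 : ZMod (m + 3)) = 0 by linear_combination -e1 + e2) (two_ne m)

lemma cycle_col {V : Type} (m : ℕ) (hm : Even (m + 3)) (φ : ZMod (m + 3) → V)
    (hφ : Function.Injective φ) (L : Sym2 V → Finset ℕ)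
    (hL : ∀ i, 2 ≤ (L s(φ i, φ (i + 1))).card) :
    Col (Finset.univ.image fun i => s(φ i, φ (i + 1))) L := by
  obtain ⟨f, hf1, hf2⟩ := cycle_list m hm (fun i => L s(φ i, φ (i + 1))) hL
  have hinj : Function.Injective (fun i => s(φ i, φ (i + 1))) := cyc_inj m φ hφ
  refine ⟨fun e => f (Function.invFun (fun i => s(φ i, φ (i + 1))) e), ?_, ?_⟩
  · intro e he
    obtain ⟨i, -, rfl⟩ := Finset.mem_image.mp he
    have := Function.leftInverse_invFun hinj i
    beta_reduce at this ⊢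
    rw [this]
    exact hf1 i
  · intro e he e' he' hadj
    obtain ⟨i, -, rfl⟩ := Finset.mem_image.mp he
    obtain ⟨j, -, rfl⟩ := Finset.mem_image.mp he'
    have h1 := Function.leftInverse_invFun hinj i
    have h2 := Function.leftInverse_invFun hinj j
    beta_reduce at h1 h2 ⊢
    rw [h1, h2]
    obtain ⟨hne, w, hw1, hw2⟩ := hadj
    have hij : i ≠ j := by rintro rfl; exact hne rfl
    rcases Sym2.mem_iff.mp hw1 with rfl | rfl <;> rcases Sym2.mem_iff.mp hw2 with h | h
    · exact absurd (hφ h) hij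
    · rw [hφ h]; exact (hf2 j).symm
    · rw [← hφ h]; exact hf2 i
    · exact absurd (add_right_cancel (hφ h)) hij

/-- forests have few edges -/
lemma acyclic_count {V : Type} [Fintype V] (Q : Finset (Sym2 V)) (S : Finset V) (hS : S.Nonempty)
    (hd : ∀ e ∈ Q, ¬ e.IsDiag) (hQ : ∀ e ∈ Q, ∀ v ∈ e, v ∈ S)
    (hac : (fromEdgeSet (Q : Set (Sym2 V))).IsAcyclic) : Q.card + 1 ≤ S.card := by
  have h1 := finrank_ker_bd Q S hS hd hQ
  have hker : LinearMap.ker (bd Q) = ⊥ := by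
    rw [LinearMap.ker_eq_bot']
    intro c hc
    by_contra h0
    obtain ⟨⟨e, heQ⟩, he⟩ := Function.ne_iff.mp h0
    induction e using Sym2.ind with
    | _ u v =>
      have huv : u ≠ v := by simpa using hd _ heQ
      have hbr := isAcyclic_iff_forall_isBridge.mp hac
        (e := s(u, v)) (by simp [heQ, huv])
      rw [isBridge_iff] at hbr
      set Γ := (fromEdgeSet (Q : Set (Sym2 V))).deleteEdges {s(u, v)} with hΓ
      have hsum := sum_bd Q c (Finset.univ.filter fun w => Γ.Reachable u w)
      rw [hc] at hsum
      simp only [Pi.zero_apply, Finset.sum_const_zero] at hsum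
      rw [Finset.sum_eq_single ⟨s(u, v), heQ⟩] at hsum
      · rw [sum_mem_edge _ u v huv] at hsum
        simp [hbr] at hsum
        exact he hsum.symm
      · rintro ⟨f, hf⟩ - hne
        induction f using Sym2.ind with
        | _ x y =>
          have hxy : x ≠ y := by simpa using hd _ hf
          simp only
          rw [sum_mem_edge _ x y hxy]
          have hadj : Γ.Adj x y := by
            rw [hΓ, deleteEdges_adj]
            refine ⟨by simp [hf, hxy], fun h => hne (Subtype.ext h)⟩
          have : Γ.Reachable u x ↔ Γ.Reachable u y :=
            ⟨fun h => h.trans hadj.reachable, fun h => h.trans hadj.symm.reachable⟩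
          simp only [Finset.mem_filter, Finset.mem_univ, true_and, this]
          exact z2_add_self _
      · simp
  rw [hker, finrank_bot] at h1
  omega

end PlanarExt

namespace PlanarExt
open Classical
open scoped BigOperators

section core
set_option linter.unusedSectionVars false
variable {V : Type} [Fintype V]

lemma Dg_sdiff (F K : Finset (Sym2 V)) (hK : K ⊆ F) (v : V) : Dg (F \ K) v + Dg K v = Dg F v := by
  unfold Dg
  have : F.filter (v ∈ ·) = (F \ K).filter (v ∈ ·) ∪ K.filter (v ∈ ·) := by
    rw [← Finset.filter_union, Finset.sdiff_union_of_subset hK]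
  rw [this, Finset.card_union_of_disjoint]
  exact Finset.disjoint_filter_filter Finset.sdiff_disjoint

lemma Dg_mono {F K : Finset (Sym2 V)} (hK : K ⊆ F) (v : V) : Dg K v ≤ Dg F v :=
  Finset.card_le_card (Finset.filter_subset_filter _ hK)

lemma sum_Dg (F : Finset (Sym2 V)) (hd : ∀ e ∈ F, ¬ e.IsDiag) : ∑ v, Dg F v = 2 * F.card := by
  unfold Dg
  simp only [Finset.card_filter]
  rw [Finset.sum_comm, mul_comm, ← smul_eq_mul, ← Finset.sum_const]
  refine Finset.sum_congr rfl fun e he => ?_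
  induction e using Sym2.ind with
  | _ a b =>
    have hab : a ≠ b := by simpa using hd _ he
    rw [← Finset.card_filter]
    rw [Finset.card_eq_two]
    exact ⟨a, b, hab, by ext; simp⟩

/-- edges with an end in `A`, when `A` is independent. -/
lemma card_star (F : Finset (Sym2 V)) (A : Finset V)
    (hA : ∀ a b, s(a, b) ∈ F → a ∈ A → b ∉ A) :
    (F.filter fun e => ∃ v ∈ A, v ∈ e).card = ∑ v ∈ A, Dg F v := by
  unfold Dg
  rw [← Finset.card_biUnion]
  · congr 1
    ext e
    simp only [Finset.mem_filter, Finset.mem_biUnion]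
    tauto
  · intro x hx y hy hxy
    rw [Function.onFun, Finset.disjoint_left]
    intro e h1 h2
    simp only [Finset.mem_filter] at h1 h2
    have : e = s(x, y) := ((Sym2.mem_and_mem_iff hxy).mp ⟨h1.2, h2.2⟩)
    subst this
    exact hA x y h1.1 hx hy

lemma Dg_pos {F : Finset (Sym2 V)} {e : Sym2 V} (he : e ∈ F) {v : V} (hv : v ∈ e) : 0 < Dg F v :=
  Finset.card_pos.mpr ⟨e, by simp [he, hv]⟩

/-- Discharging inequalities. -/
lemma ineq_bip (F : Finset (Sym2 V)) (hF : ∀ Q ⊆ F, Nonempty (GridModel Q)) (j s : ℕ) (hjs : 2 * j < s)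
    (hs : ∀ u v, s(u, v) ∈ F → s ≤ Dg F u + Dg F v) :
    0 ≤ ∑ v ∈ Finset.univ.filter (fun v => 0 < Dg F v),
      ((if Dg F v ≤ j then 2 - (Dg F v : ℤ) else 0) + (if s - j ≤ Dg F v then 2 else 0)) := by
  set W := Finset.univ.filter (fun v => 0 < Dg F v) with hW
  set A := W.filter (fun v => Dg F v ≤ j)
  set B := W.filter (fun v => s - j ≤ Dg F v)
  have hind : ∀ a b, s(a, b) ∈ F → a ∈ A → b ∈ B ∧ b ∉ A := by
    intro a b hab ha
    have h1 := hs a b hab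
    have h2 := (Finset.mem_filter.mp ha).2
    have h3 : b ∈ W := by simp [hW, Dg_pos hab]
    refine ⟨Finset.mem_filter.mpr ⟨h3, by omega⟩, fun hb => ?_⟩
    have h4 := (Finset.mem_filter.mp hb).2
    omega
  have hcard := card_star F A (fun a b h1 h2 => (hind a b h1 h2).2)
  rw [Finset.sum_add_distrib, ← Finset.sum_filter, ← Finset.sum_filter]
  change 0 ≤ ∑ v ∈ A, (2 - (Dg F v : ℤ)) + ∑ v ∈ B, 2
  rw [Finset.sum_sub_distrib, Finset.sum_const, Finset.sum_const, ← Nat.cast_sum, ← hcard]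
  rcases A.eq_empty_or_nonempty with hA | hA
  · simp [hA]
  · obtain ⟨M⟩ := hF (F.filter fun e => ∃ v ∈ A, v ∈ e) (Finset.filter_subset _ _)
    have := M.bound2 (A ∪ B) (hA.mono Finset.subset_union_left) (by
      intro e he v hv
      obtain ⟨he, w, hwA, hwe⟩ := Finset.mem_filter.mp he
      by_cases hvw : v = w
      · exact Finset.mem_union_left _ (hvw ▸ hwA)
      · have : e = s(w, v) := ((Sym2.mem_and_mem_iff (Ne.symm hvw)).mp ⟨hwe, hv⟩)
        subst this
        exact Finset.mem_union_right _ (hind _ _ he hwA).1) A (by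
      intro a b hab
      obtain ⟨he, w, hwA, hwe⟩ := Finset.mem_filter.mp hab
      simp only [Finset.mem_coe]
      constructor
      · exact fun h => (hind _ _ he h).2
      · intro h
        rcases Sym2.mem_iff.mp hwe with rfl | rfl
        · exact hwA
        · exact absurd hwA h)
    have h2 := Finset.card_union_le A B
    simp only [nsmul_eq_mul]
    zify at this h2
    linarith

lemma ineq_total (F : Finset (Sym2 V)) (hF : ∀ Q ⊆ F, Nonempty (GridModel Q)) (hne : F.Nonempty)
    (hd : ∀ e ∈ F, ¬ e.IsDiag) :
    0 < ∑ v ∈ Finset.univ.filter (fun v => 0 < Dg F v), (6 - (Dg F v : ℤ)) := by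
  obtain ⟨M⟩ := hF F (Finset.Subset.refl _)
  have hS : (Finset.univ.filter (fun v => 0 < Dg F v)).Nonempty := by
    obtain ⟨e, he⟩ := hne
    induction e using Sym2.ind with
    | _ a b => exact ⟨a, by simp [Dg_pos he]⟩
  have h1 := M.bound3 _ hS (fun e he v hv => by simp [Dg_pos he hv])
  have h2 := sum_Dg F hd
  have h3 : ∑ v ∈ Finset.univ.filter (fun v => 0 < Dg F v), Dg F v ≤ ∑ v, Dg F v :=
    Finset.sum_le_sum_of_subset (Finset.subset_univ _)
  rw [Finset.sum_sub_distrib, Finset.sum_const, ← Nat.cast_sum, nsmul_eq_mul]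
  omega

/-- The hypothesis on lists. -/
def Big (k M : ℕ) (F : Finset (Sym2 V)) (L : Sym2 V → Finset ℕ) : Prop :=
  ∀ e ∈ F, M + k ≤ (L e).card ∧ ∀ v ∈ e, Dg F v + k ≤ (L e).card

lemma Big.mono {k M : ℕ} {F K : Finset (Sym2 V)} {L : Sym2 V → Finset ℕ} (h : Big k M F L)
    (hK : K ⊆ F) : Big k M K L := by
  intro e he
  refine ⟨(h e (hK he)).1, fun v hv => ?_⟩
  have := (h e (hK he)).2 v hv
  have := Dg_mono hK v
  omega

lemma col_of_col (F K : Finset (Sym2 V)) (hK : K ⊆ F) (L : Sym2 V → Finset ℕ)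
    (h1 : Col (F \ K) L) (h2 : ∀ C, Col K (rest (F \ K) L C)) : Col F L := by
  obtain ⟨C, hC⟩ := h1
  obtain ⟨C', hC', -⟩ := combine (F \ K) K L C hC (h2 C)
  rw [Finset.sdiff_union_of_subset hK] at hC'
  exact ⟨C', hC'⟩

/-- An edge that can be coloured last. -/
lemma edge_red (F : Finset (Sym2 V)) (L : Sym2 V → Finset ℕ) (hn : ¬ Col F L) (u v : V)
    (huv : s(u, v) ∈ F) (hrec : Col (F \ {s(u, v)}) L) :
    (L s(u, v)).card + 2 ≤ Dg F u + Dg F v := by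
  by_contra hcon
  push Not at hcon
  apply hn
  have hsub : ({s(u, v)} : Finset (Sym2 V)) ⊆ F := by simpa using huv
  refine col_of_col F {s(u, v)} hsub L hrec fun C => ?_
  have h1 := card_rest (F \ {s(u, v)}) L C u v
  have h2 := Dg_sdiff F _ hsub u
  have h3 := Dg_sdiff F _ hsub v
  have h4 : 0 < Dg {s(u, v)} u := Dg_pos (Finset.mem_singleton_self _) (by simp)
  have h5 : 0 < Dg {s(u, v)} v := Dg_pos (Finset.mem_singleton_self _) (by simp)
  have h6 : 0 < (rest (F \ {s(u, v)}) L C s(u, v)).card := by omega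
  obtain ⟨c, hc⟩ := Finset.card_pos.mp h6
  refine ⟨fun _ => c, ?_, ?_⟩
  · intro e he
    rw [Finset.mem_singleton.mp he]
    exact hc
  · intro e he f hf hef
    rw [Finset.mem_singleton] at he hf
    exact absurd (he.trans hf.symm) hef.1

lemma ineq_cycle (k M : ℕ) (F : Finset (Sym2 V)) (hd : ∀ e ∈ F, ¬ e.IsDiag) (L : Sym2 V → Finset ℕ)
    (hB : Big k M F L) (hn : ¬ Col F L) (hkM : k + 2 < M)
    (hrec : ∀ K ⊆ F, K.Nonempty → Col (F \ K) L)
    (hs : ∀ u v, s(u, v) ∈ F → M + k + 2 ≤ Dg F u + Dg F v) :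
    0 ≤ ∑ v ∈ Finset.univ.filter (fun v => 0 < Dg F v),
      ((if M ≤ Dg F v then (1 : ℤ) else 0) + (if Dg F v = k + 2 then -(k + 1 : ℤ) else 0)) := by
  set W := Finset.univ.filter (fun v => 0 < Dg F v) with hW
  set A := W.filter (fun v => Dg F v = k + 2) with hAdef
  set B := W.filter (fun v => M ≤ Dg F v)
  have hind : ∀ a b, s(a, b) ∈ F → a ∈ A → b ∈ B ∧ b ∉ A := by
    intro a b hab ha
    have h1 := hs a b hab
    have h2 := (Finset.mem_filter.mp ha).2
    have h3 : b ∈ W := by simp [hW, Dg_pos hab]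
    refine ⟨Finset.mem_filter.mpr ⟨h3, by omega⟩, fun hb => ?_⟩
    have h4 := (Finset.mem_filter.mp hb).2
    omega
  have hcard := card_star F A (fun a b h1 h2 => (hind a b h1 h2).2)
  have hsumA : ∑ v ∈ A, Dg F v = A.card * (k + 2) := by
    rw [← smul_eq_mul, ← Finset.sum_const]
    exact Finset.sum_congr rfl fun v hv => (Finset.mem_filter.mp hv).2
  rw [hsumA] at hcard
  rw [Finset.sum_add_distrib, ← Finset.sum_filter, ← Finset.sum_filter]
  change 0 ≤ ∑ v ∈ B, (1 : ℤ) + ∑ v ∈ A, (-(k + 1 : ℤ))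
  rw [Finset.sum_const, Finset.sum_const]
  set Q := F.filter fun e => ∃ v ∈ A, v ∈ e with hQdef
  rcases A.eq_empty_or_nonempty with hA | hA
  · simp [hA]
  have hac : (fromEdgeSet (Q : Set (Sym2 V))).IsAcyclic := by
    rw [isAcyclic_iff_free_cycleGraph]
    rintro n hn3 ⟨f⟩
    obtain ⟨m, rfl⟩ : ∃ m, n = m + 3 := ⟨n - 3, by omega⟩
    let φ : ZMod (m + 3) → V := fun i => f i
    have hφ : Function.Injective φ := f.injective
    have hadj : ∀ i, s(φ i, φ (i + 1)) ∈ Q := by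
      intro i
      have h1 : ∀ x y : Fin (m + 3), y = x + 1 → (cycleGraph (m + 3)).Adj x y := by
        rintro x _ rfl
        rw [cycleGraph_adj]
        right
        exact add_sub_cancel_left x 1
      let y : ZMod (m + 3) := i + 1
      have h2 := f.toHom.map_adj (h1 i y rfl)
      rw [fromEdgeSet_adj] at h2
      exact h2.1
    have halt : ∀ i, φ i ∈ A ↔ φ (i + 1) ∉ A := by
      intro i
      obtain ⟨he, w, hwA, hwe⟩ := Finset.mem_filter.mp (hadj i)
      constructor
      · exact fun h => (hind _ _ he h).2
      · intro h
        rcases Sym2.mem_iff.mp hwe with rfl | rfl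
        · exact hwA
        · exact absurd hwA h
    have heven : Even (m + 3) := by
      have : ∀ j : ℕ, Even j ↔ (φ (j : ZMod (m + 3)) ∈ A ↔ φ 0 ∈ A) := by
        intro j
        induction j with
        | zero => simp
        | succ j ih =>
          have := halt j
          rw [Nat.even_add_one, ih, Nat.cast_succ]
          tauto
      rw [this, ZMod.natCast_self]
    apply hn
    set K := Finset.univ.image fun i => s(φ i, φ (i + 1)) with hK
    have hKF : K ⊆ F := by
      intro e he
      obtain ⟨i, -, rfl⟩ := Finset.mem_image.mp he
      exact (Finset.mem_filter.mp (hadj i)).1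
    have hDK : ∀ i, 2 ≤ Dg K (φ i) := by
      intro i
      have hsub : ({s(φ i, φ (i + 1)), s(φ (i - 1), φ (i - 1 + 1))} : Finset (Sym2 V)) ⊆
          K.filter (φ i ∈ ·) := by
        intro e he
        rw [Finset.mem_insert, Finset.mem_singleton] at he
        rw [Finset.mem_filter]
        rcases he with rfl | rfl
        · exact ⟨Finset.mem_image_of_mem _ (Finset.mem_univ i), by simp⟩
        · exact ⟨Finset.mem_image_of_mem (fun i => s(φ i, φ (i + 1))) (Finset.mem_univ (i - 1)),
            by simp⟩
      refine le_trans ?_ (Finset.card_le_card hsub)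
      rw [Finset.card_pair]
      intro h
      have := cyc_inj m φ hφ _ _ h
      have h1 : (1 : ZMod (m + 3)) = 0 := by linear_combination this
      exact two_ne m (by linear_combination 2 * h1)
    refine col_of_col F K hKF L (hrec K hKF ⟨_, Finset.mem_image_of_mem _ (Finset.mem_univ 0)⟩)
      fun C => cycle_col m heven φ hφ _ fun i => ?_
    have h1 := card_rest (F \ K) L C (φ i) (φ (i + 1))
    have h2 := Dg_sdiff F K hKF (φ i)
    have h3 := Dg_sdiff F K hKF (φ (i + 1))
    have h4 := hDK i
    have h5 := hDK (i + 1)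
    have hiF := (Finset.mem_filter.mp (hadj i)).1
    have h6 := (hB _ hiF).2 (φ i) (by simp)
    have h7 := (hB _ hiF).2 (φ (i + 1)) (by simp)
    have h8 : Dg F (φ i) = k + 2 ∨ Dg F (φ (i + 1)) = k + 2 := by
      by_cases h : φ i ∈ A
      · exact Or.inl (Finset.mem_filter.mp h).2
      · right
        have : φ (i + 1) ∈ A := by
          by_contra h'
          exact h ((halt i).mpr h')
        exact (Finset.mem_filter.mp this).2
    omega
  have := acyclic_count Q (A ∪ B) (hA.mono Finset.subset_union_left)
    (fun e he => hd e (Finset.mem_filter.mp he).1) (by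
      intro e he v hv
      obtain ⟨he, w, hwA, hwe⟩ := Finset.mem_filter.mp he
      by_cases hvw : v = w
      · exact Finset.mem_union_left _ (hvw ▸ hwA)
      · have : e = s(w, v) := ((Sym2.mem_and_mem_iff (Ne.symm hvw)).mp ⟨hwe, hv⟩)
        subst this
        exact Finset.mem_union_right _ (hind _ _ he hwA).1) hac
  have h2 := Finset.card_union_le A B
  rw [hcard] at this
  simp only [nsmul_eq_mul]
  zify at this h2
  linarith

lemma core (k M : ℕ) (hkM : k = 1 ∧ M = 9 ∨ k = 0 ∧ M = 16) (L : Sym2 V → Finset ℕ) :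
    ∀ (n : ℕ) (F : Finset (Sym2 V)), F.card = n → (∀ Q ⊆ F, Nonempty (GridModel Q)) →
      (∀ e ∈ F, ¬ e.IsDiag) → Big k M F L → Col F L := by
  intro n
  induction n using Nat.strong_induction_on with
  | _ n ih =>
  intro F hFn hF hd hB
  by_contra hn
  have hne : F.Nonempty := by
    rw [Finset.nonempty_iff_ne_empty]
    rintro rfl
    exact hn ⟨fun _ => 0, by simp, by simp⟩
  have hrec : ∀ K ⊆ F, K.Nonempty → Col (F \ K) L := by
    intro K hK hKne
    have hlt : (F \ K).card < F.card := by
      rw [Finset.card_sdiff_of_subset hK]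
      have := hKne.card_pos
      have := Finset.card_le_card hK
      omega
    exact ih _ (hFn ▸ hlt) (F \ K) rfl (fun Q hQ => hF Q (hQ.trans Finset.sdiff_subset))
      (fun e he => hd e (Finset.sdiff_subset he)) (hB.mono Finset.sdiff_subset)
  have hred : ∀ u v, s(u, v) ∈ F → (L s(u, v)).card + 2 ≤ Dg F u + Dg F v := fun u v huv =>
    edge_red F L hn u v huv (hrec _ (by simpa using huv) (by simp))
  have hs : ∀ u v, s(u, v) ∈ F → M + k + 2 ≤ Dg F u + Dg F v := by
    intro u v huv
    have := hred u v huv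
    have := (hB _ huv).1
    omega
  have hmin : ∀ v, 0 < Dg F v → k + 2 ≤ Dg F v := by
    intro v hv
    obtain ⟨e, he⟩ := Finset.card_pos.mp hv
    obtain ⟨he, hve⟩ := Finset.mem_filter.mp he
    obtain ⟨u, rfl⟩ := hve
    have := hred v u he
    have := (hB _ he).2 u (by simp)
    omega
  have i0 := ineq_total F hF hne hd
  have i1 := ineq_cycle k M F hd L hB hn (by omega) hrec hs
  have i5 := ineq_bip F hF 5 _ (by omega) hs
  have i4 := ineq_bip F hF 4 _ (by omega) hs
  have i3 := ineq_bip F hF 3 _ (by omega) hs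
  set W := Finset.univ.filter (fun v => 0 < Dg F v) with hW
  rcases hkM with ⟨rfl, rfl⟩ | ⟨rfl, rfl⟩
  · have hfin : ∀ v ∈ W, 3 * (6 - (Dg F v : ℤ)) +
      ((if Dg F v ≤ 5 then 2 - (Dg F v : ℤ) else 0) + (if 9 + 1 + 2 - 5 ≤ Dg F v then 2 else 0)) +
      2 * ((if Dg F v ≤ 4 then 2 - (Dg F v : ℤ) else 0) + (if 9 + 1 + 2 - 4 ≤ Dg F v then 2 else 0)) +
      3 * ((if 9 ≤ Dg F v then (1 : ℤ) else 0) + (if Dg F v = 1 + 2 then -((1 : ℕ) + 1 : ℤ) else 0))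
      ≤ 0 := by
      intro v hv
      have := hmin v (Finset.mem_filter.mp hv).2
      push_cast
      split_ifs <;> omega
    have := Finset.sum_nonpos hfin
    simp only [Finset.sum_add_distrib, ← Finset.mul_sum] at this i0 i1 i5 i4
    linarith
  · have hfin : ∀ v ∈ W, 3 * (6 - (Dg F v : ℤ)) +
      ((if Dg F v ≤ 5 then 2 - (Dg F v : ℤ) else 0) + (if 16 + 0 + 2 - 5 ≤ Dg F v then 2 else 0)) +
      2 * ((if Dg F v ≤ 4 then 2 - (Dg F v : ℤ) else 0) + (if 16 + 0 + 2 - 4 ≤ Dg F v then 2 else 0)) +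
      6 * ((if Dg F v ≤ 3 then 2 - (Dg F v : ℤ) else 0) + (if 16 + 0 + 2 - 3 ≤ Dg F v then 2 else 0)) +
      12 * ((if 16 ≤ Dg F v then (1 : ℤ) else 0) + (if Dg F v = 0 + 2 then -((0 : ℕ) + 1 : ℤ) else 0))
      ≤ 0 := by
      intro v hv
      have := hmin v (Finset.mem_filter.mp hv).2
      push_cast
      split_ifs <;> omega
    have := Finset.sum_nonpos hfin
    simp only [Finset.sum_add_distrib, ← Finset.mul_sum] at this i0 i1 i5 i4 i3
    linarith

end core

end PlanarExt

namespace PlanarExt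
open Classical
open scoped BigOperators

lemma Dg_le_edeg {V : Type} [Fintype V] (G : SimpleGraph V) (v : V) :
    Dg (Finset.univ.filter fun e => e ∈ G.edgeSet) v ≤ edeg G v := by
  unfold Dg edeg
  rw [Set.ncard_eq_toFinset_card']
  refine le_trans (Finset.card_le_card ?_) (Finset.card_image_le (f := fun w => s(v, w)))
  intro e he
  simp only [Finset.mem_filter, Finset.mem_univ, true_and] at he
  obtain ⟨he, w, rfl⟩ := he
  simp only [Finset.mem_image, Set.mem_toFinset]
  exact ⟨w, he, rfl⟩

theorem main {V : Type} [Fintype V] (Δ d t : ℕ)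
    (hdt : d ≤ t) (htd : t ≤ d + 3)
    (hΔ0 : d = t → 16 + d ≤ Δ)
    (hΔ1 : d + 1 = t → 9 + d ≤ Δ)
    (hΔ2 : d + 2 = t → 8 + d ≤ Δ)
    (hΔ3 : d + 3 = t → 7 + d ≤ Δ)
    (G : SimpleGraph V) (hplanar : IsPlanar G) (hdeg : ∀ v, edeg G v ≤ Δ)
    (L : Sym2 V → Finset ℕ) (hL : ∀ e ∈ G.edgeSet, Δ + t ≤ (L e).card)
    (H : SimpleGraph V) (hHG : H ≤ G) (hHdeg : ∀ v, edeg H v ≤ d)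
    (C₀ : Sym2 V → ℕ) (hC₀ : IsListEdgeColoring H L C₀) :
    ExtendsTo G H L C₀ := by
  set E := Finset.univ.filter fun e => e ∈ G.edgeSet with hE
  set R := Finset.univ.filter fun e => e ∈ H.edgeSet with hR
  have hRE : R ⊆ E := by
    intro e he
    simp only [hE, hR, Finset.mem_filter, Finset.mem_univ, true_and] at *
    exact edgeSet_mono hHG he
  have hmE : ∀ e, e ∈ E ↔ e ∈ G.edgeSet := by simp [hE]
  have hmR : ∀ e, e ∈ R ↔ e ∈ H.edgeSet := by simp [hR]
  have hdR : ∀ v, Dg R v ≤ d := fun v => (Dg_le_edeg H v).trans (hHdeg v)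
  have hdF : ∀ v, Dg (E \ R) v + Dg R v ≤ Δ := fun v => by
    rw [Dg_sdiff E R hRE]
    exact (Dg_le_edeg G v).trans (hdeg v)
  have hcol : Col (E \ R) (rest R L C₀) := by
    have hgrid : ∀ Q ⊆ E \ R, Nonempty (GridModel Q) := fun Q hQ =>
      planar_gridModel hplanar Q fun e he => (hmE e).mp (Finset.mem_sdiff.mp (hQ he)).1
    have hdiag : ∀ e ∈ E \ R, ¬ e.IsDiag := fun e he =>
      G.not_isDiag_of_mem_edgeSet ((hmE e).mp (Finset.mem_sdiff.mp he).1)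
    have hlist : ∀ u v, s(u, v) ∈ E \ R → Δ + t ≤ (rest R L C₀ s(u, v)).card + (Dg R u + Dg R v) :=
      fun u v h => (hL _ ((hmE _).mp (Finset.mem_sdiff.mp h).1)).trans (card_rest R L C₀ u v)
    by_cases h : d = t
    · refine core 0 16 (Or.inr ⟨rfl, rfl⟩) _ _ _ rfl hgrid hdiag ?_
      intro e he
      induction e using Sym2.ind with
      | _ u v =>
        have h1 := hlist u v he
        have h2 := hdR u
        have h3 := hdR v
        have h4 := hdF u
        have h5 := hdF v
        have h6 := hΔ0 h
        refine ⟨by omega, fun w hw => ?_⟩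
        rcases Sym2.mem_iff.mp hw with rfl | rfl <;> omega
    · refine core 1 9 (Or.inl ⟨rfl, rfl⟩) _ _ _ rfl hgrid hdiag ?_
      intro e he
      induction e using Sym2.ind with
      | _ u v =>
        have h1 := hlist u v he
        have h2 := hdR u
        have h3 := hdR v
        have h4 := hdF u
        have h5 := hdF v
        refine ⟨by omega, fun w hw => ?_⟩
        rcases Sym2.mem_iff.mp hw with rfl | rfl <;> omega
  obtain ⟨C', ⟨h1, h2⟩, h3⟩ := combine R (E \ R) L C₀
    ⟨fun e he => hC₀.1 e ((hmR e).mp he),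
      fun e he f hf => hC₀.2 e ((hmR e).mp he) f ((hmR f).mp hf)⟩ hcol
  rw [Finset.union_sdiff_of_subset hRE] at h1 h2
  exact ⟨C', ⟨fun e he => h1 e ((hmE e).mpr he),
    fun e he f hf => h2 e ((hmE e).mpr he) f ((hmE f).mpr hf)⟩, fun e he => h3 e ((hmR e).mpr he)⟩

end PlanarExt

/-- Theorem 4, case 2: for positive integers Δ, d, t with t - 3 ≤ d ≤ t and Δ
large enough depending on t - d, any proper L-edge-precolouring (lists of size ≥ Δ + t) of a
subgraph of maximum degree ≤ d of a planar graph of maximum degree ≤ Δ extends. -/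
theorem statement19 {V : Type} [Fintype V] (Δ d t : ℕ)
    (hΔ : 1 ≤ Δ) (hd : 1 ≤ d) (ht : 1 ≤ t)
    (hdt : d ≤ t) (htd : t ≤ d + 3)
    (hΔ0 : d = t → 16 + d ≤ Δ)
    (hΔ1 : d + 1 = t → 9 + d ≤ Δ)
    (hΔ2 : d + 2 = t → 8 + d ≤ Δ)
    (hΔ3 : d + 3 = t → 7 + d ≤ Δ)
    (G : SimpleGraph V) (hplanar : IsPlanar G) (hdeg : ∀ v, edeg G v ≤ Δ)
    (L : Sym2 V → Finset ℕ) (hL : ∀ e ∈ G.edgeSet, Δ + t ≤ (L e).card)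
    (H : SimpleGraph V) (hHG : H ≤ G) (hHdeg : ∀ v, edeg H v ≤ d)
    (C₀ : Sym2 V → ℕ) (hC₀ : IsListEdgeColoring H L C₀) :
    ExtendsTo G H L C₀ := by
  exact PlanarExt.main Δ d t hdt htd hΔ0 hΔ1 hΔ2 hΔ3 G hplanar hdeg L hL H hHG hHdeg C₀ hC₀
end
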